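/- Let p, q be positive integers. For every integer m ≥ 2, the number of multichains π_1 ≤ π_2 ≤ … ≤ π_{m-1} in NC^B(p,q) equals C(mp, p) · C(mq, q) + Σ_{c=1}^{p} 2c · C(mp, p-c) · C(mq, q+c); equivalently, the zeta polynomial of NC^B(p,q) is Z(m) = C(mp,p)C(mq,q) + Σ_{c=1}^{p} 2c C(mp, p-c) C(mq, q+c). -/

import Mathlib

/-!  Common setup: annular non-crossing partitions of type B, following
Goulden–Nica–Oancea, "Enumerative properties of NC^(B)(p,q)". -/

/-- The underlying set `{±1, …, ±n}`, realized inside `ℤ`. -/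
def signedSet (n : ℕ) : Set ℤ := {x : ℤ | x ≠ 0 ∧ |x| ≤ (n : ℤ)}

/-- Membership in the hyperoctahedral group `B_n`, realized as the permutations of `ℤ`
that commute with negation and fix every point outside `{±1, …, ±n}`. -/
def inB (n : ℕ) (π : Equiv.Perm ℤ) : Prop :=
  (∀ x : ℤ, π (-x) = -(π x)) ∧ ∀ x : ℤ, x ∉ signedSet n → π x = x

/-- The set of generators of `B_n`:
`(i,j)(-i,-j)`, `(i,-j)(-i,j)` for `1 ≤ i ≠ j ≤ n`, and `(i,-i)` for `1 ≤ i ≤ n`. -/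
def genB (n : ℕ) : Set (Equiv.Perm ℤ) :=
  {π | (∃ i j : ℤ, 1 ≤ i ∧ i ≤ (n : ℤ) ∧ 1 ≤ j ∧ j ≤ (n : ℤ) ∧ i ≠ j ∧
          π = Equiv.swap i j * Equiv.swap (-i) (-j)) ∨
       (∃ i j : ℤ, 1 ≤ i ∧ i ≤ (n : ℤ) ∧ 1 ≤ j ∧ j ≤ (n : ℤ) ∧ i ≠ j ∧
          π = Equiv.swap i (-j) * Equiv.swap (-i) j) ∨
       (∃ i : ℤ, 1 ≤ i ∧ i ≤ (n : ℤ) ∧ π = Equiv.swap i (-i))}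

/-- The length function `ℓ_B` on `B_n`: the least `k` such that `τ` is a product of `k`
generators from `genB n` (the empty product being the identity). -/
noncomputable def lenB (n : ℕ) (τ : Equiv.Perm ℤ) : ℕ :=
  sInf {k : ℕ | ∃ l : List (Equiv.Perm ℤ),
    l.length = k ∧ (∀ g ∈ l, g ∈ genB n) ∧ l.prod = τ}

/-- The partial order on `B_n`:  `τ ≤ σ` iff `ℓ_B(σ) = ℓ_B(τ) + ℓ_B(τ⁻¹σ)`. -/
def leB (n : ℕ) (τ σ : Equiv.Perm ℤ) : Prop :=
  lenB n σ = lenB n τ + lenB n (τ⁻¹ * σ)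

/-- The permutation `γ_{p,q} = (1,…,p,-1,…,-p)(p+1,…,p+q,-(p+1),…,-(p+q))`. -/
def gammaPQ (p q : ℕ) : Equiv.Perm ℤ :=
  (((List.range p).map fun i => ((i : ℤ) + 1)) ++
      ((List.range p).map fun i => -((i : ℤ) + 1))).formPerm *
    (((List.range q).map fun i => ((p : ℤ) + (i : ℤ) + 1)) ++
      ((List.range q).map fun i => -((p : ℤ) + (i : ℤ) + 1))).formPerm

/-- The long cycle `γ_n = (1,…,n,-1,…,-n)` of `B_n` (disc case). -/
def gammaDisc (n : ℕ) : Equiv.Perm ℤ :=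
  (((List.range n).map fun i => ((i : ℤ) + 1)) ++
    ((List.range n).map fun i => -((i : ℤ) + 1))).formPerm

/-- The annular non-crossing permutations of type B: `S^B_nc(p,q) = [ε, γ_{p,q}] ⊆ B_{p+q}`. -/
def SncB (p q : ℕ) : Set (Equiv.Perm ℤ) :=
  {τ | inB (p + q) τ ∧ leB (p + q) τ (gammaPQ p q)}

/-- The orbit of `x` under the permutation `τ`. -/
def permOrbit (τ : Equiv.Perm ℤ) (x : ℤ) : Set ℤ := {y | ∃ m : ℤ, (τ ^ m) x = y}

/-- The partition `Ω(τ)` of `{±1,…,±n}` into orbits of `τ`. -/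
def orbitsOn (n : ℕ) (τ : Equiv.Perm ℤ) : Set (Set ℤ) :=
  {A | ∃ x ∈ signedSet n, A = permOrbit τ x}

/-- The negation `-A` of a set `A ⊆ ℤ`. -/
def negSet (A : Set ℤ) : Set ℤ := {x | -x ∈ A}

/-- The partition `Ω̃(τ)`, obtained from `Ω(τ)` by merging all inversion-invariant orbits
(orbits `A` with `A = -A`) into a single block. -/
def omegaTilde (n : ℕ) (τ : Equiv.Perm ℤ) : Set (Set ℤ) :=
  {A | A ∈ orbitsOn n τ ∧ negSet A ≠ A} ∪
    {B | B = ⋃₀ {A | A ∈ orbitsOn n τ ∧ negSet A = A} ∧ B.Nonempty}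

/-- The annular non-crossing partitions of type B: `NC^B(p,q) = {Ω̃(τ) : τ ∈ S^B_nc(p,q)}`. -/
def NCB (p q : ℕ) : Set (Set (Set ℤ)) :=
  {π | ∃ τ ∈ SncB p q, π = omegaTilde (p + q) τ}

/-- The type B non-crossing partitions of the disc: `NC^B(n) = {Ω̃(τ) : τ ∈ B_n, τ ≤ γ_n}`. -/
def NCBdisc (n : ℕ) : Set (Set (Set ℤ)) :=
  {π | ∃ τ, inB n τ ∧ leB n τ (gammaDisc n) ∧ π = omegaTilde n τ}

/-- Reverse refinement order on partitions: every block of `π` is contained in a block of `ρ`. -/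
def refines (π ρ : Set (Set ℤ)) : Prop := ∀ A ∈ π, ∃ B ∈ ρ, A ⊆ B

/-- The rank of a partition of `{±1,…,±n}`:
`n` minus half the number of blocks `A` with `A ≠ -A`. -/
noncomputable def rankNCB (n : ℕ) (π : Set (Set ℤ)) : ℕ :=
  n - {A | A ∈ π ∧ negSet A ≠ A}.ncard / 2

/-- The inner point set `{±(p+1), …, ±(p+q)}`. -/
def innerSet (p q : ℕ) : Set ℤ := {x : ℤ | (p : ℤ) < |x| ∧ |x| ≤ (p : ℤ) + (q : ℤ)}

/-- The connectivity of `π ∈ NC^B(p,q)`: half the number of blocks `A` with `A ≠ -A`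
meeting both `{±1,…,±p}` and `{±(p+1),…,±(p+q)}`. -/
noncomputable def connectivity (p q : ℕ) (π : Set (Set ℤ)) : ℕ :=
  {A | A ∈ π ∧ negSet A ≠ A ∧ (A ∩ signedSet p).Nonempty ∧
    (A ∩ innerSet p q).Nonempty}.ncard / 2

/-- The number of exterior pairs of blocks `{A, -A}` (with `A ≠ -A`, `A ⊆ {±1,…,±p}`). -/
noncomputable def extPairs (p : ℕ) (π : Set (Set ℤ)) : ℕ :=
  {A | A ∈ π ∧ negSet A ≠ A ∧ A ⊆ signedSet p}.ncard / 2

/-- The number of interior pairs of blocks `{A, -A}`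
(with `A ≠ -A`, `A ⊆ {±(p+1),…,±(p+q)}`). -/
noncomputable def intPairs (p q : ℕ) (π : Set (Set ℤ)) : ℕ :=
  {A | A ∈ π ∧ negSet A ≠ A ∧ A ⊆ innerSet p q}.ncard / 2

/-- The minimum `0̂` of `NC^B(p,q)` (with `n = p+q`): the partition into singletons. -/
def botNCB (n : ℕ) : Set (Set ℤ) := {A | ∃ x ∈ signedSet n, A = {x}}

/-- The maximum `1̂` of `NC^B(p,q)` (with `n = p+q`): the partition with a single block. -/
def topNCB (n : ℕ) : Set (Set ℤ) := {signedSet n}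

/-- The orbit of `x` under the subgroup generated by `{τ, γ}`. -/
def jointOrbit (τ γ : Equiv.Perm ℤ) (x : ℤ) : Set ℤ :=
  {y | ∃ g ∈ Subgroup.closure ({τ, γ} : Set (Equiv.Perm ℤ)), g x = y}

/-- The orbits on `{±1,…,±n}` of the subgroup generated by `{τ, γ}`. -/
def jointOrbitsOn (n : ℕ) (τ γ : Equiv.Perm ℤ) : Set (Set ℤ) :=
  {Y | ∃ x ∈ signedSet n, Y = jointOrbit τ γ x}


set_option linter.unusedSectionVars false
set_option linter.unusedSimpArgs false

section AbstractLin
variable {G : Type*} [Group G] {V : Type*} [AddCommGroup V] [Module ℝ V] [FiniteDimensional ℝ V]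

def fixS (ρ : G →* Module.End ℝ V) (g : G) : Submodule ℝ V := LinearMap.ker (ρ g - 1)

noncomputable def LL (ρ : G →* Module.End ℝ V) (g : G) : ℕ := Module.finrank ℝ (LinearMap.range (ρ g - 1))

open Module

lemma frk_map_inj {f : Module.End ℝ V} (hf : Function.Injective f) (S : Submodule ℝ V) :
    finrank ℝ (S.map f) = finrank ℝ S :=
  (LinearEquiv.finrank_eq (Submodule.equivMapOfInjective f hf S)).symm

lemma mem_fixS (ρ : G →* Module.End ℝ V) (g : G) (v : V) : v ∈ fixS ρ g ↔ ρ g v = v := by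
  simp [fixS, sub_eq_zero]

lemma LL_add (ρ : G →* Module.End ℝ V) (g : G) : LL ρ g + finrank ℝ (fixS ρ g) = finrank ℝ V :=
  LinearMap.finrank_range_add_finrank_ker _

lemma fixS_inf (ρ : G →* Module.End ℝ V) (g h : G) : fixS ρ g ⊓ fixS ρ h ≤ fixS ρ (g * h) := by
  intro v hv
  simp only [Submodule.mem_inf, mem_fixS] at *
  simp [hv.1, hv.2]

lemma fixS_inv (ρ : G →* Module.End ℝ V) (g : G) : fixS ρ g⁻¹ = fixS ρ g := by
  have key : ∀ g : G, fixS ρ g ≤ fixS ρ g⁻¹ := by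
    intro g v hv
    simp only [mem_fixS] at *
    conv_lhs => rw [← hv]
    rw [← Module.End.mul_apply, ← map_mul]; simp
  apply le_antisymm
  · simpa using key g⁻¹
  · exact key g

lemma LL_mul (ρ : G →* Module.End ℝ V) (g h : G) : LL ρ (g * h) ≤ LL ρ g + LL ρ h := by
  have h1 := LL_add ρ g
  have h2 := LL_add ρ h
  have h3 := LL_add ρ (g * h)
  have h4 := Submodule.finrank_sup_add_finrank_inf_eq (fixS ρ g) (fixS ρ h)
  have h5 := Submodule.finrank_mono (fixS_inf ρ g h)
  have h6 := Submodule.finrank_le (fixS ρ g ⊔ fixS ρ h)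
  omega

lemma LL_conj (ρ : G →* Module.End ℝ V) (g h : G) : LL ρ (g * h * g⁻¹) = LL ρ h := by
  have key : ∀ g h : G, finrank ℝ (fixS ρ h) ≤ finrank ℝ (fixS ρ (g * h * g⁻¹)) := by
    intro g h
    have hinj : Function.Injective (ρ g) := by
      intro a b hab
      have := congrArg (ρ g⁻¹) hab
      rw [← Module.End.mul_apply, ← Module.End.mul_apply, ← map_mul] at this
      simpa using this
    rw [← frk_map_inj hinj]
    · apply Submodule.finrank_mono
      rintro _ ⟨v, hv, rfl⟩
      simp only [SetLike.mem_coe, mem_fixS] at *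
      rw [← Module.End.mul_apply, ← map_mul]
      simp [hv]
  have h1 := key g h
  have h2 := key g⁻¹ (g * h * g⁻¹)
  have e : g⁻¹ * (g * h * g⁻¹) * g⁻¹⁻¹ = h := by group
  rw [e] at h2
  have h3 := LL_add ρ h
  have h4 := LL_add ρ (g * h * g⁻¹)
  omega

lemma LL_one (ρ : G →* Module.End ℝ V) : LL ρ 1 = 0 := by
  simp [LL]

/-- order implies inclusion of fixed spaces -/
lemma fix_le_of_LL (ρ : G →* Module.End ℝ V) (g h : G) (e : LL ρ h = LL ρ g + LL ρ (g⁻¹ * h)) :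
    fixS ρ h ≤ fixS ρ g := by
  have h1 := LL_add ρ g
  have h2 := LL_add ρ (g⁻¹ * h)
  have h3 := LL_add ρ h
  have h4 := Submodule.finrank_sup_add_finrank_inf_eq (fixS ρ g) (fixS ρ (g⁻¹ * h))
  have h5 := fixS_inf ρ g (g⁻¹ * h)
  have h6 := Submodule.finrank_le (fixS ρ g ⊔ fixS ρ (g⁻¹ * h))
  rw [mul_inv_cancel_left] at h5
  have := Submodule.eq_of_le_of_finrank_le h5 (by omega)
  rw [← this]
  exact inf_le_left

variable (ρ : G →* Module.End ℝ V) (B : LinearMap.BilinForm ℝ V)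

lemma range_eq_orth (hs : ∀ v w, B v w = B w v) (hpos : ∀ v, B v v = 0 → v = 0)
    (hinv : ∀ g v w, B (ρ g v) (ρ g w) = B v w) (g : G) :
    LinearMap.range (ρ g - 1) = B.orthogonal (fixS ρ g) := by
  have hrefl : B.IsRefl := fun v w h => by rw [hs]; exact h
  have hnd : B.Nondegenerate := by
    refine (LinearMap.IsRefl.nondegenerate_iff_separatingLeft hrefl).2 ?_
    intro v hv
    exact hpos v (hv v)
  have hle : LinearMap.range (ρ g - 1) ≤ B.orthogonal (fixS ρ g) := by
    rintro _ ⟨w, rfl⟩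
    rw [LinearMap.BilinForm.mem_orthogonal_iff]
    intro z hz
    rw [mem_fixS] at hz
    have := hinv g z w
    rw [hz] at this
    simp [this]
  apply Submodule.eq_of_le_of_finrank_le hle
  have h1 := LinearMap.BilinForm.finrank_orthogonal hnd (fixS ρ g)
  have h2 := LL_add ρ g
  unfold LL at h2
  omega

/-- Brady--Watt -/
lemma brady_watt (hs : ∀ v w, B v w = B w v) (hpos : ∀ v, B v v = 0 → v = 0)
    (hinv : ∀ g v w, B (ρ g v) (ρ g w) = B v w) (C a b : G) (hC : fixS ρ C = ⊥)
    (ha : LL ρ C = LL ρ a + LL ρ (a⁻¹ * C)) (hb : LL ρ C = LL ρ b + LL ρ (b⁻¹ * C))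
    (hab : fixS ρ b ≤ fixS ρ a) : LL ρ b = LL ρ a + LL ρ (a⁻¹ * b) := by
  have hCr : ∀ x : G, ∀ y ∈ fixS ρ (x⁻¹ * C), ρ C y = ρ x y := by
    intro x y hy
    rw [mem_fixS] at hy
    have : C = x * (x⁻¹ * C) := by group
    conv_lhs => rw [this, map_mul, Module.End.mul_apply, hy]
  have hinj : Function.Injective (ρ C - 1 : Module.End ℝ V) := by
    rw [← LinearMap.ker_eq_bot]; exact hC
  have hm : LinearMap.range (ρ a - 1) ≤ LinearMap.range (ρ b - 1) := by
    rw [range_eq_orth ρ B hs hpos hinv, range_eq_orth ρ B hs hpos hinv]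
    exact LinearMap.BilinForm.orthogonal_le hab
  have hmap : ∀ x : G, (fixS ρ (x⁻¹ * C)).map (ρ C - 1) ≤ LinearMap.range (ρ x - 1) := by
    rintro x _ ⟨y, hy, rfl⟩
    exact ⟨y, by simp [hCr x y hy]⟩
  have la := LL_add ρ a
  have lb := LL_add ρ b
  have lC := LL_add ρ C
  have laC := LL_add ρ (a⁻¹ * C)
  have lbC := LL_add ρ (b⁻¹ * C)
  have lab := LL_add ρ (a⁻¹ * b)
  rw [hC, finrank_bot] at lC
  have hmapb : (fixS ρ (b⁻¹ * C)).map (ρ C - 1) = LinearMap.range (ρ b - 1) := by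
    apply Submodule.eq_of_le_of_finrank_le (hmap b)
    rw [frk_map_inj hinj]
    change LL ρ b ≤ _
    omega
  have hsub : fixS ρ (a⁻¹ * C) ≤ fixS ρ (b⁻¹ * C) := by
    intro y hy
    have : (ρ C - 1) y ∈ (fixS ρ (b⁻¹ * C)).map (ρ C - 1) := by
      rw [hmapb]; exact hm (hmap a ⟨y, hy, rfl⟩)
    obtain ⟨z, hz, hzy⟩ := this
    rwa [← hinj hzy]
  have hfix : fixS ρ b ⊔ fixS ρ (a⁻¹ * C) ≤ fixS ρ (a⁻¹ * b) := by
    apply sup_le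
    · intro y hy
      have h1 := hab hy
      rw [← fixS_inv] at h1
      rw [mem_fixS] at *
      rw [map_mul, Module.End.mul_apply, hy, h1]
    · intro y hy
      have h1 := hCr a y hy
      have h2 := hCr b y (hsub hy)
      rw [mem_fixS, map_mul, Module.End.mul_apply, ← h2, h1, ← Module.End.mul_apply, ← map_mul]
      simp
  have hdis : fixS ρ b ⊓ fixS ρ (a⁻¹ * C) = ⊥ := by
    rw [eq_bot_iff, ← hC]
    intro y hy
    have := fixS_inf ρ a (a⁻¹ * C) ⟨hab hy.1, hy.2⟩
    rwa [mul_inv_cancel_left] at this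
  have h4 := Submodule.finrank_sup_add_finrank_inf_eq (fixS ρ b) (fixS ρ (a⁻¹ * C))
  rw [hdis, finrank_bot] at h4
  have h5 := Submodule.finrank_mono hfix
  have h6 := LL_mul ρ a (a⁻¹ * b)
  rw [mul_inv_cancel_left] at h6
  omega

lemma LL_refl_le (r : G) (α : V) (h : ∀ v, ∃ k : ℝ, ρ r v = v + k • α) : LL ρ r ≤ 1 := by
  unfold LL
  have : LinearMap.range (ρ r - 1) ≤ Submodule.span ℝ {α} := by
    rintro _ ⟨v, rfl⟩
    obtain ⟨k, hk⟩ := h v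
    rw [Submodule.mem_span_singleton]
    exact ⟨k, by simp [hk]⟩
  exact (Submodule.finrank_mono this).trans (finrank_span_le_card _ |>.trans (by simp))

lemma LL_refl_lt (hs : ∀ v w, B v w = B w v) (hpos : ∀ v, B v v = 0 → v = 0)
    (hinv : ∀ g v w, B (ρ g v) (ρ g w) = B v w) (r σ : G) (α : V) (hα : α ≠ 0)
    (hr : ρ r α = -α) (h : ∀ v, ∃ k : ℝ, ρ r v = v + k • α)
    (hval : ∀ v ∈ fixS ρ σ, ρ r v = v) : LL ρ (r * σ) < LL ρ σ := by
  have hle : fixS ρ σ ≤ fixS ρ (r * σ) := by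
    intro v hv
    have := hval v hv
    rw [mem_fixS] at *
    rw [map_mul, Module.End.mul_apply, hv, this]
  have hα' : α ∈ LinearMap.range (ρ σ - 1) := by
    rw [range_eq_orth ρ B hs hpos hinv, LinearMap.BilinForm.mem_orthogonal_iff]
    intro z hz
    have h1 := hinv r z α
    rw [hval z hz, hr] at h1
    simp only [map_neg] at h1
    linarith
  obtain ⟨w, hw⟩ := hα'
  have hσw : ρ σ w = w + α := by
    simp at hw; rw [← hw]; abel
  have hαα : B α α ≠ 0 := fun h => hα (hpos α h)
  have e1 := hinv σ w w
  rw [hσw] at e1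
  simp only [map_add, LinearMap.add_apply] at e1
  rw [hs α w] at e1
  obtain ⟨k, hk⟩ := h w
  have e2 := hinv r w α
  rw [hr, hk] at e2
  simp only [map_neg, map_add, map_smul, LinearMap.add_apply, LinearMap.smul_apply, smul_eq_mul] at e2
  have hk1 : k = 1 := by
    have : (k - 1) * B α α = 0 := by linarith
    rcases mul_eq_zero.1 this with h | h
    · linarith
    · exact absurd h hαα
  have hwfix : w ∈ fixS ρ (r * σ) := by
    rw [mem_fixS, map_mul, Module.End.mul_apply, hσw, map_add, hr, hk, hk1]; simp
  have hlt : fixS ρ σ < fixS ρ (r * σ) := by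
    refine lt_of_le_of_ne hle (fun he => ?_)
    rw [← he, mem_fixS, hσw] at hwfix
    exact hα (by simpa using hwfix)
  have h1 := Submodule.finrank_lt_finrank_of_lt hlt
  have h2 := LL_add ρ σ
  have h3 := LL_add ρ (r * σ)
  omega

lemma LL_valid (r σ : G) (hr2 : r * r = 1) (h1 : LL ρ r ≤ 1) (h : LL ρ (r * σ) < LL ρ σ) :
    ∀ v ∈ fixS ρ σ, ρ r v = v := by
  have hri : r⁻¹ = r := inv_eq_of_mul_eq_one_right hr2
  have h2 := LL_mul ρ r (r⁻¹ * σ)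
  rw [mul_inv_cancel_left, hri] at h2
  have := fix_le_of_LL ρ r σ (by rw [hri]; omega)
  intro v hv
  exact (mem_fixS ρ r v).1 (this hv)

end AbstractLin

set_option linter.unusedSectionVars false
set_option linter.unusedSimpArgs false

lemma neg_mem_signed {n : ℕ} {x : ℤ} : -x ∈ signedSet n ↔ x ∈ signedSet n := by
  simp [signedSet]

lemma inB_maps {n : ℕ} {π : Equiv.Perm ℤ} (h : inB n π) (x : ℤ) :
    π x ∈ signedSet n ↔ x ∈ signedSet n := by
  constructor
  · intro hx
    by_contra hc
    rw [h.2 x hc] at hx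
    exact hc hx
  · intro hx
    by_contra hc
    have := h.2 _ hc
    have := π.injective this
    rw [this] at hc
    exact hc hx

def Bsub (n : ℕ) : Subgroup (Equiv.Perm ℤ) where
  carrier := {π | inB n π}
  one_mem' := ⟨fun _ => rfl, fun _ _ => rfl⟩
  mul_mem' := by
    intro a b ha hb
    refine ⟨fun x => ?_, fun x hx => ?_⟩
    · simp [ha.1, hb.1]
    · simp [hb.2 x hx, ha.2 x hx]
  inv_mem' := by
    intro a ha
    refine ⟨fun x => ?_, fun x hx => ?_⟩
    · rw [Equiv.Perm.inv_eq_iff_eq, ha.1]; simp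
    · rw [Equiv.Perm.inv_eq_iff_eq, ha.2 x hx]

lemma mem_Bsub {n : ℕ} {π : Equiv.Perm ℤ} : π ∈ Bsub n ↔ inB n π := Iff.rfl

lemma inB_one (n : ℕ) : inB n 1 := (Bsub n).one_mem
lemma inB_mul {n : ℕ} {a b : Equiv.Perm ℤ} (ha : inB n a) (hb : inB n b) : inB n (a * b) :=
  (Bsub n).mul_mem ha hb
lemma inB_inv {n : ℕ} {a : Equiv.Perm ℤ} (ha : inB n a) : inB n a⁻¹ := (Bsub n).inv_mem ha

def Wn (n : ℕ) : Submodule ℝ (ℤ → ℝ) where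
  carrier := {v | (∀ a, v (-a) = -v a) ∧ ∀ a, a ∉ signedSet n → v a = 0}
  zero_mem' := by simp
  add_mem' := by
    rintro a b ⟨h1, h2⟩ ⟨h3, h4⟩
    refine ⟨fun x => ?_, fun x hx => ?_⟩
    · simp [h1, h3]; ring
    · simp [h2 x hx, h4 x hx]
  smul_mem' := by
    rintro c a ⟨h1, h2⟩
    refine ⟨fun x => ?_, fun x hx => ?_⟩
    · simp [h1]
    · simp [h2 x hx]

lemma signed_sub_Icc {n : ℕ} {a : ℤ} (h : a ∈ signedSet n) : a ∈ Finset.Icc (-(n:ℤ)) n := by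
  have := h.2
  rw [abs_le] at this
  simpa using this

instance Wn_fd (n : ℕ) : FiniteDimensional ℝ (Wn n) := by
  let f : (Wn n) →ₗ[ℝ] (Finset.Icc (-(n:ℤ)) n → ℝ) :=
    { toFun := fun v a => v.1 a
      map_add' := fun _ _ => rfl
      map_smul' := fun _ _ => rfl }
  apply FiniteDimensional.of_injective f
  intro v w h
  ext a
  by_cases ha : a ∈ signedSet n
  · exact congrFun h ⟨a, signed_sub_Icc ha⟩
  · rw [v.2.2 a ha, w.2.2 a ha]

def rhoB (n : ℕ) : Bsub n →* Module.End ℝ (Wn n) where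
  toFun σ :=
    { toFun := fun v => ⟨fun a => v.1 (σ.1⁻¹ a), by
        have hi := inB_inv σ.2
        refine ⟨fun a => ?_, fun a ha => ?_⟩
        · simp only []
          rw [hi.1, v.2.1]
        · apply v.2.2
          rwa [inB_maps hi]⟩
      map_add' := fun _ _ => rfl
      map_smul' := fun _ _ => rfl }
  map_one' := by ext; rfl
  map_mul' := by
    intro a b
    ext v x
    simp [mul_inv_rev]

lemma rhoB_apply (n : ℕ) (σ : Bsub n) (v : Wn n) (a : ℤ) : (rhoB n σ v).1 a = v.1 (σ.1⁻¹ a) := rfl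

noncomputable def formB (n : ℕ) : LinearMap.BilinForm ℝ (Wn n) :=
  LinearMap.mk₂ ℝ (fun v w => ∑ a ∈ Finset.Icc (-(n:ℤ)) n, v.1 a * w.1 a)
    (by intros; simp [add_mul, Finset.sum_add_distrib])
    (by intros; simp [Finset.mul_sum, mul_assoc])
    (by intros; simp [mul_add, Finset.sum_add_distrib])
    (by intros; simp [Finset.mul_sum, mul_left_comm])

lemma formB_apply (n : ℕ) (v w : Wn n) :
    formB n v w = ∑ a ∈ Finset.Icc (-(n:ℤ)) n, v.1 a * w.1 a := rfl

lemma formB_symm (n : ℕ) (v w : Wn n) : formB n v w = formB n w v := by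
  simp [formB_apply, mul_comm]

lemma formB_pos (n : ℕ) (v : Wn n) (h : formB n v v = 0) : v = 0 := by
  rw [formB_apply, Finset.sum_eq_zero_iff_of_nonneg (fun a _ => mul_self_nonneg _)] at h
  ext a
  by_cases ha : a ∈ signedSet n
  · simpa using h a (signed_sub_Icc ha)
  · exact v.2.2 a ha

lemma inB_Icc {n : ℕ} {π : Equiv.Perm ℤ} (h : inB n π) (x : ℤ) :
    π x ∈ Finset.Icc (-(n:ℤ)) n ↔ x ∈ Finset.Icc (-(n:ℤ)) n := by
  by_cases hx : x ∈ signedSet n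
  · have := (inB_maps h x).2 hx
    simp [signed_sub_Icc hx, signed_sub_Icc this, -Finset.mem_Icc]
  · rw [h.2 x hx]

lemma formB_inv (n : ℕ) (g : Bsub n) (v w : Wn n) :
    formB n (rhoB n g v) (rhoB n g w) = formB n v w := by
  simp only [formB_apply, rhoB_apply]
  refine Finset.sum_equiv (g.1⁻¹ : Equiv.Perm ℤ) ?_ ?_
  · intro i
    exact (inB_Icc (inB_inv g.2) i).symm
  · intros; rfl

/-- same block relation -/
def appr (σ : Equiv.Perm ℤ) (x y : ℤ) : Prop :=
  ∀ v : ℤ → ℝ, (∀ a, v (-a) = -v a) → (∀ a, v (σ a) = v a) → v x = v y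

lemma mem_fixB (n : ℕ) (σ : Bsub n) (v : Wn n) :
    v ∈ fixS (rhoB n) σ ↔ ∀ a, v.1 (σ.1 a) = v.1 a := by
  rw [← fixS_inv, mem_fixS, Subtype.ext_iff, funext_iff]
  simp only [rhoB_apply]
  simp

lemma appr_iff (n : ℕ) (σ : Bsub n) (x y : ℤ) (hx : x ∈ signedSet n) (hy : y ∈ signedSet n) :
    appr σ.1 x y ↔ ∀ v ∈ fixS (rhoB n) σ, v.1 x = v.1 y := by
  classical
  constructor
  · intro h v hv
    rw [mem_fixB] at hv
    exact h v.1 v.2.1 hv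
  · intro h v h1 h2
    let w : Wn n := ⟨fun a => if a ∈ signedSet n then v a else 0, by
      refine ⟨fun a => ?_, fun a ha => by simp [ha]⟩
      simp only [neg_mem_signed]
      split_ifs <;> simp [h1]⟩
    have hw : w ∈ fixS (rhoB n) σ := by
      rw [mem_fixB]
      intro a
      simp only [w, inB_maps σ.2, h2]
    have := h w hw
    simpa [w, hx, hy] using this

/-- the reflection `((x,y))` -/
def rf (x y : ℤ) : Equiv.Perm ℤ :=
  if y = -x then Equiv.swap x (-x) else Equiv.swap x y * Equiv.swap (-x) (-y)

lemma rf_apply {x y : ℤ} (hx : x ≠ 0) (hy : y ≠ 0) (hxy : x ≠ y) (a : ℤ) :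
    rf x y a = if a = x then y else if a = y then x else if a = -x then -y else
      if a = -y then -x else a := by
  unfold rf
  split_ifs <;> simp only [Equiv.Perm.mul_apply, Equiv.swap_apply_def] <;> split_ifs <;> omega

lemma rf_inB {n : ℕ} {x y : ℤ} (hx : x ∈ signedSet n) (hy : y ∈ signedSet n) (hxy : x ≠ y) :
    inB n (rf x y) := by
  have h1 := hx.1
  have h2 := hy.1
  refine ⟨fun a => ?_, fun a ha => ?_⟩
  · rw [rf_apply h1 h2 hxy, rf_apply h1 h2 hxy]
    split_ifs <;> omega
  · rw [rf_apply h1 h2 hxy]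
    have h3 : a ≠ x := fun h => ha (h ▸ hx)
    have h4 : a ≠ y := fun h => ha (h ▸ hy)
    have h5 : a ≠ -x := fun h => ha (h ▸ neg_mem_signed.2 hx)
    have h6 : a ≠ -y := fun h => ha (h ▸ neg_mem_signed.2 hy)
    simp [h3, h4, h5, h6]

lemma rf_sq {x y : ℤ} (hx : x ≠ 0) (hy : y ≠ 0) (hxy : x ≠ y) : rf x y * rf x y = 1 := by
  ext a
  rw [Equiv.Perm.mul_apply, rf_apply hx hy hxy, rf_apply hx hy hxy a, Equiv.Perm.one_apply]
  split_ifs <;> omega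

lemma rf_inv {x y : ℤ} (hx : x ≠ 0) (hy : y ≠ 0) (hxy : x ≠ y) : (rf x y)⁻¹ = rf x y :=
  inv_eq_of_mul_eq_one_right (rf_sq hx hy hxy)

lemma rf_comm {x y : ℤ} (hx : x ≠ 0) (hy : y ≠ 0) (hxy : x ≠ y) : rf x y = rf y x := by
  ext a
  rw [rf_apply hx hy hxy, rf_apply hy hx hxy.symm]
  split_ifs <;> omega

lemma rf_neg {x y : ℤ} (hx : x ≠ 0) (hy : y ≠ 0) (hxy : x ≠ y) : rf (-x) (-y) = rf x y := by
  ext a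
  rw [rf_apply hx hy hxy, rf_apply (by simpa) (by simpa) (by simpa)]
  split_ifs <;> omega

def rfB {n : ℕ} {x y : ℤ} (hx : x ∈ signedSet n) (hy : y ∈ signedSet n) (hxy : x ≠ y) : Bsub n :=
  ⟨rf x y, rf_inB hx hy hxy⟩

lemma rfB_root {n : ℕ} {x y : ℤ} (hx : x ∈ signedSet n) (hy : y ∈ signedSet n) (hxy : x ≠ y) :
    ∃ α : Wn n, α ≠ 0 ∧ rhoB n (rfB hx hy hxy) α = -α ∧
      ∀ v, ∃ k : ℝ, rhoB n (rfB hx hy hxy) v = v + k • α := by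
  classical
  have h1 := hx.1
  have h2 := hy.1
  have hin : ∀ a, a ∉ signedSet n → a ≠ x ∧ a ≠ y ∧ a ≠ -x ∧ a ≠ -y := by
    intro a ha
    refine ⟨fun h => ha (h ▸ hx), fun h => ha (h ▸ hy), fun h => ha (h ▸ neg_mem_signed.2 hx),
      fun h => ha (h ▸ neg_mem_signed.2 hy)⟩
  let α : Wn n := ⟨fun a => if a = x then 1 else if a = y then -1 else if a = -x then -1 else
    if a = -y then 1 else 0, by
      refine ⟨fun a => ?_, fun a ha => ?_⟩
      · simp only []
        split_ifs <;> first | omega | simp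
      · obtain ⟨h3, h4, h5, h6⟩ := hin a ha
        simp [h3, h4, h5, h6]⟩
  have hα : ∀ a, α.1 a = if a = x then 1 else if a = y then -1 else if a = -x then -1 else
    if a = -y then 1 else 0 := fun a => rfl
  have hr : ∀ (v : Wn n) a, (rhoB n (rfB hx hy hxy) v).1 a = v.1 (rf x y a) := by
    intro v a
    rw [rhoB_apply]
    change v.1 ((rf x y)⁻¹ a) = _
    rw [rf_inv h1 h2 hxy]
  refine ⟨α, ?_, ?_, ?_⟩
  · intro h
    have := congrArg (fun v : Wn n => v.1 x) h
    simp [hα] at this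
  · ext a
    rw [hr]
    change _ = - α.1 a
    rw [hα, hα, rf_apply h1 h2 hxy]
    split_ifs <;> first | omega | simp
  · intro v
    refine ⟨v.1 y - v.1 x, ?_⟩
    ext a
    rw [hr]
    change _ = v.1 a + (v.1 y - v.1 x) * α.1 a
    have e1 := v.2.1 x
    have e2 := v.2.1 y
    rw [hα, rf_apply h1 h2 hxy]
    split_ifs with c1 c2 c3 c4
    · subst c1; ring
    · subst c2; ring
    · subst c3; rw [e1, e2]; ring
    · subst c4; rw [e1, e2]; ring
    · ring

lemma gen_rf {n : ℕ} {g : Equiv.Perm ℤ} :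
    g ∈ genB n ↔ ∃ x y, x ∈ signedSet n ∧ y ∈ signedSet n ∧ x ≠ y ∧ g = rf x y := by
  constructor
  · rintro (⟨i, j, h1, h2, h3, h4, h5, rfl⟩ | ⟨i, j, h1, h2, h3, h4, h5, rfl⟩ | ⟨i, h1, h2, rfl⟩)
    · refine ⟨i, j, ⟨by omega, by rw [abs_le]; omega⟩, ⟨by omega, by rw [abs_le]; omega⟩, h5, ?_⟩
      rw [rf, if_neg (by omega)]
    · refine ⟨i, -j, ⟨by omega, by rw [abs_le]; omega⟩, ⟨by omega, by rw [abs_le]; omega⟩, by omega, ?_⟩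
      rw [rf, if_neg (by omega), neg_neg]
    · refine ⟨i, -i, ⟨by omega, by rw [abs_le]; omega⟩, ⟨by omega, by rw [abs_le]; omega⟩, by omega, ?_⟩
      rw [rf, if_pos rfl]
  · have key : ∀ x y, 0 < x → x ∈ signedSet n → y ∈ signedSet n → x ≠ y → rf x y ∈ genB n := by
      intro x y h0 hx hy hxy
      have h1 := hx.2
      have h2 := hy.2
      have h3 := hy.1
      rw [abs_le] at h1 h2
      by_cases e : y = -x
      · right; right
        exact ⟨x, by omega, by omega, by rw [rf, if_pos e]⟩
      · rcases lt_or_gt_of_ne h3 with h4 | h4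
        · right; left
          refine ⟨x, -y, by omega, by omega, by omega, by omega, by omega, ?_⟩
          rw [rf, if_neg e, neg_neg]
        · left
          refine ⟨x, y, by omega, by omega, by omega, by omega, by omega, ?_⟩
          rw [rf, if_neg e]
    rintro ⟨x, y, hx, hy, hxy, rfl⟩
    rcases lt_or_gt_of_ne hx.1 with h | h
    · rw [← rf_neg hx.1 hy.1 hxy]
      exact key _ _ (by omega) (neg_mem_signed.2 hx) (neg_mem_signed.2 hy) (by omega)
    · exact key x y h hx hy hxy

lemma gen_LL {n : ℕ} {x y : ℤ} (hx : x ∈ signedSet n) (hy : y ∈ signedSet n) (hxy : x ≠ y) :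
    LL (rhoB n) (rfB hx hy hxy) ≤ 1 := by
  obtain ⟨α, -, -, h⟩ := rfB_root hx hy hxy
  exact LL_refl_le _ _ α h

lemma rf_fix_iff {n : ℕ} {x y : ℤ} (hx : x ∈ signedSet n) (hy : y ∈ signedSet n) (hxy : x ≠ y)
    (v : Wn n) : rhoB n (rfB hx hy hxy) v = v ↔ v.1 x = v.1 y := by
  have h1 := hx.1
  have h2 := hy.1
  have e := mem_fixB n (rfB hx hy hxy) v
  rw [mem_fixS] at e
  rw [e]
  change (∀ a, v.1 (rf x y a) = v.1 a) ↔ _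
  constructor
  · intro h
    have := h x
    rw [rf_apply h1 h2 hxy, if_pos rfl] at this
    exact this.symm
  · intro h a
    have e1 := v.2.1 x
    have e2 := v.2.1 y
    rw [rf_apply h1 h2 hxy]
    split_ifs with c1 c2 c3 c4
    · subst c1; exact h.symm
    · subst c2; exact h
    · subst c3; rw [e1, e2, h]
    · subst c4; rw [e1, e2, h]
    · rfl

lemma LL_rf_iff {n : ℕ} {x y : ℤ} (hx : x ∈ signedSet n) (hy : y ∈ signedSet n) (hxy : x ≠ y)
    (σ : Bsub n) : LL (rhoB n) (rfB hx hy hxy * σ) + 1 = LL (rhoB n) σ ↔ appr σ.1 x y := by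
  rw [appr_iff n σ x y hx hy]
  have h2 : rfB hx hy hxy * rfB hx hy hxy = 1 := Subtype.ext (rf_sq hx.1 hy.1 hxy)
  constructor
  · intro h v hv
    rw [← rf_fix_iff hx hy hxy]
    exact LL_valid (rhoB n) _ σ h2 (gen_LL hx hy hxy) (by omega) v hv
  · intro h
    obtain ⟨α, h3, h4, h5⟩ := rfB_root hx hy hxy
    have h6 := LL_refl_lt (rhoB n) (formB n) (formB_symm n) (formB_pos n) (formB_inv n)
      (rfB hx hy hxy) σ α h3 h4 h5 (fun v hv => by rw [rf_fix_iff]; exact h v hv)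
    have h7 := LL_mul (rhoB n) (rfB hx hy hxy) (rfB hx hy hxy * σ)
    rw [← mul_assoc, h2, one_mul] at h7
    have := gen_LL hx hy hxy
    omega

lemma exists_rf {n : ℕ} (σ : Bsub n) (h : σ ≠ 1) :
    ∃ x y, ∃ (hx : x ∈ signedSet n) (hy : y ∈ signedSet n) (hxy : x ≠ y),
      LL (rhoB n) (rfB hx hy hxy * σ) + 1 = LL (rhoB n) σ := by
  have : ∃ x, σ.1 x ≠ x := by
    by_contra hc
    push Not at hc
    exact h (Subtype.ext (Equiv.ext hc))
  obtain ⟨x, hx⟩ := this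
  have h1 : x ∈ signedSet n := by
    by_contra hc
    exact hx (σ.2.2 x hc)
  refine ⟨x, σ.1 x, h1, (inB_maps σ.2 x).2 h1, hx.symm, ?_⟩
  rw [LL_rf_iff]
  intro v _ h2
  exact (h2 x).symm

lemma len_le_LL {n : ℕ} : ∀ (k : ℕ) (σ : Bsub n), LL (rhoB n) σ = k →
    ∃ l : List (Equiv.Perm ℤ), l.length = k ∧ (∀ g ∈ l, g ∈ genB n) ∧ l.prod = σ.1 := by
  intro k
  induction k with
  | zero =>
    intro σ h
    by_cases h1 : σ = 1
    · exact ⟨[], rfl, by simp, by simp [h1]⟩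
    · obtain ⟨x, y, hx, hy, hxy, h2⟩ := exists_rf σ h1
      omega
  | succ k ih =>
    intro σ h
    by_cases h1 : σ = 1
    · rw [h1, LL_one] at h; omega
    · obtain ⟨x, y, hx, hy, hxy, h2⟩ := exists_rf σ h1
      obtain ⟨l, e1, e2, e3⟩ := ih (rfB hx hy hxy * σ) (by omega)
      refine ⟨rf x y :: l, by simp [e1], ?_, ?_⟩
      · intro g hg
        rcases List.mem_cons.1 hg with rfl | hg
        · exact gen_rf.2 ⟨x, y, hx, hy, hxy, rfl⟩
        · exact e2 g hg
      · rw [List.prod_cons, e3]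
        change rf x y * (rf x y * σ.1) = _
        rw [← mul_assoc, rf_sq hx.1 hy.1 hxy, one_mul]

lemma LL_le_len {n : ℕ} : ∀ (l : List (Equiv.Perm ℤ)), (∀ g ∈ l, g ∈ genB n) →
    ∃ h : l.prod ∈ Bsub n, LL (rhoB n) ⟨l.prod, h⟩ ≤ l.length := by
  intro l
  induction l with
  | nil => intro _; exact ⟨(Bsub n).one_mem, by
      have := LL_one (rhoB n)
      simp only [List.prod_nil, List.length_nil]
      exact this.le⟩
  | cons g l ih =>
    intro hl
    obtain ⟨h1, h2⟩ := ih (fun g hg => hl g (List.mem_cons_of_mem _ hg))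
    obtain ⟨x, y, hx, hy, hxy, rfl⟩ := gen_rf.1 (hl g (List.mem_cons_self))
    have h3 := LL_mul (rhoB n) (rfB hx hy hxy) ⟨l.prod, h1⟩
    have h4 := gen_LL hx hy hxy
    refine ⟨by rw [List.prod_cons]; exact (rfB hx hy hxy * ⟨l.prod, h1⟩).2, ?_⟩
    simp only [List.prod_cons, List.length_cons]
    exact h3.trans (by omega)

lemma lenB_eq {n : ℕ} (σ : Bsub n) : lenB n σ.1 = LL (rhoB n) σ := by
  unfold lenB
  apply le_antisymm
  · exact Nat.sInf_le (len_le_LL _ σ rfl)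
  · obtain ⟨l, h1, h2, h3⟩ := Nat.sInf_mem (s := {k : ℕ | ∃ l : List (Equiv.Perm ℤ),
      l.length = k ∧ (∀ g ∈ l, g ∈ genB n) ∧ l.prod = σ.1}) ⟨_, len_le_LL _ σ rfl⟩
    rw [← h1]
    obtain ⟨h4, h5⟩ := LL_le_len l h2
    have : (⟨l.prod, h4⟩ : Bsub n) = σ := Subtype.ext h3
    rwa [this] at h5

/-! exported facts about `lenB` -/

lemma lenB_one (n : ℕ) : lenB n 1 = 0 := (lenB_eq (1 : Bsub n)).trans (LL_one _)

lemma lenB_mul {n : ℕ} {a b : Equiv.Perm ℤ} (ha : inB n a) (hb : inB n b) :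
    lenB n (a * b) ≤ lenB n a + lenB n b := by
  have := LL_mul (rhoB n) ⟨a, ha⟩ ⟨b, hb⟩
  rwa [← lenB_eq, ← lenB_eq, ← lenB_eq] at this

lemma lenB_conj {n : ℕ} {a b : Equiv.Perm ℤ} (ha : inB n a) (hb : inB n b) :
    lenB n (a * b * a⁻¹) = lenB n b := by
  have := LL_conj (rhoB n) ⟨a, ha⟩ ⟨b, hb⟩
  rwa [← lenB_eq, ← lenB_eq] at this

lemma lenB_rf_iff {n : ℕ} {x y : ℤ} (hx : x ∈ signedSet n) (hy : y ∈ signedSet n) (hxy : x ≠ y)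
    {σ : Equiv.Perm ℤ} (hσ : inB n σ) : lenB n (rf x y * σ) + 1 = lenB n σ ↔ appr σ x y := by
  have := LL_rf_iff hx hy hxy ⟨σ, hσ⟩
  rwa [← lenB_eq, ← lenB_eq] at this

lemma lenB_rf_le {n : ℕ} {x y : ℤ} (hx : x ∈ signedSet n) (hy : y ∈ signedSet n) (hxy : x ≠ y) :
    lenB n (rf x y) ≤ 1 := by
  have := gen_LL hx hy hxy
  rwa [← lenB_eq] at this

lemma lenB_exists {n : ℕ} {σ : Equiv.Perm ℤ} (hσ : inB n σ) (h : σ ≠ 1) :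
    ∃ x y, x ∈ signedSet n ∧ y ∈ signedSet n ∧ x ≠ y ∧ lenB n (rf x y * σ) + 1 = lenB n σ := by
  obtain ⟨x, y, hx, hy, hxy, h1⟩ := exists_rf ⟨σ, hσ⟩ (fun hc => h (congrArg Subtype.val hc))
  rw [← lenB_eq, ← lenB_eq] at h1
  exact ⟨x, y, hx, hy, hxy, h1⟩

lemma lenB_zero {n : ℕ} {σ : Equiv.Perm ℤ} (hσ : inB n σ) (h : lenB n σ = 0) : σ = 1 := by
  by_contra hc
  obtain ⟨x, y, -, -, -, h1⟩ := lenB_exists hσ hc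
  omega

lemma fix_le_iff {n : ℕ} (a b : Bsub n) : fixS (rhoB n) b ≤ fixS (rhoB n) a ↔
    ∀ x y, x ∈ signedSet n → y ∈ signedSet n → appr a.1 x y → appr b.1 x y := by
  constructor
  · intro h x y hx hy
    rw [appr_iff n a x y hx hy, appr_iff n b x y hx hy]
    exact fun h1 v hv => h1 v (h hv)
  · intro h v hv
    rw [mem_fixB]
    intro x
    by_cases hx : x ∈ signedSet n
    · have hx' := (inB_maps a.2 x).2 hx
      have h1 := h x (a.1 x) hx hx' (fun v _ h2 => (h2 x).symm)
      rw [appr_iff n b _ _ hx hx'] at h1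
      exact (h1 v hv).symm
    · rw [a.2.2 x hx]

lemma leB_appr {n : ℕ} {a b : Equiv.Perm ℤ} (ha : inB n a) (hb : inB n b) (h : leB n a b) :
    ∀ x y, x ∈ signedSet n → y ∈ signedSet n → appr a x y → appr b x y := by
  apply (fix_le_iff ⟨a, ha⟩ ⟨b, hb⟩).1
  apply fix_le_of_LL
  rw [← lenB_eq, ← lenB_eq, ← lenB_eq]
  exact h

lemma leB_of_appr {n : ℕ} {a b c : Equiv.Perm ℤ} (ha : inB n a) (hb : inB n b) (hc : inB n c)
    (hac : leB n a c) (hbc : leB n b c) (hfix : ∀ x ∈ signedSet n, appr c x (-x))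
    (h : ∀ x y, x ∈ signedSet n → y ∈ signedSet n → appr a x y → appr b x y) : leB n a b := by
  have := brady_watt (rhoB n) (formB n) (formB_symm n) (formB_pos n) (formB_inv n)
    ⟨c, hc⟩ ⟨a, ha⟩ ⟨b, hb⟩ ?_ ?_ ?_ ((fix_le_iff ⟨a, ha⟩ ⟨b, hb⟩).2 h)
  · rw [← lenB_eq, ← lenB_eq, ← lenB_eq] at this
    exact this
  · rw [eq_bot_iff]
    intro v hv
    rw [Submodule.mem_bot]
    ext x
    by_cases hx : x ∈ signedSet n
    · have h1 := (appr_iff n ⟨c, hc⟩ x (-x) hx (neg_mem_signed.2 hx)).1 (hfix x hx) v hv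
      rw [v.2.1] at h1
      change v.1 x = 0
      linarith
    · exact v.2.2 x hx
  · rw [← lenB_eq, ← lenB_eq, ← lenB_eq]; exact hac
  · rw [← lenB_eq, ← lenB_eq, ← lenB_eq]; exact hbc

set_option linter.unusedSectionVars false
set_option linter.unusedSimpArgs false

lemma appr_zpow {τ : Equiv.Perm ℤ} (v : ℤ → ℝ) (hv : ∀ a, v (τ a) = v a) (m : ℤ) (x : ℤ) :
    v ((τ ^ m) x) = v x := by
  induction m using Int.induction_on generalizing x with
  | zero => simp
  | succ i ih => rw [zpow_add_one, Equiv.Perm.mul_apply, ih, hv]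
  | pred i ih =>
    rw [zpow_sub_one, Equiv.Perm.mul_apply, ih]
    have := hv (τ⁻¹ x)
    simpa using this.symm

lemma orb_refl (τ : Equiv.Perm ℤ) (x : ℤ) : x ∈ permOrbit τ x := ⟨0, by simp⟩

lemma orb_appr {τ : Equiv.Perm ℤ} {x y : ℤ} (h : y ∈ permOrbit τ x) : appr τ x y := by
  obtain ⟨m, rfl⟩ := h
  intro v _ hv
  exact (appr_zpow v hv m x).symm

lemma inB_zpow_neg {n : ℕ} {τ : Equiv.Perm ℤ} (h : inB n τ) (m : ℤ) (x : ℤ) :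
    (τ ^ m) (-x) = -((τ ^ m) x) := ((Bsub n).zpow_mem h m).1 x

lemma orb_tr {τ : Equiv.Perm ℤ} {x : ℤ} (a : ℤ) : τ a ∈ permOrbit τ x ↔ a ∈ permOrbit τ x := by
  constructor
  · rintro ⟨m, hm⟩
    refine ⟨-1 + m, ?_⟩
    rw [zpow_add, Equiv.Perm.mul_apply, hm]; simp
  · rintro ⟨m, hm⟩
    refine ⟨1 + m, ?_⟩
    rw [zpow_add, Equiv.Perm.mul_apply, hm]; simp

lemma orb_eq {τ : Equiv.Perm ℤ} {x y : ℤ} (h : y ∈ permOrbit τ x) : permOrbit τ y = permOrbit τ x := by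
  obtain ⟨m, rfl⟩ := h
  ext z
  constructor
  · rintro ⟨k, rfl⟩
    exact ⟨k + m, by rw [zpow_add, Equiv.Perm.mul_apply]⟩
  · rintro ⟨k, rfl⟩
    exact ⟨k - m, by rw [← Equiv.Perm.mul_apply, ← zpow_add]; simp⟩

lemma negSet_orb {n : ℕ} {τ : Equiv.Perm ℤ} (hτ : inB n τ) (x : ℤ) :
    negSet (permOrbit τ x) = permOrbit τ (-x) := by
  ext z
  simp only [negSet, permOrbit, Set.mem_ofPred_eq]
  refine exists_congr fun m => ?_
  rw [inB_zpow_neg hτ]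
  constructor <;> intro h <;> omega

lemma negSet_orb_iff {n : ℕ} {τ : Equiv.Perm ℤ} (hτ : inB n τ) (x : ℤ) :
    negSet (permOrbit τ x) = permOrbit τ x ↔ -x ∈ permOrbit τ x := by
  rw [negSet_orb hτ]
  constructor
  · intro h; rw [← h]; exact orb_refl _ _
  · exact orb_eq

open Classical in
lemma appr_noninv {n : ℕ} {τ : Equiv.Perm ℤ} (hτ : inB n τ) {x : ℤ} (h : -x ∉ permOrbit τ x)
    {y : ℤ} (hy : appr τ x y) : y ∈ permOrbit τ x := by
  by_contra hc
  have := hy (fun a => (if a ∈ permOrbit τ x then 1 else 0) - (if -a ∈ permOrbit τ x then 1 else 0))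
    (by intro a; simp) (by
      intro a
      have h2 : -τ a = τ (-a) := (hτ.1 a).symm
      simp only [h2, orb_tr])
  simp only [orb_refl, h, hc] at this
  split_ifs at this <;> simp_all <;> norm_num at this

def cls (n : ℕ) (τ : Equiv.Perm ℤ) (x : ℤ) : Set ℤ := {y | y ∈ signedSet n ∧ appr τ x y}

lemma appr_refl (τ : Equiv.Perm ℤ) (x : ℤ) : appr τ x x := fun _ _ _ => rfl
lemma appr_symm {τ : Equiv.Perm ℤ} {x y : ℤ} (h : appr τ x y) : appr τ y x :=
  fun v h1 h2 => (h v h1 h2).symm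
lemma appr_trans {τ : Equiv.Perm ℤ} {x y z : ℤ} (h : appr τ x y) (h' : appr τ y z) : appr τ x z :=
  fun v h1 h2 => (h v h1 h2).trans (h' v h1 h2)

lemma appr_neg_zero {τ : Equiv.Perm ℤ} {x : ℤ} (h : appr τ x (-x)) {v : ℤ → ℝ}
    (h1 : ∀ a, v (-a) = -v a) (h2 : ∀ a, v (τ a) = v a) : v x = 0 := by
  have := h v h1 h2
  rw [h1] at this; linarith

lemma orb_signed {n : ℕ} {τ : Equiv.Perm ℤ} (hτ : inB n τ) {x y : ℤ} (hx : x ∈ signedSet n)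
    (h : y ∈ permOrbit τ x) : y ∈ signedSet n := by
  obtain ⟨m, rfl⟩ := h
  exact (inB_maps ((Bsub n).zpow_mem hτ m) x).2 hx

lemma cls_noninv {n : ℕ} {τ : Equiv.Perm ℤ} (hτ : inB n τ) {x : ℤ} (hx : x ∈ signedSet n)
    (h : -x ∉ permOrbit τ x) : cls n τ x = permOrbit τ x := by
  ext y
  exact ⟨fun hy => appr_noninv hτ h hy.2, fun hy => ⟨orb_signed hτ hx hy, orb_appr hy⟩⟩

lemma cls_inv {n : ℕ} {τ : Equiv.Perm ℤ} (hτ : inB n τ) {x : ℤ} (hx : x ∈ signedSet n)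
    (h : -x ∈ permOrbit τ x) : cls n τ x = ⋃₀ {A | A ∈ orbitsOn n τ ∧ negSet A = A} := by
  ext y
  simp only [Set.mem_sUnion, Set.mem_ofPred_eq]
  constructor
  · rintro ⟨hy, hyx⟩
    refine ⟨permOrbit τ y, ⟨⟨y, hy, rfl⟩, ?_⟩, orb_refl _ _⟩
    rw [negSet_orb_iff hτ]
    by_contra hc
    have h3 : appr τ y (-y) := by
      intro v h1 h2
      have := appr_neg_zero (orb_appr h) h1 h2
      have h4 := hyx v h1 h2
      rw [h1, ← h4, this]; simp
    exact hc (appr_noninv hτ hc h3)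
  · rintro ⟨A, ⟨⟨z, hz, rfl⟩, hA⟩, hy⟩
    refine ⟨orb_signed hτ hz hy, fun v h1 h2 => ?_⟩
    rw [negSet_orb_iff hτ] at hA
    rw [appr_neg_zero (orb_appr h) h1 h2, ← orb_appr hy v h1 h2, appr_neg_zero (orb_appr hA) h1 h2]

lemma mem_omegaTilde {n : ℕ} {τ : Equiv.Perm ℤ} (hτ : inB n τ) (A : Set ℤ) :
    A ∈ omegaTilde n τ ↔ ∃ x ∈ signedSet n, A = cls n τ x := by
  constructor
  · rintro (⟨⟨x, hx, rfl⟩, h⟩ | ⟨rfl, ⟨z, ⟨B, ⟨⟨x, hx, rfl⟩, h⟩, hz⟩⟩⟩)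
    · rw [Ne, negSet_orb_iff hτ] at h
      exact ⟨x, hx, (cls_noninv hτ hx h).symm⟩
    · rw [negSet_orb_iff hτ] at h
      exact ⟨x, hx, (cls_inv hτ hx h).symm⟩
  · rintro ⟨x, hx, rfl⟩
    by_cases h : -x ∈ permOrbit τ x
    · right
      exact ⟨cls_inv hτ hx h, ⟨x, hx, appr_refl _ _⟩⟩
    · left
      rw [cls_noninv hτ hx h]
      exact ⟨⟨x, hx, rfl⟩, by rwa [Ne, negSet_orb_iff hτ]⟩

lemma refines_iff {n : ℕ} {a b : Equiv.Perm ℤ} (ha : inB n a) (hb : inB n b) :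
    refines (omegaTilde n a) (omegaTilde n b) ↔
      ∀ x y, x ∈ signedSet n → y ∈ signedSet n → appr a x y → appr b x y := by
  constructor
  · intro h x y hx hy hxy
    obtain ⟨B, hB, hs⟩ := h (cls n a x) ((mem_omegaTilde ha _).2 ⟨x, hx, rfl⟩)
    obtain ⟨z, hz, rfl⟩ := (mem_omegaTilde hb _).1 hB
    have h1 : x ∈ cls n b z := hs ⟨hx, appr_refl _ _⟩
    have h2 : y ∈ cls n b z := hs ⟨hy, hxy⟩
    exact appr_trans (appr_symm h1.2) h2.2
  · intro h A hA
    obtain ⟨x, hx, rfl⟩ := (mem_omegaTilde ha _).1 hA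
    exact ⟨cls n b x, (mem_omegaTilde hb _).2 ⟨x, hx, rfl⟩, fun y hy => ⟨hy.1, h x y hx hy.1 hy.2⟩⟩

/-! gamma -/

lemma cyc_nodup (k c : ℕ) : (((List.range k).map fun i : ℕ => ((c:ℤ) + (i : ℤ) + 1)) ++
      ((List.range k).map fun i : ℕ => -((c:ℤ) + (i : ℤ) + 1))).Nodup := by
  rw [List.nodup_append]
  refine ⟨?_, ?_, ?_⟩
  · exact List.nodup_range.map (fun a b h => by simpa using h)
  · exact List.nodup_range.map (fun a b h => by simpa using h)
  · intro a ha b hb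
    simp only [List.mem_map, List.mem_range] at ha hb
    obtain ⟨i, _, rfl⟩ := ha
    obtain ⟨j, _, rfl⟩ := hb
    omega

def cyc (k c : ℕ) : Equiv.Perm ℤ := (((List.range k).map fun i : ℕ => ((c:ℤ) + (i : ℤ) + 1)) ++
      ((List.range k).map fun i : ℕ => -((c:ℤ) + (i : ℤ) + 1))).formPerm

lemma cyc_pos (k c i : ℕ) (h : i + 1 < k) :
    cyc k c ((c:ℤ) + i + 1) = c + i + 2 := by
  have := List.formPerm_apply_getElem _ (cyc_nodup k c) i (by simp; omega)
  rw [List.getElem_append_left (by simp; omega)] at this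
  simp only [List.getElem_map, List.getElem_range] at this
  rw [cyc, this]
  have h2 : (i + 1) % (((List.range k).map fun i : ℕ => ((c:ℤ) + (i : ℤ) + 1)) ++
      ((List.range k).map fun i : ℕ => -((c:ℤ) + (i : ℤ) + 1))).length = i + 1 := by
    apply Nat.mod_eq_of_lt; simp; omega
  simp only [h2]
  rw [List.getElem_append_left (by simp; omega)]
  simp; ring

lemma cyc_pos_last (k c i : ℕ) (h : i + 1 = k) :
    cyc k c ((c:ℤ) + i + 1) = -((c:ℤ) + 1) := by
  have := List.formPerm_apply_getElem _ (cyc_nodup k c) i (by simp; omega)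
  rw [List.getElem_append_left (by simp; omega)] at this
  simp only [List.getElem_map, List.getElem_range] at this
  rw [cyc, this]
  have h2 : (i + 1) % (((List.range k).map fun i : ℕ => ((c:ℤ) + (i : ℤ) + 1)) ++
      ((List.range k).map fun i : ℕ => -((c:ℤ) + (i : ℤ) + 1))).length = i + 1 := by
    apply Nat.mod_eq_of_lt; simp; omega
  simp only [h2]
  rw [List.getElem_append_right (by simp; omega)]
  simp; omega

lemma cyc_neg (k c i : ℕ) (h : i + 1 < k) :
    cyc k c (-((c:ℤ) + i + 1)) = -((c:ℤ) + i + 2) := by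
  have := List.formPerm_apply_getElem _ (cyc_nodup k c) (k + i) (by simp; omega)
  rw [List.getElem_append_right (by simp)] at this
  simp only [List.getElem_map, List.getElem_range, List.length_map, List.length_range,
    Nat.add_sub_cancel_left] at this
  rw [cyc, this]
  have h2 : (k + i + 1) % (((List.range k).map fun i : ℕ => ((c:ℤ) + (i : ℤ) + 1)) ++
      ((List.range k).map fun i : ℕ => -((c:ℤ) + (i : ℤ) + 1))).length = k + i + 1 := by
    apply Nat.mod_eq_of_lt; simp; omega
  simp only [h2]
  rw [List.getElem_append_right (by simp; omega)]
  simp; omega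

lemma cyc_neg_last (k c i : ℕ) (h : i + 1 = k) :
    cyc k c (-((c:ℤ) + i + 1)) = (c:ℤ) + 1 := by
  have := List.formPerm_apply_getElem _ (cyc_nodup k c) (k + i) (by simp; omega)
  rw [List.getElem_append_right (by simp)] at this
  simp only [List.getElem_map, List.getElem_range, List.length_map, List.length_range,
    Nat.add_sub_cancel_left] at this
  rw [cyc, this]
  have h2 : (k + i + 1) % (((List.range k).map fun i : ℕ => ((c:ℤ) + (i : ℤ) + 1)) ++
      ((List.range k).map fun i : ℕ => -((c:ℤ) + (i : ℤ) + 1))).length = 0 := by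
    have : (((List.range k).map fun i : ℕ => ((c:ℤ) + (i : ℤ) + 1)) ++
      ((List.range k).map fun i : ℕ => -((c:ℤ) + (i : ℤ) + 1))).length = k + i + 1 := by simp; omega
    rw [this, Nat.mod_self]
  simp only [h2]
  rw [List.getElem_append_left (by simp; omega)]
  simp

lemma cyc_out (k c : ℕ) (x : ℤ) (h : ¬ (c < |x| ∧ |x| ≤ c + k)) : cyc k c x = x := by
  apply List.formPerm_apply_of_notMem
  simp only [List.mem_append, List.mem_map, List.mem_range]
  rintro (⟨i, hi, rfl⟩ | ⟨i, hi, rfl⟩)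
  · rw [abs_of_pos (by omega)] at h; omega
  · rw [abs_neg, abs_of_pos (by omega)] at h; omega

lemma cyc_odd (k c : ℕ) (x : ℤ) : cyc k c (-x) = - cyc k c x := by
  by_cases h : c < |x| ∧ |x| ≤ c + k
  · obtain ⟨i, hi⟩ : ∃ i : ℕ, |x| = c + i + 1 := ⟨(|x| - c - 1).toNat, by omega⟩
    rcases abs_eq (by omega : (0:ℤ) ≤ c + i + 1) |>.1 hi with rfl | rfl
    · by_cases h2 : i + 1 < k
      · rw [cyc_pos _ _ _ h2, cyc_neg _ _ _ h2]
      · rw [cyc_pos_last _ _ _ (by omega), cyc_neg_last _ _ _ (by omega)]; ring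
    · rw [neg_neg]
      by_cases h2 : i + 1 < k
      · rw [cyc_pos _ _ _ h2, cyc_neg _ _ _ h2]; ring
      · rw [cyc_pos_last _ _ _ (by omega), cyc_neg_last _ _ _ (by omega)]
  · rw [cyc_out _ _ _ h, cyc_out _ _ _ (by rwa [abs_neg])]

lemma cyc_inB (k c n : ℕ) (h : c + k ≤ n) : inB n (cyc k c) := by
  refine ⟨cyc_odd k c, fun x hx => cyc_out _ _ _ fun h2 => hx ⟨?_, by omega⟩⟩
  rintro rfl
  simp at h2; omega

lemma gamma_eq (p q : ℕ) : gammaPQ p q = cyc p 0 * cyc q p := by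
  have h : ∀ l : List ℕ, List.flatMap (fun a : ℕ => [(a:ℤ)]) l = l.map (fun a : ℕ => (a:ℤ)) := by
    intro l; induction l with
    | nil => rfl
    | cons a l ih => simp [List.flatMap_cons, ih]
  simp [gammaPQ, cyc, h, List.map_map, Function.comp_def]

lemma gamma_inB (p q : ℕ) : inB (p + q) (gammaPQ p q) := by
  rw [gamma_eq]
  exact inB_mul (cyc_inB _ _ _ (by omega)) (cyc_inB _ _ _ (by omega))

lemma gamma_fst (p q : ℕ) (x : ℤ) (h : |x| ≤ p) : gammaPQ p q x = cyc p 0 x := by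
  rw [gamma_eq, Equiv.Perm.mul_apply, cyc_out q p x (by omega)]

lemma gamma_snd (p q : ℕ) (x : ℤ) (h : p < |x|) : gammaPQ p q x = cyc q p x := by
  rw [gamma_eq, Equiv.Perm.mul_apply]
  by_cases h2 : |x| ≤ p + q
  · apply cyc_out
    obtain ⟨i, hi⟩ : ∃ i : ℕ, |x| = p + i + 1 := ⟨(|x| - p - 1).toNat, by omega⟩
    rcases abs_eq (by omega : (0:ℤ) ≤ p + i + 1) |>.1 hi with rfl | rfl
    · by_cases h2 : i + 1 < q
      · rw [cyc_pos _ _ _ h2, abs_of_pos (by omega)]; omega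
      · rw [cyc_pos_last _ _ _ (by omega), abs_neg, abs_of_pos (by omega)]; omega
    · by_cases h2 : i + 1 < q
      · rw [cyc_neg _ _ _ h2, abs_neg, abs_of_pos (by omega)]; omega
      · rw [cyc_neg_last _ _ _ (by omega), abs_of_pos (by omega)]; omega
  · rw [cyc_out q p _ (by omega), cyc_out _ _ _ (by push_cast; omega)]

lemma cyc_v_zero (k c : ℕ) (v : ℤ → ℝ) (h1 : ∀ a, v (-a) = -v a)
    (h2 : ∀ a : ℤ, (c:ℤ) < |a| → |a| ≤ c + k → v (cyc k c a) = v a) (x : ℤ) (h : c < |x| ∧ |x| ≤ c + k) : v x = 0 := by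
  have key : ∀ i : ℕ, i < k → v (c + i + 1) = v (c + 1) := by
    intro i
    induction i with
    | zero => intro _; simp
    | succ i ih =>
      intro hi
      rw [← ih (by omega), ← h2 (c + i + 1) (by rw [abs_of_pos (by omega)]; omega) (by rw [abs_of_pos (by omega)]; omega),
        cyc_pos _ _ _ hi]
      congr 1
  have hk : 0 < k := by omega
  have hl := h2 (c + (k - 1 : ℕ) + 1) (by rw [abs_of_pos (by omega)]; omega) (by rw [abs_of_pos (by omega)]; omega)
  rw [cyc_pos_last _ _ _ (by omega), key _ (by omega), h1] at hl
  have h0 : v (c + 1) = 0 := by linarith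
  obtain ⟨i, hi⟩ : ∃ i : ℕ, |x| = c + i + 1 := ⟨(|x| - c - 1).toNat, by omega⟩
  rcases abs_eq (by omega : (0:ℤ) ≤ c + i + 1) |>.1 hi with rfl | rfl
  · rw [key _ (by omega), h0]
  · rw [h1, key _ (by omega), h0]; simp

lemma gamma_appr (p q : ℕ) (x : ℤ) (hx : x ∈ signedSet (p + q)) : appr (gammaPQ p q) x (-x) := by
  intro v h1 h2
  suffices v x = 0 by rw [h1, this]; simp
  have hx0 : 0 < |x| := abs_pos.2 hx.1
  have := hx.2
  by_cases h : |x| ≤ p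
  · exact cyc_v_zero p 0 v h1 (fun a _ ha => by rw [← gamma_fst p q a (by simpa using ha), h2]) x
      ⟨by simpa using hx.1, by simpa using h⟩
  · exact cyc_v_zero q p v h1 (fun a ha _ => by rw [← gamma_snd p q a ha, h2]) x ⟨by omega, by push_cast at this; omega⟩

lemma leB_antisymm {n : ℕ} {a b : Equiv.Perm ℤ} (ha : inB n a) (hb : inB n b) (h : leB n a b)
    (h' : leB n b a) : a = b := by
  unfold leB at h h'
  have : lenB n (a⁻¹ * b) = 0 := by omega
  have := lenB_zero (inB_mul (inB_inv ha) hb) this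
  exact inv_mul_eq_one.1 this

lemma refines_leB {p q : ℕ} {a b : Equiv.Perm ℤ} (ha : a ∈ SncB p q) (hb : b ∈ SncB p q) :
    refines (omegaTilde (p + q) a) (omegaTilde (p + q) b) ↔ leB (p + q) a b := by
  rw [refines_iff ha.1 hb.1]
  constructor
  · exact leB_of_appr ha.1 hb.1 (gamma_inB p q) ha.2 hb.2 (gamma_appr p q)
  · exact leB_appr ha.1 hb.1

lemma omega_inj {p q : ℕ} {a b : Equiv.Perm ℤ} (ha : a ∈ SncB p q) (hb : b ∈ SncB p q)
    (h : omegaTilde (p + q) a = omegaTilde (p + q) b) : a = b := by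
  refine leB_antisymm ha.1 hb.1 ((refines_leB ha hb).1 ?_) ((refines_leB hb ha).1 ?_)
  · rw [h]; exact fun A hA => ⟨A, hA, subset_rfl⟩
  · rw [h]; exact fun A hA => ⟨A, hA, subset_rfl⟩

lemma chains_eq (p q k : ℕ) :
    {f : Fin k → Set (Set ℤ) | (∀ i, f i ∈ NCB p q) ∧
        (∀ i j : Fin k, i ≤ j → refines (f i) (f j))}.ncard =
    {g : Fin k → Equiv.Perm ℤ | (∀ i, g i ∈ SncB p q) ∧
        (∀ i j : Fin k, i ≤ j → leB (p + q) (g i) (g j))}.ncard := by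
  symm
  refine Set.ncard_congr (fun g _ i => omegaTilde (p + q) (g i)) ?_ ?_ ?_
  · rintro g ⟨h1, h2⟩
    exact ⟨fun i => ⟨g i, h1 i, rfl⟩, fun i j hij => (refines_leB (h1 i) (h1 j)).2 (h2 i j hij)⟩
  · rintro g g' ⟨h1, _⟩ ⟨h1', _⟩ h
    funext i
    exact omega_inj (h1 i) (h1' i) (congrFun h i)
  · rintro f ⟨h1, h2⟩
    choose g hg hfg using h1
    refine ⟨g, ⟨hg, fun i j hij => ?_⟩, ?_⟩
    · rw [← refines_leB (hg i) (hg j), ← hfg, ← hfg]; exact h2 i j hij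
    · funext i; exact (hfg i).symm

set_option linter.unusedSectionVars false
set_option linter.unusedSimpArgs false
set_option linter.unusedVariables false

lemma finB (n : ℕ) : {u : Equiv.Perm ℤ | inB n u}.Finite := by
  have hm : ∀ u : Bsub n, ∀ x : Finset.Icc (-(n:ℤ)) n, u.1 x.1 ∈ Finset.Icc (-(n:ℤ)) n :=
    fun u x => by
      have := inB_Icc u.2 x.1
      first | exact this.2 x.2 | exact this.1 x.2
  let f : Bsub n → (Finset.Icc (-(n:ℤ)) n → Finset.Icc (-(n:ℤ)) n) := fun u x => ⟨u.1 x.1, hm u x⟩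
  have hf : Function.Injective f := by
    intro u w h
    apply Subtype.ext
    ext x
    by_cases hx : x ∈ signedSet n
    · have := congrFun h ⟨x, signed_sub_Icc hx⟩
      exact congrArg Subtype.val this
    · rw [u.2.2 x hx, w.2.2 x hx]
  have : Finite (Bsub n) := Finite.of_injective f hf
  exact Set.toFinite (Bsub n : Set (Equiv.Perm ℤ))

noncomputable def BF (n : ℕ) : Finset (Equiv.Perm ℤ) := (finB n).toFinset

lemma mem_BF {n : ℕ} {u : Equiv.Perm ℤ} : u ∈ BF n ↔ inB n u := by
  simp [BF]

lemma leB_refl {n : ℕ} (a : Equiv.Perm ℤ) : leB n a a := by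
  simp [leB, lenB_one]

lemma leB_trans {n : ℕ} {a b c : Equiv.Perm ℤ} (ha : inB n a) (hb : inB n b) (hc : inB n c)
    (h1 : leB n a b) (h2 : leB n b c) : leB n a c := by
  unfold leB at *
  have e1 : lenB n (a⁻¹ * c) ≤ lenB n (a⁻¹ * b) + lenB n (b⁻¹ * c) := by
    have := lenB_mul (inB_mul (inB_inv ha) hb) (inB_mul (inB_inv hb) hc)
    rwa [show a⁻¹ * b * (b⁻¹ * c) = a⁻¹ * c by group] at this
  have e2 : lenB n c ≤ lenB n a + lenB n (a⁻¹ * c) := by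
    have := lenB_mul ha (inB_mul (inB_inv ha) hc)
    rwa [show a * (a⁻¹ * c) = c by group] at this
  omega

open Classical in
noncomputable def PP (n : ℕ) (F : Equiv.Perm ℤ → ℤ) (σ : Equiv.Perm ℤ) : ℤ :=
  ∑ u ∈ (BF n).filter (fun u => leB n u σ), F (u⁻¹ * σ)

open Classical in
lemma PP_eq (n : ℕ) (F : Equiv.Perm ℤ → ℤ) (σ : Equiv.Perm ℤ) (hσ : inB n σ) :
    PP n F σ = ∑ w ∈ (BF n).filter (fun u => leB n u σ), F w := by
  have key : ∀ u, inB n u → (leB n (u⁻¹ * σ) σ ↔ leB n u σ) := by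
    intro u hu
    unfold leB
    have := lenB_conj (inB_inv (a := u⁻¹ * σ) (inB_mul (inB_inv hu) hσ)) hu
    rw [show (u⁻¹ * σ)⁻¹ * u * (u⁻¹ * σ)⁻¹⁻¹ = (u⁻¹ * σ)⁻¹ * σ by group] at this
    rw [this]; omega
  refine Finset.sum_bij' (fun u _ => u⁻¹ * σ) (fun w _ => σ * w⁻¹) ?_ ?_ ?_ ?_ ?_
  · intro u hu
    simp only [Finset.mem_filter, mem_BF] at hu ⊢
    exact ⟨inB_mul (inB_inv hu.1) hσ, (key u hu.1).2 hu.2⟩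
  · intro u hu
    simp only [Finset.mem_filter, mem_BF] at hu ⊢
    refine ⟨inB_mul hσ (inB_inv hu.1), ?_⟩
    rw [← key _ (inB_mul hσ (inB_inv hu.1))]
    rw [show (σ * u⁻¹)⁻¹ * σ = u by group]; exact hu.2
  · intro u hu; group
  · intro u hu; group
  · intro u hu; rfl

noncomputable def delt (σ : Equiv.Perm ℤ) : ℤ := open Classical in if σ = 1 then 1 else 0

lemma PP_delt (n : ℕ) (σ : Equiv.Perm ℤ) (hσ : inB n σ) : PP n delt σ = 1 := by
  classical
  unfold PP
  rw [Finset.sum_eq_single σ]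
  · simp [delt]
  · intro b _ hb
    simp [delt, inv_mul_eq_one, hb]
  · intro h
    simp [mem_BF, hσ, leB_refl] at h

/-- chains below sigma -/
def Ch (n k : ℕ) (σ : Equiv.Perm ℤ) : Set (Fin k → Equiv.Perm ℤ) :=
  {g | (∀ i, inB n (g i) ∧ leB n (g i) σ) ∧ ∀ i j : Fin k, i ≤ j → leB n (g i) (g j)}

lemma Ch_fin (n k : ℕ) (σ : Equiv.Perm ℤ) : (Ch n k σ).Finite := by
  refine (Set.Finite.pi' (fun _ : Fin k => finB n)).subset ?_
  intro g hg i
  exact (hg.1 i).1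

open Classical in
lemma Ch_succ (n k : ℕ) (σ : Equiv.Perm ℤ) (hσ : inB n σ) :
    (Ch n (k + 1) σ).ncard = ∑ w ∈ (BF n).filter (fun u => leB n u σ), (Ch n k w).ncard := by
  have h1 : Ch n (k + 1) σ = ⋃ w ∈ (BF n).filter (fun u => leB n u σ),
      (fun g : Fin k → Equiv.Perm ℤ => (Fin.snoc g w : Fin (k + 1) → Equiv.Perm ℤ)) '' Ch n k w := by
    ext g
    simp only [Set.mem_iUnion, Finset.mem_filter, mem_BF, Set.mem_image, exists_prop]
    constructor
    · rintro ⟨h1, h2⟩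
      refine ⟨g (Fin.last k), h1 _, Fin.init g, ⟨fun i => ⟨(h1 _).1, h2 _ _ (Fin.le_last _)⟩, ?_⟩, ?_⟩
      · intro i j hij
        exact h2 _ _ (by simpa using hij)
      · exact Fin.snoc_init_self g
    · rintro ⟨w, ⟨hw, hws⟩, g, ⟨h1, h2⟩, rfl⟩
      constructor
      · intro i
        refine Fin.lastCases ?_ (fun i => ?_) i
        · simpa using ⟨hw, hws⟩
        · simpa using ⟨(h1 i).1, leB_trans (h1 i).1 hw hσ (h1 i).2 hws⟩
      · intro i j
        refine Fin.lastCases ?_ (fun j => ?_) j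
        · intro _
          refine Fin.lastCases ?_ (fun i => ?_) i
          · simpa using leB_refl w
          · simpa using (h1 i).2
        · refine Fin.lastCases ?_ (fun i => ?_) i
          · intro h
            exact absurd h (not_le.2 (Fin.castSucc_lt_last j))
          · intro h
            simpa using h2 i j (by simpa using h)
  rw [h1]
  have hinj : ∀ w, Function.Injective
      (fun g : Fin k → Equiv.Perm ℤ => (Fin.snoc g w : Fin (k + 1) → Equiv.Perm ℤ)) := by
    intro w g g' h
    have := congrArg Fin.init h
    simpa using this
  have h2 := Set.Finite.ncard_biUnion (t := (((BF n).filter (fun u => leB n u σ) :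
      Finset (Equiv.Perm ℤ)) : Set (Equiv.Perm ℤ))) (Finset.finite_toSet _)
    (s := fun w => (fun g : Fin k → Equiv.Perm ℤ => (Fin.snoc g w : Fin (k + 1) → Equiv.Perm ℤ)) '' Ch n k w)
    (fun w _ => (Ch_fin n k w).image _) (by
      intro w _ w' _ hww
      rw [Function.onFun, Set.disjoint_left]
      rintro g ⟨g1, _, rfl⟩ ⟨g2, _, h⟩
      have := congrFun h (Fin.last k)
      simp at this
      exact hww this.symm)
  rw [finsum_mem_coe_finset] at h2
  simp only [Finset.mem_coe] at h2
  rw [h2]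
  exact Finset.sum_congr rfl fun w _ => Set.ncard_image_of_injective _ (hinj w)

lemma Ch_PP (n : ℕ) : ∀ (k : ℕ) (σ : Equiv.Perm ℤ), inB n σ →
    ((Ch n k σ).ncard : ℤ) = (PP n)^[k + 1] delt σ := by
  classical
  intro k
  induction k with
  | zero =>
    intro σ hσ
    rw [zero_add, Function.iterate_one, PP_delt n σ hσ]
    have : Ch n 0 σ = {Fin.elim0} := by
      ext g
      simp only [Set.mem_singleton_iff]
      exact ⟨fun _ => Subsingleton.elim _ _, fun _ => ⟨fun i => i.elim0, fun i => i.elim0⟩⟩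
    rw [this]; simp
  | succ k ih =>
    intro σ hσ
    rw [Function.iterate_succ_apply', PP_eq _ _ _ hσ, Ch_succ _ _ _ hσ, Nat.cast_sum]
    refine Finset.sum_congr rfl fun w hw => ih w ?_
    simp only [Finset.mem_filter, mem_BF] at hw
    exact hw.1

section
variable (n : ℕ) (R : ℤ → ℤ → Prop)

open Classical in
noncomputable def Yset (x : ℤ) : Finset ℤ :=
  (Finset.Icc (-(n:ℤ)) n).filter (fun y => y ∈ signedSet n ∧ y ≠ x ∧ R x y)

lemma mem_Yset {x y : ℤ} : y ∈ Yset n R x ↔ y ∈ signedSet n ∧ y ≠ x ∧ R x y := by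
  simp only [Yset, Finset.mem_filter, and_iff_right_iff_imp]
  exact fun h => signed_sub_Icc h.1

open Classical in
noncomputable def Dx (x : ℤ) (F : Equiv.Perm ℤ → ℤ) (σ : Equiv.Perm ℤ) : ℤ :=
  ∑ y ∈ Yset n R x, if lenB n (rf x y * σ) + 1 = lenB n σ then F (rf x y * σ) else 0

noncomputable def Dl : List ℤ → (Equiv.Perm ℤ → ℤ) → Equiv.Perm ℤ → ℤ
  | [], F => F
  | x :: s, F => Dx n R x (Dl s F)

lemma Dl_append (s t : List ℤ) (F : Equiv.Perm ℤ → ℤ) : Dl n R (s ++ t) F = Dl n R s (Dl n R t F) := by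
  induction s with
  | nil => rfl
  | cons x s ih => simp only [List.cons_append, Dl, ih]

open Classical in
lemma Dl_conv (s : List ℤ) (hs : ∀ x ∈ s, x ∈ signedSet n) (F : Equiv.Perm ℤ → ℤ) :
    ∀ σ, inB n σ →
    Dl n R s F σ = ∑ u ∈ BF n, if leB n u σ then Dl n R s delt u * F (u⁻¹ * σ) else 0 := by
  induction s with
  | nil =>
    intro σ hσ
    simp only [Dl]
    rw [Finset.sum_eq_single 1]
    · simp [delt, leB, lenB_one]
    · intro b _ hb
      simp [delt, hb]
    · intro h
      exact absurd (mem_BF.2 (inB_one n)) h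
  | cons x s ih =>
    intro σ hσ
    have hx := hs x (by simp)
    have ih' := ih (fun y hy => hs y (by simp [hy]))
    have hL : Dl n R (x :: s) F σ = ∑ y ∈ Yset n R x, ∑ u ∈ BF n,
        if lenB n (rf x y * σ) + 1 = lenB n σ ∧ leB n u (rf x y * σ) then
          Dl n R s delt u * F (u⁻¹ * (rf x y * σ)) else 0 := by
      simp only [Dl, Dx]
      refine Finset.sum_congr rfl fun y hy => ?_
      rw [mem_Yset] at hy
      split_ifs with h
      · rw [ih' _ (inB_mul (rf_inB hx hy.1 (Ne.symm hy.2.1)) hσ)]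
        simp [h]
      · simp [h]
    rw [hL]
    have hR : (∑ u ∈ BF n, if leB n u σ then Dl n R (x :: s) delt u * F (u⁻¹ * σ) else 0) =
        ∑ y ∈ Yset n R x, ∑ u ∈ BF n, if lenB n (rf x y * u) + 1 = lenB n u ∧ leB n u σ then
          Dl n R s delt (rf x y * u) * F (u⁻¹ * σ) else 0 := by
      rw [Finset.sum_comm]
      refine Finset.sum_congr rfl fun u hu => ?_
      split_ifs with h
      · simp only [Dl, Dx, Finset.sum_mul, h, and_true]
        refine Finset.sum_congr rfl fun y hy => ?_
        split_ifs <;> simp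
      · simp [h]
    rw [hR]
    refine Finset.sum_congr rfl fun y hy => ?_
    rw [mem_Yset] at hy
    have hr := rf_inB hx hy.1 (Ne.symm hy.2.1)
    have hinv := rf_inv hx.1 hy.1.1 (Ne.symm hy.2.1)
    have hsq := rf_sq hx.1 hy.1.1 (Ne.symm hy.2.1)
    have hle := lenB_rf_le hx hy.1 (Ne.symm hy.2.1)
    set r := rf x y with hrdef
    have hrr : ∀ a, r * (r * a) = a := fun a => by rw [← mul_assoc, hsq, one_mul]
    refine Finset.sum_bij' (fun u _ => r * u) (fun u _ => r * u) ?_ ?_ ?_ ?_ ?_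
    · intro u hu; rw [mem_BF] at *; exact inB_mul hr hu
    · intro u hu; rw [mem_BF] at *; exact inB_mul hr hu
    · intro u hu; exact hrr u
    · intro u hu; exact hrr u
    · intro u hu
      rw [mem_BF] at hu
      have e1 : (r * u)⁻¹ * σ = u⁻¹ * (r * σ) := by rw [mul_inv_rev, hinv, mul_assoc]
      rw [hrr, e1]
      refine if_congr ?_ rfl rfl
      unfold leB
      rw [e1]
      have a1 := lenB_mul hr hu
      have a2 := lenB_mul hr (inB_mul hr hσ)
      rw [hrr] at a2
      have a3 := lenB_mul hr (inB_mul hr hu)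
      rw [hrr] at a3
      have a4 := lenB_mul (inB_mul hr hu) (inB_mul (inB_inv (inB_mul hr hu)) hσ)
      rw [e1, ← e1, mul_inv_cancel_left, e1] at a4
      have a5 := lenB_mul hu (inB_mul (inB_inv hu) (inB_mul hr hσ))
      rw [mul_inv_cancel_left] at a5
      constructor
      · rintro ⟨h1, h2⟩; omega
      · rintro ⟨h1, h2⟩; omega

noncomputable def SumT : ℕ → (List ℤ → ℤ) → ℤ
  | 0, g => g []
  | k + 1, g => ∑ T ∈ (Finset.Icc (1:ℤ) n).powerset, SumT k (fun s => g (T.toList ++ s))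

lemma SumT_sum {ι : Type*} (Y : Finset ι) : ∀ (k : ℕ) (h : ι → List ℤ → ℤ),
    SumT n k (fun s => ∑ y ∈ Y, h y s) = ∑ y ∈ Y, SumT n k (h y) := by
  intro k
  induction k with
  | zero => intro h; rfl
  | succ k ih =>
    intro h
    simp only [SumT, ih]
    rw [Finset.sum_comm]

lemma SumT_zero : ∀ (k : ℕ), SumT n k (fun _ => 0) = 0 := by
  intro k
  induction k with
  | zero => rfl
  | succ k ih => simp [SumT, ih]

lemma Dl_SumT (k : ℕ) (T : List ℤ) (h : Equiv.Perm ℤ → List ℤ → ℤ) (σ : Equiv.Perm ℤ) :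
    Dl n R T (fun τ => SumT n k (h τ)) σ = SumT n k (fun s => Dl n R T (fun τ => h τ s) σ) := by
  induction T generalizing σ with
  | nil => rfl
  | cons x T ih =>
    simp only [Dl, Dx]
    rw [SumT_sum]
    refine Finset.sum_congr rfl fun y hy => ?_
    split_ifs
    · exact ih _
    · rw [SumT_zero]

lemma rf_conj {g : Equiv.Perm ℤ} (hg : inB n g) {x y : ℤ} (hx : x ≠ 0) (hy : y ≠ 0) (hxy : x ≠ y)
    (hx' : g x ≠ 0) (hy' : g y ≠ 0) :
    g * rf x y * g⁻¹ = rf (g x) (g y) := by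
  ext a
  obtain ⟨b, rfl⟩ := g.surjective a
  rw [Equiv.Perm.mul_apply, Equiv.Perm.mul_apply, show g⁻¹ (g b) = b from g.symm_apply_apply b,
    rf_apply hx hy hxy, rf_apply hx' hy' (fun h => hxy (g.injective h))]
  simp only [← hg.1, g.injective.eq_iff, apply_ite g]

variable (St : Equiv.Perm ℤ → Prop) (hB : ∀ σ, St σ → inB n σ)
  (hmove : ∀ σ x y, St σ → x ∈ signedSet n → y ∈ signedSet n → x ≠ y → R x y →
    lenB n (rf x y * σ) + 1 = lenB n σ → St (rf x y * σ))
  (hRt : ∀ x y, x ∈ signedSet n → y ∈ signedSet n → x ≠ y → R x y ∨ R y x)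
  (hsum : ∀ σ, St σ → ∑ T ∈ (Finset.Icc (1:ℤ) n).powerset, Dl n R T.toList delt σ = 1)

include hB hmove hRt in
lemma St_le : ∀ (k : ℕ) (σ u : Equiv.Perm ℤ), St σ → inB n u → leB n u σ → lenB n (u⁻¹ * σ) = k →
    St u := by
  intro k
  induction k with
  | zero =>
    intro σ u hσ hu h hk
    have := lenB_zero (inB_mul (inB_inv hu) (hB _ hσ)) hk
    rw [inv_mul_eq_one] at this
    rwa [this]
  | succ k ih =>
    intro σ u hσ hu h hk
    have hs := hB _ hσ
    have hw := inB_mul (inB_inv hu) hs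
    obtain ⟨x, y, hx, hy, hxy, hl⟩ := lenB_exists hw (by rintro h0; rw [h0, lenB_one] at hk; omega)
    have hr := rf_inB hx hy hxy
    have hinv := rf_inv hx.1 hy.1 hxy
    have hsq := rf_sq hx.1 hy.1 hxy
    have hle := lenB_rf_le hx hy hxy
    have hur := inB_mul hu hr
    have e1 : (u * rf x y)⁻¹ * σ = rf x y * (u⁻¹ * σ) := by rw [mul_inv_rev, hinv, mul_assoc]
    have a1 := lenB_mul hur (inB_mul (inB_inv hur) hs)
    rw [mul_inv_cancel_left, e1] at a1
    have a2 := lenB_mul hu hr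
    unfold leB at h
    have hst : St (u * rf x y) := by
      refine ih σ _ hσ hur ?_ ?_
      · unfold leB
        rw [e1]; omega
      · rw [e1]; omega
    set g := u * rf x y with hg
    have hgx : g x ∈ signedSet n := (inB_maps hur x).2 hx
    have hgy : g y ∈ signedSet n := (inB_maps hur y).2 hy
    have hgxy : g x ≠ g y := fun h => hxy (g.injective h)
    have e2 : rf (g x) (g y) * g = u := by
      rw [← rf_conj n hur hx.1 hy.1 hxy hgx.1 hgy.1, inv_mul_cancel_right, hg, mul_assoc, hsq, mul_one]
    have e3 : lenB n (rf (g x) (g y) * g) + 1 = lenB n g := by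
      rw [e2]; omega
    rcases hRt _ _ hgx hgy hgxy with h' | h'
    · rw [← e2]; exact hmove _ _ _ hst hgx hgy hgxy h' e3
    · rw [rf_comm hgx.1 hgy.1 hgxy] at e2 e3
      rw [← e2]; exact hmove _ _ _ hst hgy hgx (Ne.symm hgxy) h' e3

include hmove in
lemma Dl_congr (s : List ℤ) (hs : ∀ x ∈ s, x ∈ signedSet n) (F F' : Equiv.Perm ℤ → ℤ)
    (h : ∀ τ, St τ → F τ = F' τ) : ∀ σ, St σ → Dl n R s F σ = Dl n R s F' σ := by
  induction s with
  | nil => exact h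
  | cons x s ih =>
    intro σ hσ
    simp only [Dl, Dx]
    refine Finset.sum_congr rfl fun y hy => ?_
    rw [mem_Yset] at hy
    split_ifs with h
    · exact ih (fun y hy => hs y (by simp [hy])) _
        (hmove _ _ _ hσ (hs x (by simp)) hy.1 (Ne.symm hy.2.1) hy.2.2 h)
    · rfl

lemma Icc_signed {x : ℤ} (h : x ∈ Finset.Icc (1:ℤ) n) : x ∈ signedSet n := by
  rw [Finset.mem_Icc] at h
  exact ⟨by omega, by rw [abs_of_pos (by omega)]; omega⟩

include hB hmove hRt hsum in
lemma PP_Dl (F : Equiv.Perm ℤ → ℤ) (σ : Equiv.Perm ℤ) (hσ : St σ) :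
    PP n F σ = ∑ T ∈ (Finset.Icc (1:ℤ) n).powerset, Dl n R T.toList F σ := by
  classical
  have h1 : ∀ T ∈ (Finset.Icc (1:ℤ) n).powerset, Dl n R T.toList F σ =
      ∑ u ∈ BF n, if leB n u σ then Dl n R T.toList delt u * F (u⁻¹ * σ) else 0 := by
    intro T hT
    refine Dl_conv n R _ (fun x hx => Icc_signed n ?_) F σ (hB _ hσ)
    exact Finset.mem_powerset.1 hT (by simpa using hx)
  rw [Finset.sum_congr rfl h1, Finset.sum_comm, PP, Finset.sum_filter]
  refine Finset.sum_congr rfl fun u hu => ?_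
  split_ifs with h
  · rw [← Finset.sum_mul, hsum u (St_le n R St hB hmove hRt _ σ u hσ (mem_BF.1 hu) h rfl), one_mul]
  · simp

include hB hmove hRt hsum in
lemma PP_iter (F : Equiv.Perm ℤ → ℤ) : ∀ (k : ℕ) (σ : Equiv.Perm ℤ), St σ →
    (PP n)^[k] F σ = SumT n k (fun s => Dl n R s F σ) := by
  intro k
  induction k with
  | zero => intro σ hσ; rfl
  | succ k ih =>
    intro σ hσ
    rw [Function.iterate_succ_apply', PP_Dl n R St hB hmove hRt hsum _ σ hσ, SumT]
    refine Finset.sum_congr rfl fun T hT => ?_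
    rw [Dl_congr n R St hmove T.toList (fun x hx => Icc_signed n
      (Finset.mem_powerset.1 hT (by simpa using hx))) _ _ ih σ hσ, Dl_SumT]
    simp only [Dl_append]

end

lemma count_eq (p q m : ℕ) (hm : 2 ≤ m) (R : ℤ → ℤ → Prop) (St : Equiv.Perm ℤ → Prop)
    (hB : ∀ σ, St σ → inB (p + q) σ)
    (hmove : ∀ σ x y, St σ → x ∈ signedSet (p + q) → y ∈ signedSet (p + q) → x ≠ y → R x y →
      lenB (p + q) (rf x y * σ) + 1 = lenB (p + q) σ → St (rf x y * σ))
    (hRt : ∀ x y, x ∈ signedSet (p + q) → y ∈ signedSet (p + q) → x ≠ y → R x y ∨ R y x)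
    (hsum : ∀ σ, St σ →
      ∑ T ∈ (Finset.Icc (1:ℤ) (p + q : ℕ)).powerset, Dl (p + q) R T.toList delt σ = 1)
    (hγ : St (gammaPQ p q)) :
    (({f : Fin (m - 1) → Set (Set ℤ) |
        (∀ i, f i ∈ NCB p q) ∧
        (∀ i j : Fin (m - 1), i ≤ j → refines (f i) (f j))}.ncard : ℕ) : ℤ) =
      SumT (p + q) m (fun s => Dl (p + q) R s delt (gammaPQ p q)) := by
  rw [chains_eq, ← PP_iter (p + q) R St hB hmove hRt hsum delt m _ hγ]
  have := Ch_PP (p + q) (m - 1) (gammaPQ p q) (hB _ hγ)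
  rw [show m - 1 + 1 = m by omega] at this
  rw [← this]
  rfl

set_option linter.unusedSectionVars false
set_option linter.unusedSimpArgs false
set_option linter.unusedVariables false

def fhI : ℤ → List ℤ → ℤ
  | h, [] => if h = -1 then 1 else 0
  | h, a :: l => if 0 ≤ h then fhI (h + a) l else 0

def gdI : ℤ → List ℤ → ℤ
  | _, [] => 1
  | h, a :: l => if 0 ≤ h then gdI (h + a) l else 0

def hitI : ℤ → List ℤ → ℤ
  | d, [] => if d = -1 then 1 else 0
  | d, a :: l => if d = -1 then 1 else hitI (d + a) l

lemma fhI_append (u l : List ℤ) : ∀ h, fhI h (u ++ l) = gdI h u * fhI (h + u.sum) l := by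
  induction u with
  | nil => intro h; simp [gdI]
  | cons a u ih =>
    intro h
    simp only [List.cons_append, fhI, gdI, ih, List.sum_cons]
    split_ifs
    · rw [add_assoc]
    · simp

lemma key2 (t : List ℤ) : ∀ (h H : ℤ), (∀ a ∈ t, -1 ≤ a) → -1 ≤ h → 0 ≤ H →
    fhI (H + 1 + h) t = ∑ i ∈ Finset.range t.length, fhI h (t.take i) * fhI H (t.drop i) := by
  induction t with
  | nil => intro h H _ h1 h2; simp [fhI]; omega
  | cons a l ih =>
    intro h H ht h1 h2
    rw [List.length_cons, Finset.sum_range_succ']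
    simp only [List.take_succ_cons, List.drop_succ_cons, List.take_zero, List.drop_zero, fhI]
    have ha := ht a (by simp)
    rw [if_pos (by omega : 0 ≤ H + 1 + h), if_pos h2]
    by_cases hh : h = -1
    · subst hh
      simp
    · simp only [if_pos (by omega : 0 ≤ h)]
      rw [if_neg hh, add_assoc,
        ih (h + a) H (fun b hb => ht b (by simp [hb])) (by omega) h2]
      simp

lemma key1 (G : ℤ → ℤ) (t : List ℤ) : ∀ d, -1 ≤ d → (∀ a ∈ t, -1 ≤ a) →
    ∑ i ∈ Finset.range (t.length + 1), fhI d (t.take i) * G (t.drop i).sum =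
      hitI d t * G (d + 1 + t.sum) := by
  induction t with
  | nil =>
    intro d hd _
    simp only [List.length_nil, zero_add, Finset.sum_range_one, List.take_nil, List.drop_nil, fhI, hitI,
      List.sum_nil, add_zero]
    split_ifs with h
    · subst h; simp
    · simp
  | cons a l ih =>
    intro d hd ht
    rw [List.length_cons, Finset.sum_range_succ']
    simp only [List.take_succ_cons, List.drop_succ_cons, List.take_zero, List.drop_zero, fhI, hitI]
    have ha := ht a (by simp)
    by_cases hh : d = -1
    · subst hh
      simp
    · have h3 := ih (d + a) (by omega) (fun b hb => ht b (by simp [hb]))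
      rw [if_neg hh, if_neg hh, List.sum_cons]
      simp only [if_pos (by omega : 0 ≤ d)]
      rw [h3]
      ring_nf

lemma hit_cases (t : List ℤ) : ∀ d, -1 ≤ d → (∀ a ∈ t, -1 ≤ a) →
    (hitI d t = 1 ∧ ∀ W, W ≠ [] → fhI d (t ++ W) = 0) ∨
    (hitI d t = 0 ∧ 0 ≤ d + t.sum ∧ ∀ W, fhI d (t ++ W) = fhI (d + t.sum) W) := by
  induction t with
  | nil =>
    intro d hd _
    by_cases hh : d = -1
    · left
      subst hh
      refine ⟨by simp [hitI], fun W hW => ?_⟩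
      cases W with
      | nil => simp at hW
      | cons a W => simp [fhI]
    · right
      refine ⟨by simp [hitI, hh], by simp; omega, by simp⟩
  | cons a l ih =>
    intro d hd ht
    have ha := ht a (by simp)
    by_cases hh : d = -1
    · left
      subst hh
      exact ⟨by simp [hitI], fun W hW => by simp [fhI]⟩
    · simp only [hitI, if_neg hh, List.cons_append, fhI, if_pos (by omega : 0 ≤ d), List.sum_cons, ← add_assoc]
      exact ih (d + a) (by omega) (fun b hb => ht b (by simp [hb]))

lemma fhI_sum (l : List ℤ) : ∀ h, h + l.sum ≠ -1 → fhI h l = 0 := by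
  induction l with
  | nil => intro h hh; simp at hh; simp [fhI, hh]
  | cons a l ih =>
    intro h hh
    simp only [fhI]
    split_ifs
    · exact ih _ (by rw [List.sum_cons] at hh; rwa [add_assoc])
    · rfl

def mn : List ℤ → ℤ
  | [] => 0
  | a :: l => min 0 (a + mn l)

lemma mn_le (l : List ℤ) : mn l ≤ 0 := by cases l <;> simp [mn]

lemma mn_append (u l : List ℤ) : mn (u ++ l) = min (mn u) (u.sum + mn l) := by
  induction u with
  | nil => simp [mn, mn_le]
  | cons a u ih =>
    simp only [List.cons_append, mn, ih, List.sum_cons]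
    omega

lemma mn_le_sum (l : List ℤ) : mn l ≤ l.sum := by
  have := mn_append l []
  simp [mn] at this
  exact this

lemma gdI_mn (u : List ℤ) : ∀ h, 0 ≤ h + u.sum → gdI h u = if 0 ≤ h + mn u then 1 else 0 := by
  induction u with
  | nil => intro h hh; simp at hh; simp [gdI, mn, hh]
  | cons a u ih =>
    intro h hh
    rw [List.sum_cons] at hh
    simp only [gdI, mn, ih (h + a) (by omega)]
    have := mn_le u
    split_ifs <;> first | rfl | omega

lemma rec_sum (ψ : ℤ → ℤ) (W : List ℤ) : (∀ a ∈ W, -1 ≤ a) →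
    ∑ i ∈ Finset.range W.length, (if (W.take (i + 1)).sum < mn (W.take i) then
      ψ (W.take (i + 1)).sum else 0) = ∑ l ∈ Finset.Ico (mn W) 0, ψ l := by
  induction W using List.reverseRecOn with
  | nil => intro _; simp [mn]
  | append_singleton W a ih =>
    intro hW
    rw [List.length_append, List.length_singleton, Finset.sum_range_succ]
    have h1 : ∑ i ∈ Finset.range W.length, (if ((W ++ [a]).take (i + 1)).sum < mn ((W ++ [a]).take i) then
      ψ ((W ++ [a]).take (i + 1)).sum else 0) = ∑ i ∈ Finset.range W.length, (if (W.take (i + 1)).sum < mn (W.take i) then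
      ψ (W.take (i + 1)).sum else 0) := by
      refine Finset.sum_congr rfl fun i hi => ?_
      rw [Finset.mem_range] at hi
      rw [List.take_append_of_le_length (by omega), List.take_append_of_le_length (by omega)]
    rw [h1, ih (fun b hb => hW b (by simp [hb]))]
    have h2 : (W ++ [a]).take (W.length + 1) = W ++ [a] := List.take_of_length_le (by simp)
    have h3 : (W ++ [a]).take W.length = W := by simp
    rw [h2, h3, mn_append]
    have ha := hW a (by simp)
    have h4 := mn_le_sum W
    have h5 := mn_le W
    simp only [mn, List.sum_append, List.sum_cons, List.sum_nil, add_zero]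
    split_ifs with h
    · have e : min (mn W) (W.sum + min 0 a) = mn W - 1 := by omega
      have e2 : W.sum + a = mn W - 1 := by omega
      rw [e, e2, show Finset.Ico (mn W - 1) 0 = insert (mn W - 1) (Finset.Ico (mn W) 0) by
        ext; simp; omega, Finset.sum_insert (by simp), add_comm]
    · have e : min (mn W) (W.sum + min 0 a) = mn W := by omega
      rw [e, add_zero]

lemma rot_term (c : ℤ) (hc : 1 ≤ c) (W : List ℤ) (hW : W.sum = -c) (i : ℕ) (hi : i < W.length) :
    fhI (c - 1) (W.drop (i + 1) ++ W.take (i + 1)) =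
      if (W.take (i + 1)).sum < mn (W.take i) then
        (if (W.take (i + 1)).sum < mn W + c then 1 else 0) else 0 := by
  have e0 : W.take (i + 1) ++ W.drop (i + 1) = W := List.take_append_drop _ _
  have e1 : (W.take (i + 1)).sum + (W.drop (i + 1)).sum = -c := by
    rw [← List.sum_append, e0, hW]
  have e2 : mn W = min (mn (W.take (i + 1))) ((W.take (i + 1)).sum + mn (W.drop (i + 1))) := by
    rw [← mn_append, e0]
  have e3 : W.take (i + 1) = W.take i ++ [W[i]] := by simp
  have e4 : mn (W.take (i + 1)) = min (mn (W.take i)) (W.take (i + 1)).sum := by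
    rw [e3, mn_append]
    have := mn_le_sum (W.take i)
    simp only [mn, List.sum_append, List.sum_cons, List.sum_nil, add_zero]
    omega
  have e5 : (W.take (i + 1)).sum = (W.take i).sum + W[i] := by rw [e3, List.sum_append]; simp
  have l1 := mn_le (W.take i)
  have l2 := mn_le (W.drop (i + 1))
  have l3 := mn_le_sum (W.take i)
  have l4 := mn_le_sum (W.drop (i + 1))
  have e6 : fhI (c - 1 + (W.drop (i + 1)).sum) (W.take (i + 1)) =
      fhI (c - 1 + (W.drop (i + 1)).sum) (W.take i ++ [W[i]]) := by rw [e3]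
  rw [fhI_append, e6, fhI_append]
  clear e0 e3 e6
  generalize (W.take (i + 1)).sum = S at *
  generalize hD : (W.drop (i + 1)).sum = D at *
  generalize hmD : mn (W.drop (i + 1)) = mD at *
  generalize mn (W.take (i + 1)) = mS at *
  simp only [fhI]
  by_cases h : S < mn (W.take i)
  · rw [min_eq_right h.le] at e4
    subst e4
    rw [min_eq_right (by omega)] at e2
    rw [e2]
    rw [if_pos h, gdI_mn _ _ (by omega), gdI_mn _ _ (by omega), if_pos (by omega : 0 ≤ c - 1 + D + mn (W.take i)),
      if_pos (by omega : 0 ≤ c - 1 + D + (W.take i).sum),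
      if_pos (by omega : c - 1 + D + (W.take i).sum + W[i] = -1), hmD]
    simp only [mul_one, one_mul]
    refine if_congr ?_ rfl rfl
    omega
  · rw [if_neg h]
    by_cases h0 : 0 ≤ c - 1 + D + (W.take i).sum
    · rw [gdI_mn (W.take i) _ h0, if_neg (by omega)]; simp
    · rw [if_neg h0]; simp

lemma cycle_lemma (c : ℤ) (hc : 1 ≤ c) (W : List ℤ) (hW : ∀ a ∈ W, -1 ≤ a) :
    ∑ i ∈ Finset.range W.length, fhI (c - 1) (W.drop (i + 1) ++ W.take (i + 1)) =
      if W.sum = -c then c else 0 := by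
  split_ifs with h
  · rw [Finset.sum_congr rfl fun i hi => rot_term c hc W h i (Finset.mem_range.1 hi)]
    rw [rec_sum (fun l => if l < mn W + c then 1 else 0) W hW]
    have h1 := mn_le_sum W
    rw [← Finset.sum_filter, show (Finset.Ico (mn W) 0).filter (fun l => l < mn W + c) =
      Finset.Ico (mn W) (mn W + c) by ext l; simp; omega]
    simp
    omega
  · refine Finset.sum_eq_zero fun i _ => fhI_sum _ _ ?_
    rw [List.sum_append, add_comm (W.drop (i + 1)).sum, ← List.sum_append, List.take_append_drop]
    omega

lemma cycle_lemma' (c : ℤ) (hc : 1 ≤ c) (W : List ℤ) (hW : ∀ a ∈ W, -1 ≤ a) :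
    ∑ i ∈ Finset.range W.length, fhI (c - 1) (W.drop i ++ W.take i) =
      if W.sum = -c then c else 0 := by
  rw [← cycle_lemma c hc W hW]
  have := Finset.sum_range_succ (fun i => fhI (c - 1) (W.drop i ++ W.take i)) W.length
  rw [Finset.sum_range_succ'] at this
  simp only [List.drop_length, List.take_length, List.drop_zero, List.take_zero, List.append_nil,
    List.nil_append] at this
  linarith

set_option linter.unusedSectionVars false
set_option linter.unusedSimpArgs false
set_option linter.unusedVariables false

def Pth (σ : Equiv.Perm ℤ) : List ℤ → ℤ → Prop
  | [], _ => True
  | a :: l, z => σ a = l.headD z ∧ Pth σ l z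

lemma headD_app (u w : List ℤ) (z : ℤ) : (u ++ w).headD z = u.headD (w.headD z) := by
  cases u <;> simp

lemma Pth_append {σ : Equiv.Perm ℤ} {u w : List ℤ} {z : ℤ} :
    Pth σ (u ++ w) z ↔ Pth σ u (w.headD z) ∧ Pth σ w z := by
  induction u with
  | nil => simp [Pth]
  | cons a u ih =>
    simp only [List.cons_append, Pth, ih, headD_app, and_assoc]

lemma headD_neg (l : List ℤ) (z : ℤ) : (l.map (fun a => -a)).headD (-z) = -(l.headD z) := by
  cases l <;> simp

lemma Pth_neg {σ : Equiv.Perm ℤ} (h : ∀ a, σ (-a) = -σ a) {l : List ℤ} {z : ℤ} (hp : Pth σ l z) :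
    Pth σ (l.map (fun a => -a)) (-z) := by
  induction l with
  | nil => trivial
  | cons a l ih =>
    simp only [List.map_cons, Pth, headD_neg]
    exact ⟨by rw [h, hp.1], ih hp.2⟩

lemma Pth_mul {σ r : Equiv.Perm ℤ} {l : List ℤ} {z : ℤ} (hp : Pth σ l z)
    (hr : ∀ b ∈ l.tail, r b = b) : Pth (r * σ) l (r z) := by
  induction l with
  | nil => trivial
  | cons a l ih =>
    simp only [List.tail_cons] at hr
    refine ⟨?_, ih hp.2 (fun b hb => hr b (List.mem_of_mem_tail hb))⟩
    rw [Equiv.Perm.mul_apply, hp.1]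
    cases l with
    | nil => rfl
    | cons b l => exact hr b (by simp)

lemma Pth_const {σ : Equiv.Perm ℤ} {l : List ℤ} {z : ℤ} (hp : Pth σ l z) (v : ℤ → ℝ)
    (hv : ∀ a, v (σ a) = v a) : ∀ a ∈ l, v a = v z := by
  induction l with
  | nil => simp
  | cons b l ih =>
    have ih := ih hp.2
    intro a ha
    rcases List.mem_cons.1 ha with rfl | ha
    · rw [← hv, hp.1]
      cases l with
      | nil => rfl
      | cons c l => exact ih c (by simp)
    · exact ih a ha

lemma Pth_maps {σ : Equiv.Perm ℤ} {l : List ℤ} {z : ℤ} (hp : Pth σ l z) :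
    ∀ a ∈ l, σ a ∈ l ∨ σ a = z := by
  induction l with
  | nil => simp
  | cons b l ih =>
    have ih := ih hp.2
    intro a ha
    rcases List.mem_cons.1 ha with rfl | ha
    · rw [hp.1]
      cases l with
      | nil => right; rfl
      | cons c l => left; simp
    · rcases ih a ha with h | h
      · left; simp [h]
      · right; exact h

lemma Pth_surj {σ : Equiv.Perm ℤ} {l : List ℤ} {z : ℤ} (hp : Pth σ l z) :
    (∀ b ∈ l.tail, ∃ a ∈ l, σ a = b) ∧ (l ≠ [] → ∃ a ∈ l, σ a = z) := by
  induction l with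
  | nil => simp
  | cons b l ih =>
    have ih := ih hp.2
    cases l with
    | nil => simp; exact hp.1
    | cons c l =>
      constructor
      · intro d hd
        rw [List.tail_cons, List.mem_cons] at hd
        rcases hd with rfl | hd
        · exact ⟨b, by simp, hp.1⟩
        · obtain ⟨a, ha, h⟩ := ih.1 d hd
          exact ⟨a, by simp at ha ⊢; tauto, h⟩
      · intro _
        obtain ⟨a, ha, h⟩ := ih.2 (by simp)
        exact ⟨a, by simp at ha ⊢; tauto, h⟩

def nab (L : List ℤ) : Multiset ℕ := ((L.map Int.natAbs : List ℕ) : Multiset ℕ)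

@[simp] lemma nab_nil : nab [] = 0 := rfl
lemma nab_cons (a : ℤ) (L : List ℤ) : nab (a :: L) = a.natAbs ::ₘ nab L := rfl
lemma nab_append (u w : List ℤ) : nab (u ++ w) = nab u + nab w := by simp [nab]
lemma nab_neg (u : List ℤ) : nab (u.map (fun a => -a)) = nab u := by
  simp [nab, Function.comp_def]
lemma mem_nab {k : ℕ} {L : List ℤ} : k ∈ nab L ↔ ∃ a ∈ L, a.natAbs = k := by simp [nab]
lemma mem_nab_of {a : ℤ} {L : List ℤ} (h : a ∈ L) : a.natAbs ∈ nab L := mem_nab.2 ⟨a, h, rfl⟩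

structure RP (R : ℤ → ℤ → Prop) : Prop where
  neg : ∀ x y, R x y → R (-x) (-y)
  asym : ∀ x y, x.natAbs ≠ y.natAbs → R x y → ¬ R y x
  self : ∀ x, R x (-x)

structure AL (R : ℤ → ℤ → Prop) (σ : Equiv.Perm ℤ) (A : List ℤ) : Prop where
  ne : A ≠ []
  pth : Pth σ A (A.headD 0)
  pw : A.Pairwise R

structure BL (R : ℤ → ℤ → Prop) (σ : Equiv.Perm ℤ) (L : List ℤ) : Prop where
  pth : Pth σ L (-(L.headD 0))
  pw : L.Pairwise (fun x y => R x y ∧ R y (-x))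

structure Stt (n : ℕ) (R : ℤ → ℤ → Prop) (σ : Equiv.Perm ℤ) (L1 L2 : List ℤ) (As : Multiset (List ℤ)) :
    Prop where
  hB : inB n σ
  cA : ∀ A ∈ As, AL R σ A
  b1 : BL R σ L1
  b2 : BL R σ L2
  cr : ∀ a b : ℤ, a.natAbs ∈ nab L1 → b.natAbs ∈ nab L2 → R b a
  cov : nab L1 + nab L2 + As.bind nab = (Finset.Icc 1 n).val

section
variable {n : ℕ} {R : ℤ → ℤ → Prop} (hR : RP R)

include hR in
lemma AL_neg {σ : Equiv.Perm ℤ} (h : inB n σ) {A : List ℤ} (hA : AL R σ A) :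
    AL R σ (A.map (fun a => -a)) := by
  refine ⟨by simpa using hA.ne, ?_, ?_⟩
  · have := Pth_neg h.1 hA.pth
    rwa [← headD_neg, neg_zero] at this
  · rw [List.pairwise_map]
    exact hA.pw.imp (fun h => hR.neg _ _ h)

include hR in
lemma BL_neg {σ : Equiv.Perm ℤ} (h : inB n σ) {L : List ℤ} (hL : BL R σ L) :
    BL R σ (L.map (fun a => -a)) := by
  refine ⟨?_, ?_⟩
  · have := Pth_neg h.1 hL.pth
    rwa [← headD_neg, neg_zero] at this
  · rw [List.pairwise_map]
    exact hL.pw.imp (fun h => ⟨hR.neg _ _ h.1, hR.neg _ _ h.2⟩)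

include hR in
lemma BL_rot {σ : Equiv.Perm ℤ} (h : inB n σ) {u t : List ℤ} {x : ℤ} (hL : BL R σ (u ++ x :: t)) :
    BL R σ (x :: t ++ u.map (fun a => -a)) := by
  have hp := hL.pth
  have hw := hL.pw
  rw [Pth_append] at hp
  rw [List.pairwise_append] at hw
  constructor
  · rw [Pth_append]
    have h1 : (List.map (fun a => -a) u).headD (-(x :: t ++ List.map (fun a => -a) u).headD 0) =
        -(u ++ x :: t).headD 0 := by
      cases u <;> simp
    rw [h1]
    refine ⟨hp.2, ?_⟩
    have := Pth_neg h.1 hp.1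
    simpa using this
  · rw [List.pairwise_append]
    refine ⟨hw.2.1, ?_, ?_⟩
    · rw [List.pairwise_map]
      exact hw.1.imp (fun h => ⟨hR.neg _ _ h.1, hR.neg _ _ h.2⟩)
    · intro a ha b hb
      obtain ⟨c, hc, rfl⟩ := List.mem_map.1 hb
      have := hw.2.2 c hc a ha
      exact ⟨this.2, hR.neg _ _ this.1⟩

include hR in
lemma BL_norm {σ : Equiv.Perm ℤ} (h : inB n σ) {L : List ℤ} (hL : BL R σ L) {x : ℤ}
    (hx : x.natAbs ∈ nab L) : ∃ t, BL R σ (x :: t) ∧ nab (x :: t) = nab L := by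
  have key : ∀ L, BL R σ L → x ∈ L → ∃ t, BL R σ (x :: t) ∧ nab (x :: t) = nab L := by
    intro L hL hx
    obtain ⟨u, t, rfl⟩ := List.append_of_mem hx
    refine ⟨t ++ u.map (fun a => -a), BL_rot hR h hL, ?_⟩
    rw [← List.cons_append, nab_append, nab_append, nab_neg, add_comm]
  obtain ⟨a, ha, hax⟩ := mem_nab.1 hx
  rcases Int.natAbs_eq_natAbs_iff.1 hax with rfl | rfl
  · exact key L hL ha
  · obtain ⟨t, h1, h2⟩ := key _ (BL_neg hR h hL) (by simpa using ha)
    exact ⟨t, h1, by rw [h2, nab_neg]⟩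

lemma Stt.nodup {σ L1 L2 As} (h : Stt n R σ L1 L2 As) : (nab L1 + nab L2 + As.bind nab).Nodup := by
  rw [h.cov]; exact (Finset.Icc 1 n).nodup

lemma natAbs_signed {x : ℤ} : x.natAbs ∈ (Finset.Icc 1 n).val ↔ x ∈ signedSet n := by
  rw [Finset.mem_val, Finset.mem_Icc]
  unfold signedSet
  simp only [Set.mem_ofPred_eq, Int.abs_eq_natAbs]
  omega

/-- value-preserving normal forms with respect to a signed point -/
inductive NF (n : ℕ) (R : ℤ → ℤ → Prop) (σ : Equiv.Perm ℤ) (x : ℤ) : List ℤ → List ℤ → Multiset (List ℤ) → Prop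
  | A (L1 L2 As u t) (h : Stt n R σ L1 L2 ((u ++ x :: t) ::ₘ As)) : NF n R σ x L1 L2 ((u ++ x :: t) ::ₘ As)
  | B1 (L2 As t) (h : Stt n R σ (x :: t) L2 As) : NF n R σ x (x :: t) L2 As
  | B2 (L1 As t) (h : Stt n R σ L1 (x :: t) As) : NF n R σ x L1 (x :: t) As

/-- same weights -/
def Sim (L1 L2 : List ℤ) (As : Multiset (List ℤ)) (L1' L2' : List ℤ) (As' : Multiset (List ℤ)) : Prop :=
  nab L1 = nab L1' ∧ nab L2 = nab L2' ∧
    As.map (fun A => A.map Int.natAbs) = As'.map (fun A => A.map Int.natAbs)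

include hR in
lemma exists_NF {σ L1 L2 As} (h : Stt n R σ L1 L2 As) {x : ℤ} (hx : x ∈ signedSet n) :
    ∃ L1' L2' As', NF n R σ x L1' L2' As' ∧ Sim L1 L2 As L1' L2' As' := by
  have h1 : x.natAbs ∈ nab L1 + nab L2 + As.bind nab := by
    rw [h.cov]; exact natAbs_signed.2 hx
  rw [Multiset.mem_add, Multiset.mem_add] at h1
  rcases h1 with (h1 | h1) | h1
  · obtain ⟨t, ht, hn⟩ := BL_norm hR h.hB h.b1 h1
    refine ⟨_, _, _, NF.B1 L2 As t ⟨h.hB, h.cA, ht, h.b2, ?_, ?_⟩, hn.symm, rfl, rfl⟩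
    · rw [hn]; exact h.cr
    · rw [hn]; exact h.cov
  · obtain ⟨t, ht, hn⟩ := BL_norm hR h.hB h.b2 h1
    refine ⟨_, _, _, NF.B2 L1 As t ⟨h.hB, h.cA, h.b1, ht, ?_, ?_⟩, rfl, hn.symm, rfl⟩
    · rw [hn]; exact h.cr
    · rw [hn]; exact h.cov
  · obtain ⟨A, hA, hxA⟩ := Multiset.mem_bind.1 h1
    obtain ⟨As', rfl⟩ := Multiset.exists_cons_of_mem hA
    obtain ⟨a, ha, hax⟩ := mem_nab.1 hxA
    rcases Int.natAbs_eq_natAbs_iff.1 hax with rfl | rfl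
    · obtain ⟨u, t, rfl⟩ := List.append_of_mem ha
      exact ⟨_, _, _, NF.A L1 L2 As' u t h, rfl, rfl, rfl⟩
    · obtain ⟨u, t, hut⟩ := List.append_of_mem (show x ∈ A.map (fun a => -a) by simpa using ha)
      refine ⟨_, _, _, NF.A L1 L2 As' u t ⟨h.hB, ?_, h.b1, h.b2, h.cr, ?_⟩, rfl, rfl, ?_⟩
      · intro B hB
        rcases Multiset.mem_cons.1 hB with rfl | hB
        · rw [← hut]; exact AL_neg hR h.hB (h.cA _ (by simp))
        · exact h.cA _ (by simp [hB])
      · rw [← h.cov, Multiset.cons_bind, Multiset.cons_bind, ← hut, nab_neg]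
      · rw [← hut]; simp [Function.comp_def]

/-! reflections -/
lemma rf_left {x y : ℤ} (hx : x ≠ 0) (hy : y ≠ 0) (hxy : x ≠ y) : rf x y x = y := by
  rw [rf_apply hx hy hxy]; simp
lemma rf_right {x y : ℤ} (hx : x ≠ 0) (hy : y ≠ 0) (hxy : x ≠ y) : rf x y y = x := by
  rw [rf_apply hx hy hxy]; simp [Ne.symm hxy]
lemma rf_nleft {x y : ℤ} (hx : x ≠ 0) (hy : y ≠ 0) (hxy : x ≠ y) : rf x y (-x) = -y := by
  rw [rf_apply hx hy hxy]; split_ifs <;> omega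
lemma rf_fix {x y b : ℤ} (hx : x ≠ 0) (hy : y ≠ 0) (hxy : x ≠ y) (h1 : b.natAbs ≠ x.natAbs)
    (h2 : b.natAbs ≠ y.natAbs) : rf x y b = b := by
  rw [rf_apply hx hy hxy]; split_ifs <;> omega

lemma Pth_other {σ : Equiv.Perm ℤ} {x y z : ℤ} {l : List ℤ} (hx : x ≠ 0) (hy : y ≠ 0) (hxy : x ≠ y)
    (h : Pth σ l z) (h1 : ∀ b ∈ l.tail, b.natAbs ≠ x.natAbs) (h2 : ∀ b ∈ l.tail, b.natAbs ≠ y.natAbs) :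
    Pth (rf x y * σ) l (rf x y z) :=
  Pth_mul h (fun b hb => rf_fix hx hy hxy (h1 b hb) (h2 b hb))

lemma AL_other {σ : Equiv.Perm ℤ} {x y : ℤ} {l : List ℤ} (hx : x ≠ 0) (hy : y ≠ 0) (hxy : x ≠ y)
    (h : AL R σ l) (h1 : x.natAbs ∉ nab l) (h2 : y.natAbs ∉ nab l) : AL R (rf x y * σ) l := by
  have e1 : ∀ b ∈ l, b.natAbs ≠ x.natAbs := fun b hb e => h1 (e ▸ mem_nab_of hb)
  have e2 : ∀ b ∈ l, b.natAbs ≠ y.natAbs := fun b hb e => h2 (e ▸ mem_nab_of hb)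
  refine ⟨h.ne, ?_, h.pw⟩
  have := Pth_other hx hy hxy h.pth (fun b hb => e1 b (List.mem_of_mem_tail hb))
    (fun b hb => e2 b (List.mem_of_mem_tail hb))
  have hm : l.headD 0 ∈ l := by
    have := h.ne
    cases l <;> simp at *
  rwa [rf_fix hx hy hxy (e1 _ hm) (e2 _ hm)] at this

lemma BL_other {σ : Equiv.Perm ℤ} {x y : ℤ} {l : List ℤ} (hx : x ≠ 0) (hy : y ≠ 0) (hxy : x ≠ y)
    (h : BL R σ l) (h1 : x.natAbs ∉ nab l) (h2 : y.natAbs ∉ nab l) : BL R (rf x y * σ) l := by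
  have e1 : ∀ b ∈ l, b.natAbs ≠ x.natAbs := fun b hb e => h1 (e ▸ mem_nab_of hb)
  have e2 : ∀ b ∈ l, b.natAbs ≠ y.natAbs := fun b hb e => h2 (e ▸ mem_nab_of hb)
  refine ⟨?_, h.pw⟩
  have := Pth_other hx hy hxy h.pth (fun b hb => e1 b (List.mem_of_mem_tail hb))
    (fun b hb => e2 b (List.mem_of_mem_tail hb))
  cases l with
  | nil => trivial
  | cons a l =>
    rwa [rf_fix hx hy hxy (by simpa using e1 a (by simp)) (by simpa using e2 a (by simp))] at this
end

set_option linter.unusedSectionVars false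
set_option linter.unusedSimpArgs false
set_option linter.unusedVariables false

section
variable {n : ℕ} {R : ℤ → ℤ → Prop}

lemma al_split {σ : Equiv.Perm ℤ} {u v w : List ℤ} {x y : ℤ} (hx : x ≠ 0) (hy : y ≠ 0)
    (h : AL R σ (u ++ x :: (v ++ y :: w))) (hn : (nab (u ++ x :: (v ++ y :: w))).Nodup) :
    AL R (rf x y * σ) (x :: v) ∧ AL R (rf x y * σ) (u ++ y :: w) := by
  have hn' : ((u ++ x :: (v ++ y :: w)).map Int.natAbs).Nodup := hn
  simp only [List.map_append, List.map_cons, List.nodup_append, List.nodup_cons, List.mem_map,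
    List.mem_cons, List.mem_append, not_or, not_exists, not_and] at hn'
  have hxy : x ≠ y := by
    rintro rfl; exact hn'.2.1.1.2.1 rfl
  have hp := h.pth
  rw [Pth_append, ← List.cons_append, Pth_append] at hp
  obtain ⟨hp1, hp2, hp3⟩ := hp
  have hw := h.pw
  have uf : ∀ b ∈ u, rf x y b = b := by
    intro b hb
    refine rf_fix hx hy hxy ?_ ?_
    · exact hn'.2.2 _ ⟨b, hb, rfl⟩ _ (Or.inl rfl)
    · exact hn'.2.2 _ ⟨b, hb, rfl⟩ _ (Or.inr (Or.inr (Or.inl rfl)))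
  have vf : ∀ b ∈ v, rf x y b = b := by
    intro b hb
    refine rf_fix hx hy hxy ?_ ?_
    · exact hn'.2.1.1.1 _ hb
    · exact hn'.2.1.2.2.2 _ ⟨b, hb, rfl⟩ _ (Or.inl rfl)
  have wf : ∀ b ∈ w, rf x y b = b := by
    intro b hb
    refine rf_fix hx hy hxy ?_ ?_
    · exact hn'.2.1.1.2.2 _ hb
    · exact hn'.2.1.2.2.1.1 _ hb
  refine ⟨⟨by simp, ?_, ?_⟩, ⟨by simp, ?_, ?_⟩⟩
  · have := Pth_mul (r := rf x y) hp2 (by simpa using vf)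
    simpa [rf_right hx hy hxy] using this
  · exact hw.sublist ((List.sublist_append_left (x :: v) (y :: w)).trans (List.sublist_append_right u _))
  · rw [Pth_append]
    constructor
    · have := Pth_mul (r := rf x y) hp1 (fun b hb => uf b (List.mem_of_mem_tail hb))
      simpa [rf_left hx hy hxy] using this
    · have := Pth_mul (r := rf x y) hp3 (by simpa using wf)
      cases u with
      | nil => simpa [rf_left hx hy hxy] using this
      | cons a u =>
        have ha := uf a (by simp)
        simpa [ha] using this
  · refine hw.sublist (List.Sublist.append_left ?_ u)
    exact List.Sublist.cons _ (List.sublist_append_right _ _)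

lemma bl_split {σ : Equiv.Perm ℤ} {v w : List ℤ} {x : ℤ} (hx : x ≠ 0) (hw0 : ∀ a ∈ w, a ≠ 0)
    (h : BL R σ (x :: (v ++ w))) (hn : (nab (x :: (v ++ w))).Nodup) :
    AL R (rf x (w.headD (-x)) * σ) (x :: v) ∧ BL R (rf x (w.headD (-x)) * σ) w := by
  have hn' : ((x :: (v ++ w)).map Int.natAbs).Nodup := hn
  simp only [List.map_append, List.map_cons, List.nodup_append, List.nodup_cons, List.mem_map,
    List.mem_cons, List.mem_append, not_or, not_exists, not_and] at hn'
  set y := w.headD (-x) with hyd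
  have hyw : w ≠ [] → y ∈ w := by
    intro hw; rw [hyd]; cases w with
    | nil => exact absurd rfl hw
    | cons c w => simp
  have hy : y ≠ 0 := by
    by_cases hw : w = []
    · subst hw; simp at hyd; omega
    · exact hw0 _ (hyw hw)
  have hxy : x ≠ y := by
    by_cases hw : w = []
    · subst hw; simp at hyd; omega
    · intro e; exact hn'.1.2 y (hyw hw) (by rw [e])
  have hp := h.pth
  rw [← List.cons_append, Pth_append] at hp
  obtain ⟨hp1, hp2⟩ := hp
  have hw := h.pw
  have vf : ∀ b ∈ v, rf x y b = b := by
    intro b hb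
    refine rf_fix hx hy hxy (hn'.1.1 _ hb) ?_
    by_cases hw : w = []
    · subst hw; simp at hyd; rw [hyd, Int.natAbs_neg]; exact hn'.1.1 _ hb
    · exact hn'.2.2.2 _ ⟨b, hb, rfl⟩ _ ⟨y, hyw hw, rfl⟩
  have wf : ∀ b ∈ w.tail, rf x y b = b := by
    intro b hb
    refine rf_fix hx hy hxy (hn'.1.2 _ (List.mem_of_mem_tail hb)) ?_
    cases w with
    | nil => simp at hb
    | cons c w =>
      simp at hyd hb hn'
      rw [hyd]; exact hn'.2.2.1.1 _ hb
  refine ⟨⟨by simp, ?_, ?_⟩, ⟨?_, ?_⟩⟩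
  · have := Pth_mul (r := rf x y) hp1 (by simpa using vf)
    simp only [List.cons_append, List.headD_cons] at this
    rw [← hyd, rf_right hx hy hxy] at this
    simpa using this
  · have := hw.sublist (List.sublist_append_left (x :: v) w)
    exact this.imp (fun h => h.1)
  · have := Pth_mul (r := rf x y) hp2 wf
    simp only [List.cons_append, List.headD_cons] at this
    rw [rf_nleft hx hy hxy] at this
    cases w with
    | nil => trivial
    | cons c w => simpa [hyd] using this
  · exact hw.sublist ((List.sublist_append_right v w).trans (List.sublist_cons_self _ _))

lemma al_join (hR : RP R) {σ : Equiv.Perm ℤ} (hσ : inB n σ) {t z : List ℤ} {x y : ℤ} (hx : x ≠ 0) (hy : y ≠ 0)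
    (h1 : BL R σ (y :: z)) (h2 : BL R σ (x :: t)) (hn : (nab (y :: z) + nab (x :: t)).Nodup)
    (hc : ∀ a b : ℤ, a.natAbs ∈ nab (y :: z) → b.natAbs ∈ nab (x :: t) → R b a) :
    AL R (rf x y * σ) (x :: t ++ (y :: z).map (fun a => -a)) := by
  have hn' : (((y :: z) ++ (x :: t)).map Int.natAbs).Nodup := by
    rw [← nab_append] at hn; exact hn
  simp only [List.map_append, List.map_cons, List.nodup_append, List.nodup_cons, List.mem_map,
    List.mem_cons, List.mem_append, not_or, not_exists, not_and] at hn'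
  have hxy : x ≠ y := by
    rintro rfl; exact hn'.2.2 _ (Or.inl rfl) _ (Or.inl rfl) rfl
  have h1' := BL_neg hR hσ h1
  refine ⟨by simp, ?_, ?_⟩
  · rw [Pth_append]
    constructor
    · have := Pth_other hx hy hxy h2.pth (z := _) ?_ ?_
      · simpa [rf_nleft hx hy hxy] using this
      · simpa using hn'.2.1.1
      · intro b hb e
        exact hn'.2.2 _ (Or.inl rfl) _ (Or.inr ⟨b, by simpa using hb, rfl⟩) e.symm
    · have := Pth_other hx hy hxy h1'.pth (z := _) ?_ ?_
      · simpa [rf_right hx hy hxy] using this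
      · intro b hb e
        simp only [List.map_cons, List.tail_cons, List.mem_map] at hb
        obtain ⟨c, hc, rfl⟩ := hb
        rw [Int.natAbs_neg] at e
        exact hn'.2.2 _ (Or.inr ⟨c, hc, rfl⟩) _ (Or.inl rfl) e
      · intro b hb e
        simp only [List.map_cons, List.tail_cons, List.mem_map] at hb
        obtain ⟨c, hc, rfl⟩ := hb
        rw [Int.natAbs_neg] at e
        exact hn'.1.1 _ hc e
  · rw [List.pairwise_append]
    refine ⟨h2.pw.imp (fun h => h.1), h1'.pw.imp (fun h => h.1), ?_⟩
    intro a ha b hb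
    refine hc b a ?_ (mem_nab_of ha)
    rw [← nab_neg]; exact mem_nab_of hb

lemma nd_left {s t : Multiset ℕ} (h : (s + t).Nodup) : s.Nodup :=
  Multiset.nodup_of_le (Multiset.le_add_right _ _) h
lemma nd_right {s t : Multiset ℕ} (h : (s + t).Nodup) : t.Nodup :=
  Multiset.nodup_of_le (Multiset.le_add_left _ _) h
lemma nd_dis {s t : Multiset ℕ} (h : (s + t).Nodup) {k : ℕ} (hk : k ∈ s) : k ∉ t := by
  rw [Multiset.nodup_add] at h
  exact fun h' => Multiset.disjoint_left.1 h.2.2 hk h'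

lemma sgn_ne {x : ℤ} (h : x ∈ signedSet n) : x ≠ 0 := h.1

lemma rf_mul_inB {σ : Equiv.Perm ℤ} {x y : ℤ} (hx : x ∈ signedSet n) (hy : y ∈ signedSet n) (hxy : x ≠ y)
    (hσ : inB n σ) : inB n (rf x y * σ) := inB_mul (rf_inB hx hy hxy) hσ

lemma Stt.mem_sgn {σ L1 L2 As} (h : Stt n R σ L1 L2 As) {x : ℤ}
    (hx : x.natAbs ∈ nab L1 + nab L2 + As.bind nab) : x ∈ signedSet n := by
  rw [h.cov] at hx; exact natAbs_signed.1 hx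

lemma moveA {σ L1 L2 As u v w x y} (h : Stt n R σ L1 L2 ((u ++ x :: (v ++ y :: w)) ::ₘ As)) :
    Stt n R (rf x y * σ) L1 L2 ((x :: v) ::ₘ (u ++ y :: w) ::ₘ As) := by
  have hnd := h.nodup
  rw [Multiset.cons_bind] at hnd
  have mx : x.natAbs ∈ nab (u ++ x :: (v ++ y :: w)) := mem_nab_of (by simp)
  have my : y.natAbs ∈ nab (u ++ x :: (v ++ y :: w)) := mem_nab_of (by simp)
  have hx : x ∈ signedSet n := h.mem_sgn (by rw [Multiset.cons_bind]; simp [mx])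
  have hy : y ∈ signedSet n := h.mem_sgn (by rw [Multiset.cons_bind]; simp [my])
  have hA := nd_left (nd_right hnd)
  have hxy : x ≠ y := by
    rintro rfl
    rw [nab_append, nab_cons, nab_append, nab_cons] at hA
    have := nd_right hA
    simp at this
  have dA : ∀ k ∈ nab (u ++ x :: (v ++ y :: w)), k ∉ nab L1 ∧ k ∉ nab L2 ∧ ∀ A ∈ As, k ∉ nab A := by
    intro k hk
    have h1 : k ∉ nab L1 + nab L2 := fun h' => nd_dis hnd h' (by simp [hk])
    have h2 := nd_dis (nd_right hnd) hk
    simp only [Multiset.mem_add, not_or] at h1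
    refine ⟨h1.1, h1.2, fun A hA hkA => h2 (Multiset.mem_bind.2 ⟨A, hA, hkA⟩)⟩
  obtain ⟨s1, s2⟩ := al_split hx.1 hy.1 (h.cA _ (by simp)) hA
  refine ⟨rf_mul_inB hx hy hxy h.hB, ?_, ?_, ?_, h.cr, ?_⟩
  · intro A hA
    simp only [Multiset.mem_cons] at hA
    rcases hA with rfl | rfl | hA
    · exact s1
    · exact s2
    · exact AL_other hx.1 hy.1 hxy (h.cA _ (by simp [hA])) ((dA _ mx).2.2 _ hA) ((dA _ my).2.2 _ hA)
  · exact BL_other hx.1 hy.1 hxy h.b1 (dA _ mx).1 (dA _ my).1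
  · exact BL_other hx.1 hy.1 hxy h.b2 (dA _ mx).2.1 (dA _ my).2.1
  · rw [← h.cov]
    simp only [nab_append, nab_cons, Multiset.cons_bind]
    simp only [← Multiset.singleton_add]
    abel

lemma headD_natAbs {w v : List ℤ} {x : ℤ} : (w.headD (-x)).natAbs ∈ nab (x :: (v ++ w)) := by
  cases w with
  | nil => simp [nab_cons]
  | cons a w => exact mem_nab_of (by simp)

lemma moveB1 {σ L2 As v w x} (h : Stt n R σ (x :: (v ++ w)) L2 As) :
    Stt n R (rf x (w.headD (-x)) * σ) w L2 ((x :: v) ::ₘ As) := by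
  have hnd := h.nodup
  rw [add_assoc] at hnd
  have mx : x.natAbs ∈ nab (x :: (v ++ w)) := mem_nab_of (by simp)
  have my := headD_natAbs (w := w) (v := v) (x := x)
  have hs : ∀ k : ℤ, k.natAbs ∈ nab (x :: (v ++ w)) → k ∈ signedSet n :=
    fun k hk => h.mem_sgn (by rw [add_assoc, Multiset.mem_add]; exact Or.inl hk)
  have hx := hs _ mx
  have hy := hs _ my
  obtain ⟨s1, s2⟩ := bl_split hx.1 (fun a ha => (hs a (mem_nab_of (by simp [ha]))).1) h.b1 (nd_left hnd)
  have hxy : x ≠ w.headD (-x) := by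
    cases w with
    | nil => have := hx.1; simp; omega
    | cons a w =>
      rintro e
      simp at e
      have := nd_left hnd
      rw [nab_cons, nab_append, nab_cons, e] at this
      simp at this
  have dA : ∀ k ∈ nab (x :: (v ++ w)), k ∉ nab L2 ∧ ∀ A ∈ As, k ∉ nab A := by
    intro k hk
    have h1 := nd_dis hnd hk
    simp only [Multiset.mem_add, not_or] at h1
    refine ⟨h1.1, fun A hA hkA => h1.2 (Multiset.mem_bind.2 ⟨A, hA, hkA⟩)⟩
  refine ⟨rf_mul_inB hx hy hxy h.hB, ?_, s2, ?_, ?_, ?_⟩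
  · intro A hA
    simp only [Multiset.mem_cons] at hA
    rcases hA with rfl | hA
    · exact s1
    · exact AL_other hx.1 hy.1 hxy (h.cA _ hA) ((dA _ mx).2 _ hA) ((dA _ my).2 _ hA)
  · exact BL_other hx.1 hy.1 hxy h.b2 (dA _ mx).1 (dA _ my).1
  · intro a b ha hb
    exact h.cr a b (by rw [nab_cons, nab_append]; simp [ha]) hb
  · rw [← h.cov]
    simp only [nab_append, nab_cons, Multiset.cons_bind]
    simp only [← Multiset.singleton_add]
    abel

lemma moveB2 {σ L1 As v w x} (h : Stt n R σ L1 (x :: (v ++ w)) As) :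
    Stt n R (rf x (w.headD (-x)) * σ) L1 w ((x :: v) ::ₘ As) := by
  have hnd := h.nodup
  rw [add_comm (nab L1), add_assoc] at hnd
  have mx : x.natAbs ∈ nab (x :: (v ++ w)) := mem_nab_of (by simp)
  have my := headD_natAbs (w := w) (v := v) (x := x)
  have hs : ∀ k : ℤ, k.natAbs ∈ nab (x :: (v ++ w)) → k ∈ signedSet n :=
    fun k hk => h.mem_sgn (by simp only [Multiset.mem_add]; exact Or.inl (Or.inr hk))
  have hx := hs _ mx
  have hy := hs _ my
  obtain ⟨s1, s2⟩ := bl_split hx.1 (fun a ha => (hs a (mem_nab_of (by simp [ha]))).1) h.b2 (nd_left hnd)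
  have hxy : x ≠ w.headD (-x) := by
    cases w with
    | nil => have := hx.1; simp; omega
    | cons a w =>
      rintro e
      simp at e
      have := nd_left hnd
      rw [nab_cons, nab_append, nab_cons, e] at this
      simp at this
  have dA : ∀ k ∈ nab (x :: (v ++ w)), k ∉ nab L1 ∧ ∀ A ∈ As, k ∉ nab A := by
    intro k hk
    have h1 := nd_dis hnd hk
    simp only [Multiset.mem_add, not_or] at h1
    refine ⟨h1.1, fun A hA hkA => h1.2 (Multiset.mem_bind.2 ⟨A, hA, hkA⟩)⟩
  refine ⟨rf_mul_inB hx hy hxy h.hB, ?_, ?_, s2, ?_, ?_⟩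
  · intro A hA
    simp only [Multiset.mem_cons] at hA
    rcases hA with rfl | hA
    · exact s1
    · exact AL_other hx.1 hy.1 hxy (h.cA _ hA) ((dA _ mx).2 _ hA) ((dA _ my).2 _ hA)
  · exact BL_other hx.1 hy.1 hxy h.b1 (dA _ mx).1 (dA _ my).1
  · intro a b ha hb
    exact h.cr a b ha (by rw [nab_cons, nab_append]; simp [hb])
  · rw [← h.cov]
    simp only [nab_append, nab_cons, Multiset.cons_bind]
    simp only [← Multiset.singleton_add]
    abel

lemma moveC (hR : RP R) {σ As z t x y} (h : Stt n R σ (y :: z) (x :: t) As) :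
    Stt n R (rf x y * σ) [] [] ((x :: t ++ (y :: z).map (fun a => -a)) ::ₘ As) := by
  have hnd := h.nodup
  have hx : x ∈ signedSet n := h.mem_sgn (by simp [nab_cons])
  have hy : y ∈ signedSet n := h.mem_sgn (by simp [nab_cons])
  have hxy : x ≠ y := by
    rintro rfl
    exact nd_dis (nd_left hnd) (k := x.natAbs) (by simp [nab_cons]) (by simp [nab_cons])
  have dA : ∀ k ∈ nab (y :: z) + nab (x :: t), ∀ A ∈ As, k ∉ nab A := by
    intro k hk A hA hkA
    exact nd_dis hnd hk (Multiset.mem_bind.2 ⟨A, hA, hkA⟩)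
  refine ⟨rf_mul_inB hx hy hxy h.hB, ?_, ⟨trivial, List.Pairwise.nil⟩, ⟨trivial, List.Pairwise.nil⟩, ?_, ?_⟩
  · intro A hA
    simp only [Multiset.mem_cons] at hA
    rcases hA with rfl | hA
    · exact al_join hR h.hB hx.1 hy.1 h.b1 h.b2 (nd_left hnd) h.cr
    · exact AL_other hx.1 hy.1 hxy (h.cA _ hA) (dA _ (by simp [nab_cons]) _ hA) (dA _ (by simp [nab_cons]) _ hA)
  · intro a b ha; simp at ha
  · rw [← h.cov, Multiset.cons_bind, nab_append, nab_neg, nab_nil]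
    abel
end

set_option linter.unusedSectionVars false
set_option linter.unusedSimpArgs false
set_option linter.unusedVariables false

section
variable {n : ℕ} {R : ℤ → ℤ → Prop}

lemma appr_neg {σ : Equiv.Perm ℤ} {x y : ℤ} (h : appr σ x y) : appr σ (-x) (-y) := by
  intro v h1 h2
  rw [h1, h1, h v h1 h2]

lemma headD_mem {A : List ℤ} (h : A ≠ []) (z : ℤ) : A.headD z ∈ A := by
  cases A with
  | nil => exact absurd rfl h
  | cons a l => simp

lemma al_closed {σ : Equiv.Perm ℤ} {A : List ℤ} (hA : AL R σ A) (a : ℤ) : σ a ∈ A ↔ a ∈ A := by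
  have hs := Pth_surj hA.pth
  constructor
  · intro h
    have : ∃ b ∈ A, σ b = σ a := by
      have hh : σ a = A.headD 0 ∨ σ a ∈ A.tail := by
        revert h
        cases A with
        | nil => simp
        | cons c l => simp
      rcases hh with hh | hh
      · obtain ⟨b, hb, e⟩ := hs.2 hA.ne
        exact ⟨b, hb, by rw [e, hh]⟩
      · exact hs.1 _ hh
    obtain ⟨b, hb, e⟩ := this
    rwa [← σ.injective e]
  · intro h
    rcases Pth_maps hA.pth a h with h | h
    · exact h
    · rw [h]; exact headD_mem hA.ne _

open Classical in
lemma appr_A {σ : Equiv.Perm ℤ} {A : List ℤ} (hB : inB n σ) (hA : AL R σ A)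
    (hd : ∀ a ∈ A, -a ∉ A) {x y : ℤ} (hx : x ∈ A) (h : appr σ x y) : y ∈ A := by
  have := h (fun a => (if a ∈ A then (1:ℝ) else 0) - (if -a ∈ A then 1 else 0)) (by intro a; simp)
    (by
      intro a
      have h1 := al_closed hA a
      have h2 := al_closed hA (-a)
      rw [hB.1] at h2
      simp [h1, h2])
  have h3 := hd x hx
  simp only [hx, h3, if_true, if_false] at this
  by_contra hy
  simp only [hy, if_false] at this
  split_ifs at this <;> norm_num at this

lemma nab_dis {A : List ℤ} (hn : (nab A).Nodup) (h0 : ∀ a ∈ A, a ≠ 0) : ∀ a ∈ A, -a ∉ A := by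
  intro a ha ha'
  have hn' : (A.map Int.natAbs).Nodup := hn
  have := List.inj_on_of_nodup_map hn' ha ha' (by simp)
  have := h0 a ha
  omega

lemma Stt.dis {σ L1 L2 As} (h : Stt n R σ L1 L2 As) {A : List ℤ} (hA : A ∈ As) : ∀ a ∈ A, -a ∉ A := by
  obtain ⟨As', rfl⟩ := Multiset.exists_cons_of_mem hA
  have hnd := h.nodup
  rw [Multiset.cons_bind] at hnd
  refine nab_dis (nd_left (nd_right hnd)) (fun a ha => ?_)
  have : a ∈ signedSet n := h.mem_sgn (by
    have := mem_nab_of ha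
    rw [Multiset.cons_bind]; simp [this])
  exact this.1

lemma Stt.not_A {σ L1 L2 As} (h : Stt n R σ L1 L2 As) {x y : ℤ} (hx : appr σ x (-x))
    (hxy : appr σ x y) : y.natAbs ∉ As.bind nab := by
  intro hy
  obtain ⟨A, hA, hyA⟩ := Multiset.mem_bind.1 hy
  obtain ⟨a, ha, e⟩ := mem_nab.1 hyA
  have h1 : appr σ y (-y) := appr_trans (appr_symm hxy) (appr_trans hx (appr_neg hxy))
  have h2 : appr σ a (-a) := by
    rcases Int.natAbs_eq_natAbs_iff.1 e with rfl | rfl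
    · exact h1
    · simpa using appr_neg h1
  exact h.dis hA a ha (appr_A h.hB (h.cA _ hA) (h.dis hA) ha h2)

lemma BL_zero {σ : Equiv.Perm ℤ} {L : List ℤ} (h : BL R σ L) (v : ℤ → ℝ) (h1 : ∀ a, v (-a) = -v a)
    (h2 : ∀ a, v (σ a) = v a) {a : ℤ} (ha : a.natAbs ∈ nab L) : v a = 0 := by
  have hc := Pth_const h.pth v h2
  obtain ⟨b, hb, e⟩ := mem_nab.1 ha
  have hne : L ≠ [] := by rintro rfl; simp at hb
  have h3 := hc _ (headD_mem hne 0)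
  rw [h1] at h3
  have h4 := hc _ hb
  rw [h1] at h4
  rcases Int.natAbs_eq_natAbs_iff.1 e with rfl | rfl
  · linarith
  · rw [h1] at h4; linarith

lemma validA (hR : RP R) {σ L1 L2 As u t x} (h : Stt n R σ L1 L2 ((u ++ x :: t) ::ₘ As)) {y : ℤ}
    (hy : y ∈ signedSet n) : (y ≠ x ∧ R x y ∧ appr σ x y) ↔ y ∈ t := by
  have hnd := h.nodup
  rw [Multiset.cons_bind] at hnd
  have hA : ((u ++ x :: t).map Int.natAbs).Nodup := nd_left (nd_right hnd)
  have hAL := h.cA (u ++ x :: t) (by simp)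
  have hpw := hAL.pw
  rw [List.pairwise_append, List.pairwise_cons] at hpw
  simp only [List.map_append, List.map_cons, List.nodup_append, List.nodup_cons, List.mem_map,
    List.mem_cons, List.mem_append, not_or, not_exists, not_and] at hA
  constructor
  · rintro ⟨h1, h2, h3⟩
    have := appr_A h.hB hAL (h.dis (by simp)) (x := x) (by simp) h3
    simp only [List.mem_append, List.mem_cons] at this
    rcases this with h4 | h4 | h4
    · exact absurd h2 (hR.asym _ _ (hA.2.2 _ ⟨y, h4, rfl⟩ _ (Or.inl rfl)) (hpw.2.2 y h4 x (by simp)))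
    · exact absurd h4 h1
    · exact h4
  · intro ht
    refine ⟨?_, hpw.2.1.1 y ht, ?_⟩
    · rintro rfl; exact hA.2.1.1 _ ht rfl
    · intro v h1 h2
      have := Pth_const hAL.pth v h2
      rw [this x (by simp), this y (by simp [ht])]

lemma validB1 (hR : RP R) {σ L2 As t x} (h : Stt n R σ (x :: t) L2 As) {y : ℤ}
    (hy : y ∈ signedSet n) : (y ≠ x ∧ R x y ∧ appr σ x y) ↔ y ∈ t ++ [-x] := by
  have hnd := h.nodup
  have hA : ((x :: t).map Int.natAbs).Nodup := nd_left (nd_left hnd)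
  have hpw := h.b1.pw
  rw [List.pairwise_cons] at hpw
  simp only [List.map_append, List.map_cons, List.nodup_append, List.nodup_cons, List.mem_map,
    List.mem_cons, List.mem_append, not_or, not_exists, not_and] at hA
  have xm : x.natAbs ∈ nab (x :: t) := mem_nab_of (by simp)
  have hx : x ∈ signedSet n := h.mem_sgn (by simp [xm])
  have hx0 := hx.1
  have hz : ∀ a b : ℤ, a.natAbs ∈ nab (x :: t) → b.natAbs ∈ nab (x :: t) → appr σ a b :=
    fun a b ha hb v h1 h2 => by rw [BL_zero h.b1 v h1 h2 ha, BL_zero h.b1 v h1 h2 hb]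
  rw [List.mem_append, List.mem_singleton]
  constructor
  · rintro ⟨h1, h2, h3⟩
    have hm : y.natAbs ∈ nab (x :: t) + nab L2 + As.bind nab := by
      rw [h.cov]; exact natAbs_signed.2 hy
    simp only [Multiset.mem_add] at hm
    rcases hm with (hm | hm) | hm
    · obtain ⟨a, ha, e⟩ := mem_nab.1 hm
      rcases List.mem_cons.1 ha with rfl | ha
      · rcases Int.natAbs_eq_natAbs_iff.1 e with rfl | rfl
        · exact absurd rfl h1
        · right; simp
      · rcases Int.natAbs_eq_natAbs_iff.1 e with rfl | rfl
        · exact Or.inl ha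
        · have h4 := hR.neg _ _ (hpw.1 _ ha).2
          rw [neg_neg, neg_neg] at h4
          exact absurd h2 (hR.asym _ _ (by have := hA.1 _ ha; simpa using this) h4)
    · refine absurd h2 (hR.asym _ _ ?_ (h.cr x y xm hm))
      intro e; rw [e] at hm
      exact nd_dis (nd_left hnd) xm hm
    · exact absurd hm (h.not_A (hz _ _ xm (by simpa using xm)) h3)
  · rintro (ht | rfl)
    · exact ⟨by rintro rfl; exact hA.1 _ ht rfl, (hpw.1 y ht).1, hz _ _ xm (mem_nab_of (by simp [ht]))⟩
    · exact ⟨by omega, hR.self x, hz _ _ xm (by simpa using xm)⟩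

lemma validB2 (hR : RP R) {σ L1 As t x} (h : Stt n R σ L1 (x :: t) As) {y : ℤ}
    (hy : y ∈ signedSet n) : (y ≠ x ∧ R x y ∧ appr σ x y) ↔
      y ∈ (t ++ [-x]) ++ (L1 ++ L1.map (fun a => -a)) := by
  have hnd := h.nodup
  have hA : ((x :: t).map Int.natAbs).Nodup := nd_right (nd_left hnd)
  have hpw := h.b2.pw
  rw [List.pairwise_cons] at hpw
  simp only [List.map_append, List.map_cons, List.nodup_append, List.nodup_cons, List.mem_map,
    List.mem_cons, List.mem_append, not_or, not_exists, not_and] at hA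
  have xm : x.natAbs ∈ nab (x :: t) := mem_nab_of (by simp)
  have hx : x ∈ signedSet n := h.mem_sgn (by simp [xm])
  have hx0 := hx.1
  have hv : ∀ v : ℤ → ℝ, (∀ a, v (-a) = -v a) → (∀ a, v (σ a) = v a) → ∀ a : ℤ,
      a.natAbs ∈ nab L1 + nab (x :: t) → v a = 0 := by
    intro v h1 h2 a ha
    rcases Multiset.mem_add.1 ha with ha | ha
    · exact BL_zero h.b1 v h1 h2 ha
    · exact BL_zero h.b2 v h1 h2 ha
  have xm' : x.natAbs ∈ nab L1 + nab (x :: t) := by simp [xm]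
  have hz : ∀ a b : ℤ, a.natAbs ∈ nab L1 + nab (x :: t) → b.natAbs ∈ nab L1 + nab (x :: t) → appr σ a b :=
    fun a b ha hb v h1 h2 => by rw [hv v h1 h2 a ha, hv v h1 h2 b hb]
  have hL : y ∈ L1 ++ L1.map (fun a => -a) ↔ y.natAbs ∈ nab L1 := by
    rw [List.mem_append, List.mem_map, mem_nab]
    constructor
    · rintro (h | ⟨a, h, rfl⟩)
      · exact ⟨_, h, rfl⟩
      · exact ⟨_, h, by simp⟩
    · rintro ⟨a, h, e⟩
      rcases Int.natAbs_eq_natAbs_iff.1 e with rfl | rfl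
      · exact Or.inl h
      · exact Or.inr ⟨_, h, by simp⟩
  rw [List.mem_append, hL, List.mem_append, List.mem_singleton]
  constructor
  · rintro ⟨h1, h2, h3⟩
    have hm : y.natAbs ∈ nab L1 + nab (x :: t) + As.bind nab := by
      rw [h.cov]; exact natAbs_signed.2 hy
    simp only [Multiset.mem_add] at hm
    rcases hm with (hm | hm) | hm
    · exact Or.inr hm
    · left
      obtain ⟨a, ha, e⟩ := mem_nab.1 hm
      rcases List.mem_cons.1 ha with rfl | ha
      · rcases Int.natAbs_eq_natAbs_iff.1 e with rfl | rfl
        · exact absurd rfl h1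
        · right; simp
      · rcases Int.natAbs_eq_natAbs_iff.1 e with rfl | rfl
        · exact Or.inl ha
        · have h4 := hR.neg _ _ (hpw.1 _ ha).2
          rw [neg_neg, neg_neg] at h4
          exact absurd h2 (hR.asym _ _ (by have := hA.1 _ ha; simpa using this) h4)
    · exact absurd hm (h.not_A (hz _ _ xm' (by simpa using xm')) h3)
  · rintro ((ht | rfl) | hm)
    · exact ⟨by rintro rfl; exact hA.1 _ ht rfl, (hpw.1 y ht).1,
        hz _ _ xm' (by have := mem_nab_of (show y ∈ x :: t by simp [ht]); simp [this])⟩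
    · exact ⟨by omega, hR.self x, hz _ _ xm' (by simpa using xm')⟩
    · refine ⟨?_, h.cr y x hm xm, hz _ _ xm' (by simp [hm])⟩
      rintro rfl
      exact nd_dis (nd_left hnd) hm xm

/-- generic evaluation of the operator -/
lemma Dx_list {σ : Equiv.Perm ℤ} (hσ : inB n σ) {x : ℤ} (hx : x ∈ signedSet n) (F : Equiv.Perm ℤ → ℤ)
    (l : List ℤ) (hl : l.Nodup) (hs : ∀ y ∈ l, y ∈ signedSet n)
    (hv : ∀ y, y ∈ signedSet n → ((y ≠ x ∧ R x y ∧ appr σ x y) ↔ y ∈ l)) :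
    Dx n R x F σ = (l.map (fun y => F (rf x y * σ))).sum := by
  classical
  unfold Dx
  rw [← List.sum_toFinset _ hl, ← Finset.sum_filter]
  apply Finset.sum_congr
  · ext y
    rw [Finset.mem_filter, mem_Yset, List.mem_toFinset]
    constructor
    · rintro ⟨⟨h1, h2, h3⟩, h4⟩
      exact (hv y h1).1 ⟨h2, h3, (lenB_rf_iff hx h1 h2.symm hσ).1 h4⟩
    · intro h
      have h1 := hs y h
      obtain ⟨h2, h3, h4⟩ := (hv y h1).2 h
      exact ⟨⟨h1, h2, h3⟩, (lenB_rf_iff hx h1 h2.symm hσ).2 h4⟩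
  · intros; rfl
end

set_option linter.unusedSectionVars false
set_option linter.unusedSimpArgs false
set_option linter.unusedVariables false

lemma isum1 (t : List ℤ) (G : ℤ → ℤ) (K : List ℤ → List ℤ → ℤ)
    (h : ∀ v y w, t = v ++ y :: w → G y = K v (y :: w)) :
    (t.map G).sum = ∑ i ∈ Finset.range t.length, K (t.take i) (t.drop i) := by
  induction t generalizing K with
  | nil => simp
  | cons a t ih =>
    rw [List.length_cons, Finset.sum_range_succ', List.map_cons, List.sum_cons,
      ih (fun v w => K (a :: v) w) (fun v y w e => h (a :: v) y w (by rw [e]; rfl)),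
      h [] a t rfl, add_comm]
    rfl

lemma isum2 (t : List ℤ) (z : ℤ) (G : ℤ → ℤ) (K : List ℤ → List ℤ → ℤ)
    (h : ∀ v w, t = v ++ w → G (w.headD z) = K v w) :
    ((t ++ [z]).map G).sum = ∑ i ∈ Finset.range (t.length + 1), K (t.take i) (t.drop i) := by
  rw [Finset.sum_range_succ, List.map_append, List.sum_append,
    isum1 t G K (fun v y w e => by simpa using h v (y :: w) e)]
  have := h t [] (by simp)
  simp at this
  simp [this]

def ann (a b : ℤ) : ℤ := if a + b ≠ 0 then 0 else if b = 0 then 1 else if 0 < b then 2 * b else 0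

lemma numA (u t : List ℤ) (X : ℤ) (hX : -1 ≤ X) (ht : ∀ a ∈ t, -1 ≤ a) :
    ∑ i ∈ Finset.range t.length, fhI 0 (X :: t.take i) * fhI 0 (u ++ t.drop i) =
      fhI 0 (u ++ (X + 1) :: t) := by
  rw [fhI_append]
  simp only [fhI, le_refl, if_true, zero_add]
  split_ifs with hS
  · rw [show u.sum + (X + 1) = u.sum + 1 + X by ring, key2 t X u.sum ht hX hS, Finset.mul_sum]
    refine Finset.sum_congr rfl (fun i hi => ?_)
    rw [fhI_append, zero_add]; ring
  · rw [mul_zero]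
    refine Finset.sum_eq_zero (fun i hi => ?_)
    rw [fhI_append, zero_add]
    have : t.drop i ≠ [] := by
      rw [Finset.mem_range] at hi
      simp; omega
    obtain ⟨a, l, e⟩ := List.exists_cons_of_ne_nil this
    rw [e]; simp [fhI, hS]

lemma numB1 (t : List ℤ) (X w2 : ℤ) (hX : -1 ≤ X) (ht : ∀ a ∈ t, -1 ≤ a) :
    ∑ i ∈ Finset.range (t.length + 1), fhI 0 (X :: t.take i) * ann (t.drop i).sum w2 =
      ann (X + 1 + t.sum) w2 := by
  simp only [fhI, le_refl, if_true, zero_add]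
  rw [key1 (fun s => ann s w2) t X hX ht]
  rcases hit_cases t X hX ht with ⟨h, -⟩ | ⟨h, h1, -⟩
  · rw [h, one_mul]
  · rw [h, zero_mul]
    unfold ann
    split_ifs <;> first | rfl | omega

lemma numB2 (t W : List ℤ) (X : ℤ) (hX : -1 ≤ X) (ht : ∀ a ∈ t, -1 ≤ a) (hW : ∀ a ∈ W, -1 ≤ a) :
    ∑ i ∈ Finset.range (t.length + 1), fhI 0 (X :: t.take i) * ann W.sum (t.drop i).sum +
      2 * ∑ i ∈ Finset.range W.length, fhI 0 (X :: t ++ (W.drop i ++ W.take i)) =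
      ann W.sum (X + 1 + t.sum) := by
  simp only [fhI, le_refl, if_true, zero_add, List.cons_append]
  rw [key1 (fun s => ann W.sum s) t X hX ht]
  rcases hit_cases t X hX ht with ⟨h, h1⟩ | ⟨h, h1, h2⟩
  · rw [h, one_mul, Finset.sum_eq_zero, mul_zero, add_zero]
    intro i hi
    apply h1
    rw [Finset.mem_range] at hi
    simp; omega
  · rw [h, zero_mul, zero_add]
    simp only [h2]
    have := cycle_lemma' (X + t.sum + 1) (by omega) W hW
    simp only [add_sub_cancel_right] at this
    rw [this]
    unfold ann
    split_ifs <;> first | omega | rfl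

section
variable {n : ℕ} {R : ℤ → ℤ → Prop}

def ws (g : ℕ → ℤ) (L : List ℤ) : ℤ := (L.map (fun a => g a.natAbs)).sum
def fA (g : ℕ → ℤ) (L : List ℤ) : ℤ := fhI 0 (L.map (fun a => g a.natAbs))
noncomputable def valS (g : ℕ → ℤ) (L1 L2 : List ℤ) (As : Multiset (List ℤ)) : ℤ :=
  ann (ws g L1) (ws g L2) * (As.map (fA g)).prod

lemma ws_nab (g : ℕ → ℤ) (L : List ℤ) : ws g L = ((nab L).map g).sum := by
  simp [ws, nab, Function.comp_def]

lemma prod_nab (g : ℕ → ℤ) (As : Multiset (List ℤ)) : (As.map (fA g)).prod =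
    ((As.map (fun A => A.map Int.natAbs)).map (fun l => fhI 0 (l.map g))).prod := by
  rw [Multiset.map_map]
  congr 1
  refine Multiset.map_congr rfl (fun A _ => ?_)
  simp [fA, Function.comp_def]

lemma valS_sim (g : ℕ → ℤ) {L1 L2 As L1' L2' As'} (h : Sim L1 L2 As L1' L2' As') :
    valS g L1 L2 As = valS g L1' L2' As' := by
  unfold valS
  rw [ws_nab, ws_nab, prod_nab, h.1, h.2.1, h.2.2, ← ws_nab, ← ws_nab, ← prod_nab]

lemma map_congr_nab {g g' : ℕ → ℤ} {L : List ℤ} (h : ∀ k ∈ nab L, g k = g' k) :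
    L.map (fun a => g a.natAbs) = L.map (fun a => g' a.natAbs) :=
  List.map_congr_left (fun a ha => h _ (mem_nab_of ha))

lemma ws_congr {g g' : ℕ → ℤ} {L : List ℤ} (h : ∀ k ∈ nab L, g k = g' k) : ws g L = ws g' L := by
  unfold ws; rw [map_congr_nab h]
lemma fA_congr {g g' : ℕ → ℤ} {L : List ℤ} (h : ∀ k ∈ nab L, g k = g' k) : fA g L = fA g' L := by
  unfold fA; rw [map_congr_nab h]
lemma prod_congr {g g' : ℕ → ℤ} {As : Multiset (List ℤ)} (h : ∀ k ∈ As.bind nab, g k = g' k) :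
    (As.map (fA g)).prod = (As.map (fA g')).prod := by
  congr 1
  exact Multiset.map_congr rfl (fun A hA => fA_congr (fun k hk => h k (Multiset.mem_bind.2 ⟨A, hA, hk⟩)))

lemma gneg (g : ℕ → ℤ) (L : List ℤ) :
    (L.map (fun a => -a)).map (fun a => g a.natAbs) = L.map (fun a => g a.natAbs) := by
  simp [Function.comp_def]

lemma nodup_of_nab {L : List ℤ} (h : (nab L).Nodup) : L.Nodup := by
  have h' : (L.map Int.natAbs).Nodup := h
  exact List.Nodup.of_map _ h'

lemma nodup_B {x : ℤ} (hx : x ≠ 0) {t : List ℤ} (h : (nab (x :: t)).Nodup) : (t ++ [-x]).Nodup := by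
  apply nodup_of_nab
  rw [nab_append, add_comm]
  simpa [nab_cons] using h

lemma nodup_pm {L : List ℤ} (h : (nab L).Nodup) (h0 : ∀ a ∈ L, a ≠ 0) :
    (L ++ L.map (fun a => -a)).Nodup := by
  rw [List.nodup_append]
  refine ⟨nodup_of_nab h, nodup_of_nab (by rwa [nab_neg]), ?_⟩
  rintro a ha b hb rfl
  obtain ⟨c, hc, rfl⟩ := List.mem_map.1 hb
  exact nab_dis h h0 c hc ha

lemma DxA (hR : RP R) {σ L1 L2 As u t x} (h : Stt n R σ L1 L2 ((u ++ x :: t) ::ₘ As))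
    (F : Equiv.Perm ℤ → ℤ) (K : List ℤ → List ℤ → ℤ)
    (hK : ∀ v y w, t = v ++ y :: w → F (rf x y * σ) = K v (y :: w)) :
    Dx n R x F σ = ∑ i ∈ Finset.range t.length, K (t.take i) (t.drop i) := by
  have hnd := h.nodup
  rw [Multiset.cons_bind] at hnd
  have hn := nd_left (nd_right hnd)
  have hs : ∀ y ∈ u ++ x :: t, y ∈ signedSet n := fun y hy => h.mem_sgn (by
    have := mem_nab_of hy
    rw [Multiset.cons_bind]; simp [this])
  rw [Dx_list h.hB (hs x (by simp)) F t ?_ (fun y hy => hs y (by simp [hy])) (fun y hy => validA hR h hy)]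
  · exact isum1 t _ K hK
  · have := nodup_of_nab hn
    rw [List.nodup_append, List.nodup_cons] at this
    exact this.2.1.2

lemma DxB1 (hR : RP R) {σ L2 As t x} (h : Stt n R σ (x :: t) L2 As)
    (F : Equiv.Perm ℤ → ℤ) (K : List ℤ → List ℤ → ℤ)
    (hK : ∀ v w, t = v ++ w → F (rf x (w.headD (-x)) * σ) = K v w) :
    Dx n R x F σ = ∑ i ∈ Finset.range (t.length + 1), K (t.take i) (t.drop i) := by
  have hnd := h.nodup
  have hn := nd_left (nd_left hnd)
  have hs : ∀ y ∈ x :: t, y ∈ signedSet n := fun y hy => h.mem_sgn (by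
    have := mem_nab_of hy
    simp [this])
  have hx := hs x (by simp)
  rw [Dx_list h.hB hx F (t ++ [-x]) (nodup_B hx.1 hn) ?_ (fun y hy => validB1 hR h hy)]
  · exact isum2 t _ (fun y => F (rf x y * σ)) K hK
  · intro y hy
    simp only [List.mem_append, List.mem_singleton] at hy
    rcases hy with hy | rfl
    · exact hs _ (by simp [hy])
    · exact (neg_mem_signed).2 hx

lemma DxB2 (hR : RP R) {σ L1 As t x} (h : Stt n R σ L1 (x :: t) As)
    (F : Equiv.Perm ℤ → ℤ) (K J J' : List ℤ → List ℤ → ℤ)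
    (hK : ∀ v w, t = v ++ w → F (rf x (w.headD (-x)) * σ) = K v w)
    (hJ : ∀ u y z, L1 = u ++ y :: z → F (rf x y * σ) = J u (y :: z))
    (hJ' : ∀ u y z, L1.map (fun a => -a) = u ++ y :: z → F (rf x y * σ) = J' u (y :: z)) :
    Dx n R x F σ = ∑ i ∈ Finset.range (t.length + 1), K (t.take i) (t.drop i) +
      (∑ i ∈ Finset.range L1.length, J (L1.take i) (L1.drop i) +
       ∑ i ∈ Finset.range L1.length, J' ((L1.map (fun a => -a)).take i) ((L1.map (fun a => -a)).drop i)) := by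
  have hnd := h.nodup
  have hn := nd_right (nd_left hnd)
  have hs : ∀ y ∈ x :: t, y ∈ signedSet n := fun y hy => h.mem_sgn (by
    have := mem_nab_of hy
    simp [this])
  have hs1 : ∀ y ∈ L1, y ∈ signedSet n := fun y hy => h.mem_sgn (by
    have := mem_nab_of hy
    simp [this])
  have hx := hs x (by simp)
  rw [Dx_list h.hB hx F ((t ++ [-x]) ++ (L1 ++ L1.map (fun a => -a))) ?_ ?_ (fun y hy => validB2 hR h hy)]
  · rw [List.map_append, List.sum_append, isum2 t _ (fun y => F (rf x y * σ)) K hK,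
      List.map_append, List.sum_append, isum1 L1 _ J hJ, isum1 _ _ J' hJ', List.length_map]
  · rw [List.nodup_append]
    refine ⟨nodup_B hx.1 hn, nodup_pm (nd_left (nd_left hnd)) (fun a ha => (hs1 a ha).1), ?_⟩
    rintro a ha b hb rfl
    have h1 : a.natAbs ∈ nab (x :: t) := by
      simp only [List.mem_append, List.mem_singleton] at ha
      rcases ha with ha | rfl
      · exact mem_nab_of (by simp [ha])
      · simp [nab_cons]
    have h2 : a.natAbs ∈ nab L1 := by
      rcases List.mem_append.1 hb with hb | hb
      · exact mem_nab_of hb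
      · rw [← nab_neg]; exact mem_nab_of hb
    exact nd_dis (nd_left hnd) h2 h1
  · intro y hy
    simp only [List.mem_append, List.mem_singleton, List.mem_map] at hy
    rcases hy with (hy | rfl) | (hy | ⟨a, ha, rfl⟩)
    · exact hs _ (by simp [hy])
    · exact (neg_mem_signed).2 hx
    · exact hs1 _ hy
    · exact (neg_mem_signed).2 (hs1 _ ha)

/-- cross move at a splitting of the first list -/
lemma moveC' (hR : RP R) {σ L1 As u z t x y} (h : Stt n R σ L1 (x :: t) As)
    (hL : BL R σ (u ++ y :: z)) (hn : nab L1 = nab (u ++ y :: z)) :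
    Stt n R (rf x y * σ) [] [] ((x :: t ++ (y :: z ++ u.map (fun a => -a)).map (fun a => -a)) ::ₘ As) := by
  have e : nab L1 = nab (y :: z ++ u.map (fun a => -a)) := by
    rw [hn, nab_append, nab_append, nab_neg, add_comm]
  refine moveC hR ⟨h.hB, h.cA, ?_, h.b2, ?_, ?_⟩
  · exact BL_rot hR h.hB hL
  · have := h.cr; rw [e] at this; exact this
  · have := h.cov; rw [e] at this; exact this

lemma St_move (hR : RP R) {σ L1 L2 As} (h : Stt n R σ L1 L2 As) {x y : ℤ} (hx : x ∈ signedSet n)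
    (hy : y ∈ signedSet n) (hxy : x ≠ y) (hr : R x y) (hl : lenB n (rf x y * σ) + 1 = lenB n σ) :
    ∃ L1' L2' As', Stt n R (rf x y * σ) L1' L2' As' := by
  rw [lenB_rf_iff hx hy hxy h.hB] at hl
  obtain ⟨M1, M2, Bs, hN, -⟩ := exists_NF hR h hx
  cases hN with
  | A L1 L2 As u t h =>
    have := (validA hR h hy).1 ⟨hxy.symm, hr, hl⟩
    obtain ⟨v, w, rfl⟩ := List.append_of_mem this
    exact ⟨_, _, _, moveA h⟩
  | B1 L2 As t h =>
    have := (validB1 hR h hy).1 ⟨hxy.symm, hr, hl⟩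
    rcases List.mem_append.1 this with h1 | h1
    · obtain ⟨v, w, rfl⟩ := List.append_of_mem h1
      exact ⟨_, _, _, moveB1 (w := y :: w) h⟩
    · rw [List.mem_singleton] at h1; subst h1
      exact ⟨_, _, _, moveB1 (v := t) (w := []) (by simpa using h)⟩
  | B2 L1 As t h =>
    have := (validB2 hR h hy).1 ⟨hxy.symm, hr, hl⟩
    rcases List.mem_append.1 this with h1 | h1
    · rcases List.mem_append.1 h1 with h1 | h1
      · obtain ⟨v, w, rfl⟩ := List.append_of_mem h1
        exact ⟨_, _, _, moveB2 (w := y :: w) h⟩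
      · rw [List.mem_singleton] at h1; subst h1
        exact ⟨_, _, _, moveB2 (v := t) (w := []) (by simpa using h)⟩
    · rcases List.mem_append.1 h1 with h1 | h1
      · obtain ⟨u, z, e⟩ := List.append_of_mem h1
        exact ⟨_, _, _, moveC' hR h (e ▸ h.b1) (by rw [e])⟩
      · obtain ⟨u, z, e⟩ := List.append_of_mem h1
        exact ⟨_, _, _, moveC' hR h (e ▸ BL_neg hR h.hB h.b1) (by rw [← e, nab_neg])⟩

lemma step_val (hR : RP R) (g g' : ℕ → ℤ) (hg : ∀ k, -1 ≤ g k) (F : Equiv.Perm ℤ → ℤ)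
    (hF : ∀ σ L1 L2 As, Stt n R σ L1 L2 As → F σ = valS g L1 L2 As) {x : ℤ} (hx : x ∈ signedSet n)
    (hgx : g' x.natAbs = g x.natAbs + 1) (hgo : ∀ k, k ≠ x.natAbs → g' k = g k)
    {σ L1 L2 As} (h : Stt n R σ L1 L2 As) : Dx n R x F σ = valS g' L1 L2 As := by
  obtain ⟨M1, M2, Bs, hN, hs⟩ := exists_NF hR h hx
  rw [valS_sim g' hs]
  clear hs h
  have key : ∀ S T : Multiset ℕ, (S + T).Nodup → x.natAbs ∈ S → ∀ k ∈ T, g' k = g k := by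
    intro S T hST hS k hk
    apply hgo
    rintro rfl
    exact nd_dis hST hS hk
  have hg1 : ∀ t : List ℤ, ∀ a ∈ t.map (fun a => g a.natAbs), -1 ≤ a := by
    intro t a ha
    obtain ⟨b, -, rfl⟩ := List.mem_map.1 ha
    exact hg _
  cases hN with
  | A L1 L2 As u t h =>
    have hnd := h.nodup
    rw [Multiset.cons_bind, nab_append, nab_cons, ← Multiset.singleton_add] at hnd
    have hk := key {x.natAbs} (nab u + nab t + nab M1 + nab M2 + As.bind nab)
      (by convert hnd using 1; abel) (by simp)
    rw [DxA hR h F (fun v w => valS g M1 M2 ((x :: v) ::ₘ (u ++ w) ::ₘ As)) ?_]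
    · unfold valS
      simp only [Multiset.map_cons, Multiset.prod_cons]
      rw [ws_congr (g := g') (g' := g) (L := M1) (fun k hk' => hk k (by simp [hk'])), ws_congr (g := g') (g' := g) (L := M2) (fun k hk' => hk k (by simp [hk'])),
        prod_congr (g := g') (g' := g) (fun k hk' => hk k (by simp [hk'])),
        show fA g' (u ++ x :: t) = fhI 0 (u.map (fun a => g a.natAbs) ++ (g x.natAbs + 1) :: t.map (fun a => g a.natAbs)) by
          unfold fA
          rw [List.map_append, List.map_cons, hgx, map_congr_nab (g := g') (g' := g) (fun k hk' => hk k (by simp [hk'])),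
            map_congr_nab (g := g') (g' := g) (L := t) (fun k hk' => hk k (by simp [hk']))],
        ← numA _ _ _ (hg _) (hg1 t), List.length_map, Finset.sum_mul, Finset.mul_sum]
      refine Finset.sum_congr rfl (fun i _ => ?_)
      simp only [fA, List.map_cons, List.map_append, List.map_take, List.map_drop]
      ring
    · rintro v y w rfl
      exact hF _ _ _ _ (moveA h)
  | B1 L2 As t h =>
    have hnd := h.nodup
    rw [nab_cons, ← Multiset.singleton_add] at hnd
    have hk := key {x.natAbs} (nab t + nab M2 + Bs.bind nab)
      (by convert hnd using 1; abel) (by simp)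
    rw [DxB1 hR h F (fun v w => valS g w M2 ((x :: v) ::ₘ Bs)) ?_]
    · unfold valS
      simp only [Multiset.map_cons, Multiset.prod_cons]
      rw [ws_congr (g := g') (g' := g) (L := M2) (fun k hk' => hk k (by simp [hk'])),
        prod_congr (g := g') (g' := g) (fun k hk' => hk k (by simp [hk'])),
        show ws g' (x :: t) = g x.natAbs + 1 + (t.map (fun a => g a.natAbs)).sum by
          unfold ws
          rw [List.map_cons, List.sum_cons, hgx, map_congr_nab (g := g') (g' := g) (fun k hk' => hk k (by simp [hk']))],
        ← numB1 _ _ _ (hg _) (hg1 t), List.length_map, Finset.sum_mul]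
      refine Finset.sum_congr rfl (fun i _ => ?_)
      simp only [fA, ws, List.map_cons, List.map_append, List.map_take, List.map_drop]
      ring
    · rintro v w rfl
      exact hF _ _ _ _ (moveB1 h)
  | B2 L1 As t h =>
    have hnd := h.nodup
    rw [nab_cons, ← Multiset.singleton_add] at hnd
    have hk := key {x.natAbs} (nab t + nab M1 + Bs.bind nab)
      (by convert hnd using 1; abel) (by simp)
    have hJ : ∀ u y z, BL R σ (u ++ y :: z) → nab M1 = nab (u ++ y :: z) →
        F (rf x y * σ) = valS g [] [] ((x :: t ++ ((y :: z) ++ u)) ::ₘ Bs) := by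
      intro u y z h1 h2
      rw [hF _ _ _ _ (moveC' hR h h1 h2)]
      unfold valS
      simp only [Multiset.map_cons, Multiset.prod_cons]
      congr 2
      unfold fA
      rw [List.map_append, gneg, List.map_append, gneg, ← List.map_append, ← List.map_append]
    rw [DxB2 hR h F (fun v w => valS g M1 w ((x :: v) ::ₘ Bs))
      (fun u w => valS g [] [] ((x :: t ++ (w ++ u)) ::ₘ Bs))
      (fun u w => valS g [] [] ((x :: t ++ (w ++ u)) ::ₘ Bs)) ?_ ?_ ?_]
    · unfold valS
      simp only [Multiset.map_cons, Multiset.prod_cons]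
      rw [ws_congr (g := g') (g' := g) (L := M1) (fun k hk' => hk k (by simp [hk'])),
        prod_congr (g := g') (g' := g) (fun k hk' => hk k (by simp [hk'])),
        show ws g' (x :: t) = g x.natAbs + 1 + (t.map (fun a => g a.natAbs)).sum by
          unfold ws
          rw [List.map_cons, List.sum_cons, hgx, map_congr_nab (g := g') (g' := g) (fun k hk' => hk k (by simp [hk']))],
        show ws g M1 = (M1.map (fun a => g a.natAbs)).sum from rfl,
        ← numB2 _ _ _ (hg _) (hg1 t) (hg1 M1), List.length_map, List.length_map, add_mul, two_mul, add_mul,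
        Finset.sum_mul, Finset.sum_mul]
      have a0 : ann (ws g []) (ws g []) = 1 := by simp [ws, ann]
      congr 1
      · refine Finset.sum_congr rfl (fun i _ => ?_)
        simp only [fA, ws, List.map_cons, List.map_append, List.map_take, List.map_drop]
        ring
      · congr 1
        · refine Finset.sum_congr rfl (fun i _ => ?_)
          rw [a0, one_mul]
          simp only [fA, ws, List.map_cons, List.map_append, List.map_take, List.map_drop]
        · refine Finset.sum_congr rfl (fun i _ => ?_)
          rw [a0, one_mul]
          simp only [fA, ws, List.map_cons, List.map_append, List.map_take, List.map_drop, gneg]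
    · rintro v w rfl
      exact hF _ _ _ _ (moveB2 h)
    · rintro u y z e
      exact hJ u y z (e ▸ h.b1) (by rw [e])
    · rintro u y z e
      exact hJ u y z (e ▸ BL_neg hR h.hB h.b1) (by rw [← e, nab_neg])
end

set_option linter.unusedSectionVars false
set_option linter.unusedSimpArgs false
set_option linter.unusedVariables false

section
variable {n : ℕ} {R : ℤ → ℤ → Prop}

def gs (s : List ℤ) : ℕ → ℤ := fun k => ((s.map Int.natAbs).count k : ℤ) - 1

lemma gs_ge (s : List ℤ) (k : ℕ) : -1 ≤ gs s k := by unfold gs; omega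

lemma AL_one {A : List ℤ} (h : AL R 1 A) (hn : (nab A).Nodup) : ∃ a, A = [a] := by
  obtain ⟨h1, h2, -⟩ := h
  match A, h1, h2, hn with
  | [], h1, _, _ => exact absurd rfl h1
  | [a], _, _, _ => exact ⟨a, rfl⟩
  | a :: b :: l, _, h2, hn =>
    have := h2.1
    simp at this
    subst this
    simp [nab_cons] at hn

lemma BL_one {L : List ℤ} (h : BL R 1 L) (hn : (nab L).Nodup) (h0 : ∀ a ∈ L, a ≠ 0) : L = [] := by
  obtain ⟨h2, -⟩ := h
  match L, h2, hn, h0 with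
  | [], _, _, _ => rfl
  | [a], h2, _, h0 =>
    have := h2.1
    have h0 := h0 a (by simp)
    simp at this
    omega
  | a :: b :: l, h2, hn, _ =>
    have := h2.1
    simp at this
    subst this
    simp [nab_cons] at hn

lemma val_base {σ L1 L2 As} (h : Stt n R σ L1 L2 As) : delt σ = valS (gs []) L1 L2 As := by
  have g0 : gs [] = fun _ => -1 := by funext k; simp [gs]
  have hnd := h.nodup
  rw [g0]
  unfold delt
  split_ifs with hσ
  · subst hσ
    have s1 : ∀ a ∈ L1, a ≠ 0 := fun a ha => (h.mem_sgn (by have := mem_nab_of ha; simp [this])).1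
    have s2 : ∀ a ∈ L2, a ≠ 0 := fun a ha => (h.mem_sgn (by have := mem_nab_of ha; simp [this])).1
    have e1 := BL_one h.b1 (nd_left (nd_left hnd)) s1
    have e2 := BL_one h.b2 (nd_right (nd_left hnd)) s2
    unfold valS
    rw [Multiset.prod_eq_one]
    · subst e1 e2; simp [ws, ann]
    · intro z hz
      obtain ⟨A, hA, rfl⟩ := Multiset.mem_map.1 hz
      have hnA : (nab A).Nodup :=
        Multiset.nodup_of_le (Multiset.le_bind As hA) (nd_right hnd)
      obtain ⟨a, rfl⟩ := AL_one (h.cA A hA) hnA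
      simp [fA, fhI]
  · symm
    by_contra hv
    apply hσ
    unfold valS at hv
    have ha := left_ne_zero_of_mul hv
    have hp := right_ne_zero_of_mul hv
    have w : ∀ L : List ℤ, ws (fun _ => -1) L = -(L.length : ℤ) := by
      intro L; simp [ws]
    rw [w, w] at ha
    have l1 : L1.length = 0 := by unfold ann at ha; split_ifs at ha <;> omega
    have l2 : L2.length = 0 := by unfold ann at ha; split_ifs at ha <;> omega
    rw [List.length_eq_zero_iff] at l1 l2
    subst l1 l2
    have hA : ∀ A ∈ As, ∃ a, A = [a] := by
      intro A hA
      have h1 : fA (fun _ => -1) A ≠ 0 := by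
        intro e
        exact hp (Multiset.prod_eq_zero (Multiset.mem_map.2 ⟨A, hA, e⟩))
      have h2 := (h.cA A hA).ne
      match A, h1, h2 with
      | [], _, h2 => exact absurd rfl h2
      | [a], _, _ => exact ⟨a, rfl⟩
      | a :: b :: l, h1, _ => simp [fA, fhI] at h1
    ext a
    rw [Equiv.Perm.one_apply]
    by_cases hs : a ∈ signedSet n
    · have : a.natAbs ∈ nab [] + nab [] + As.bind nab := by rw [h.cov]; exact natAbs_signed.2 hs
      simp only [nab_nil, zero_add, Multiset.mem_bind] at this
      obtain ⟨A, hA', hk⟩ := this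
      obtain ⟨b, rfl⟩ := hA A hA'
      have hb := (h.cA _ hA').pth.1
      simp at hb
      obtain ⟨c, hc, e⟩ := mem_nab.1 hk
      simp at hc; subst hc
      rcases Int.natAbs_eq_natAbs_iff.1 e with e | e
      · rw [← e, hb]
      · have : a = -c := by omega
        rw [this, h.hB.1, hb]
    · exact h.hB.2 a hs

theorem Dl_val (hR : RP R) (s : List ℤ) (hs : ∀ x ∈ s, x ∈ signedSet n) :
    ∀ {σ L1 L2 As}, Stt n R σ L1 L2 As → Dl n R s delt σ = valS (gs s) L1 L2 As := by
  induction s with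
  | nil => intro σ L1 L2 As h; exact val_base h
  | cons x s ih =>
    intro σ L1 L2 As h
    have hs' : ∀ y ∈ s, y ∈ signedSet n := fun y hy => hs y (by simp [hy])
    refine step_val hR (gs s) (gs (x :: s)) (gs_ge s) _ (fun σ L1 L2 As h => ih hs' h) (hs x (by simp)) ?_ ?_ h
    · simp [gs]
    · intro k hk
      simp [gs, List.count_cons, Ne.symm hk]

/-! one-step sums -/
lemma A_last {A : List ℤ} (h : A ≠ []) : A = A.dropLast ++ [A.getLastD 0] := by
  rw [List.getLastD_eq_getLast?, List.getLast?_eq_some_getLast h]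
  exact (List.dropLast_append_getLast h).symm

lemma fhI_01 (f : ℤ → ℤ) (hf : ∀ a, f a = 0 ∨ f a = -1) (l : List ℤ) (z : ℤ) :
    fhI 0 ((l ++ [z]).map f) = 0 ∨ fhI 0 ((l ++ [z]).map f) = 1 := by
  induction l with
  | nil => rcases hf z with h | h <;> simp [fhI, h]
  | cons a l ih =>
    rcases hf a with h | h
    · simpa [fhI, h] using ih
    · left
      cases l <;> simp [fhI, h]

lemma fhI_iff (f : ℤ → ℤ) (hf : ∀ a, f a = 0 ∨ f a = -1) (l : List ℤ) (z : ℤ) :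
    fhI 0 ((l ++ [z]).map f) = 1 ↔ (∀ a ∈ l, f a = 0) ∧ f z = -1 := by
  induction l with
  | nil => rcases hf z with h | h <;> simp [fhI, h]
  | cons a l ih =>
    rcases hf a with h | h
    · simpa [fhI, h] using ih
    · constructor
      · intro e
        cases l <;> simp [fhI, h] at e
      · rintro ⟨h1, -⟩
        have := h1 a (by simp)
        omega

def gT (T : Finset ℤ) (k : ℕ) : ℤ := if (k : ℤ) ∈ T then 0 else -1

lemma gs_toList {T : Finset ℤ} (hT : T ⊆ Finset.Icc (1:ℤ) n) : gs T.toList = gT T := by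
  funext k
  unfold gs gT
  have hpos : ∀ x ∈ T.toList, 1 ≤ x := by
    intro x hx; have := hT (Finset.mem_toList.1 hx); rw [Finset.mem_Icc] at this; exact this.1
  have hnd : (T.toList.map Int.natAbs).Nodup := by
    refine List.Nodup.map_on ?_ T.nodup_toList
    intro x hx y hy e
    have := hpos x hx
    have := hpos y hy
    omega
  rw [List.Nodup.count hnd]
  have : k ∈ T.toList.map Int.natAbs ↔ (k : ℤ) ∈ T := by
    rw [List.mem_map]
    constructor
    · rintro ⟨a, ha, rfl⟩
      have := hpos a ha
      rw [Int.natAbs_of_nonneg (by omega)]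
      exact Finset.mem_toList.1 ha
    · intro h
      exact ⟨k, Finset.mem_toList.2 h, by simp⟩
  by_cases h : (k : ℤ) ∈ T
  · rw [if_pos (this.2 h), if_pos h]; rfl
  · rw [if_neg (fun h' => h (this.1 h')), if_neg h]; rfl

lemma ws_gT (T : Finset ℤ) (L : List ℤ) : ws (gT T) L ≤ 0 ∧
    (ws (gT T) L = 0 ↔ ∀ a ∈ L, (a.natAbs : ℤ) ∈ T) := by
  induction L with
  | nil => simp [ws]
  | cons a L ih =>
    have : ws (gT T) (a :: L) = gT T a.natAbs + ws (gT T) L := by simp [ws]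
    rw [this]
    simp only [List.mem_cons, forall_eq_or_imp, ← ih.2]
    have := ih.1
    by_cases h : (a.natAbs : ℤ) ∈ T
    · have e : gT T a.natAbs = 0 := if_pos h
      simp only [h, true_and, e]; omega
    · have e : gT T a.natAbs = -1 := if_neg h
      simp only [h, false_and, iff_false, e]; omega

def PT (L1 L2 : List ℤ) (As : Multiset (List ℤ)) (T : Finset ℤ) : Prop :=
  ((∀ a ∈ L1, (a.natAbs : ℤ) ∈ T) ∧ (∀ a ∈ L2, (a.natAbs : ℤ) ∈ T)) ∧
    ∀ A ∈ As, (∀ a ∈ A.dropLast, (a.natAbs : ℤ) ∈ T) ∧ ((A.getLastD 0).natAbs : ℤ) ∉ T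

open Classical in
lemma val_PT {σ L1 L2 As} (h : Stt n R σ L1 L2 As) (T : Finset ℤ) :
    valS (gT T) L1 L2 As = if PT L1 L2 As T then 1 else 0 := by
  have g01 : ∀ a : ℤ, gT T a.natAbs = 0 ∨ gT T a.natAbs = -1 := by
    intro a; unfold gT; split_ifs <;> simp
  have gz : ∀ a : ℤ, gT T a.natAbs = 0 ↔ (a.natAbs : ℤ) ∈ T := by
    intro a; unfold gT; split_ifs with h <;> simp only [h] <;> decide
  have gm : ∀ a : ℤ, gT T a.natAbs = -1 ↔ (a.natAbs : ℤ) ∉ T := by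
    intro a; unfold gT; split_ifs with h <;> simp only [h] <;> decide
  have hA : ∀ A ∈ As, (fA (gT T) A = 0 ∨ fA (gT T) A = 1) ∧ (fA (gT T) A = 1 ↔
      (∀ a ∈ A.dropLast, (a.natAbs : ℤ) ∈ T) ∧ ((A.getLastD 0).natAbs : ℤ) ∉ T) := by
    intro A hA
    have e := A_last (h.cA A hA).ne
    have h1 := fhI_01 (fun a => gT T a.natAbs) g01 A.dropLast (A.getLastD 0)
    have h2 := fhI_iff (fun a => gT T a.natAbs) g01 A.dropLast (A.getLastD 0)
    rw [← e] at h1 h2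
    simp only [gz, gm] at h2
    exact ⟨h1, h2⟩
  unfold valS
  obtain ⟨a1, b1⟩ := ws_gT T L1
  obtain ⟨a2, b2⟩ := ws_gT T L2
  split_ifs with hP
  · obtain ⟨⟨p1, p2⟩, p3⟩ := hP
    rw [b1.2 p1, b2.2 p2, Multiset.prod_eq_one]
    · simp [ann]
    · intro z hz
      obtain ⟨A, hA', rfl⟩ := Multiset.mem_map.1 hz
      exact (hA A hA').2.2 (p3 A hA')
  · by_contra hv
    apply hP
    have ha := left_ne_zero_of_mul hv
    have hp := right_ne_zero_of_mul hv
    refine ⟨⟨b1.1 ?_, b2.1 ?_⟩, ?_⟩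
    · unfold ann at ha; split_ifs at ha <;> omega
    · unfold ann at ha; split_ifs at ha <;> omega
    · intro A hA'
      refine (hA A hA').2.1 ?_
      rcases (hA A hA').1 with h0 | h0
      · exact absurd (Multiset.prod_eq_zero (Multiset.mem_map.2 ⟨A, hA', h0⟩)) hp
      · exact h0

open Classical in
lemma PT_unique {σ L1 L2 As} (h : Stt n R σ L1 L2 As) :
    ∃ T0 ∈ (Finset.Icc (1:ℤ) n).powerset, ∀ T ∈ (Finset.Icc (1:ℤ) n).powerset,
      PT L1 L2 As T ↔ T = T0 := by
  have hnd := h.nodup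
  refine ⟨(Finset.Icc (1:ℤ) n).filter (fun k => ¬ ∃ A ∈ As, ((A.getLastD 0).natAbs : ℤ) = k),
    Finset.mem_powerset.2 (Finset.filter_subset _ _), ?_⟩
  have lm : ∀ A ∈ As, (A.getLastD 0).natAbs ∈ nab A := by
    intro A hA
    have e := A_last (h.cA A hA).ne
    refine mem_nab_of ?_
    rw [e]; simp
  have sI : ∀ a : ℤ, a.natAbs ∈ nab L1 + nab L2 + As.bind nab → (a.natAbs : ℤ) ∈ Finset.Icc (1:ℤ) n := by
    intro a ha
    rw [h.cov, Finset.mem_val, Finset.mem_Icc] at ha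
    rw [Finset.mem_Icc]; omega
  intro T hT
  rw [Finset.mem_powerset] at hT
  constructor
  · rintro ⟨⟨h1, h2⟩, h3⟩
    ext k
    rw [Finset.mem_filter]
    constructor
    · intro hk
      refine ⟨hT hk, ?_⟩
      rintro ⟨A, hA, rfl⟩
      exact (h3 A hA).2 hk
    · rintro ⟨hk, hk'⟩
      rw [Finset.mem_Icc] at hk
      have hk2 : k.natAbs ∈ nab L1 + nab L2 + As.bind nab := by
        rw [h.cov, Finset.mem_val, Finset.mem_Icc]; omega
      have hkk : (k.natAbs : ℤ) = k := by omega
      simp only [Multiset.mem_add, Multiset.mem_bind, mem_nab] at hk2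
      rcases hk2 with (⟨a, ha, e⟩ | ⟨a, ha, e⟩) | ⟨A, hA, a, ha, e⟩
      · rw [← hkk, ← e]; exact h1 a ha
      · rw [← hkk, ← e]; exact h2 a ha
      · rw [A_last (h.cA A hA).ne, List.mem_append, List.mem_singleton] at ha
        rcases ha with ha | ha
        · rw [← hkk, ← e]; exact (h3 A hA).1 a ha
        · exact absurd ⟨A, hA, by rw [← ha, e, hkk]⟩ hk'
  · rintro rfl
    have nl : ∀ k ∈ nab L1 + nab L2, ¬ ∃ A ∈ As, ((A.getLastD 0).natAbs : ℤ) = (k : ℕ) := by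
      rintro k hk ⟨A, hA, e⟩
      have e' : (A.getLastD 0).natAbs = k := by omega
      refine nd_dis hnd hk (Multiset.mem_bind.2 ⟨A, hA, ?_⟩)
      rw [← e']; exact lm A hA
    refine ⟨⟨?_, ?_⟩, ?_⟩
    · intro a ha
      have := mem_nab_of ha
      exact Finset.mem_filter.2 ⟨sI a (by simp [this]), nl _ (by simp [this])⟩
    · intro a ha
      have := mem_nab_of ha
      exact Finset.mem_filter.2 ⟨sI a (by simp [this]), nl _ (by simp [this])⟩
    · intro A hA
      constructor
      · intro a ha
        have haA := List.mem_of_mem_dropLast ha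
        refine Finset.mem_filter.2 ⟨sI a (by
          rw [Multiset.mem_add]; right; exact Multiset.mem_bind.2 ⟨A, hA, mem_nab_of haA⟩), ?_⟩
        rintro ⟨A', hA', e⟩
        have e' : (A'.getLastD 0).natAbs = a.natAbs := by omega
        obtain ⟨As', rfl⟩ := Multiset.exists_cons_of_mem hA
        have hnd2 := nd_right hnd
        rw [Multiset.cons_bind] at hnd2
        rcases Multiset.mem_cons.1 hA' with rfl | hA'
        · have := nd_left hnd2
          rw [A_last (h.cA A' hA).ne, nab_append] at this
          exact nd_dis this (mem_nab_of ha) (by rw [← e']; exact mem_nab_of (by simp))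
        · refine nd_dis hnd2 (mem_nab_of haA) (Multiset.mem_bind.2 ⟨A', hA', ?_⟩)
          rw [← e']; exact lm A' (by simp [hA'])
      · intro hm
        exact (Finset.mem_filter.1 hm).2 ⟨A, hA, rfl⟩

lemma hsum_one (hR : RP R) {σ L1 L2 As} (h : Stt n R σ L1 L2 As) :
    ∑ T ∈ (Finset.Icc (1:ℤ) n).powerset, Dl n R T.toList delt σ = 1 := by
  classical
  obtain ⟨T0, hT0, hu⟩ := PT_unique h
  rw [Finset.sum_congr rfl (g := fun T => if T = T0 then (1:ℤ) else 0)]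
  · rw [Finset.sum_ite_eq', if_pos hT0]
  · intro T hT
    have hTs := Finset.mem_powerset.1 hT
    rw [Dl_val hR _ ?_ h, gs_toList hTs, val_PT h]
    · simp only [hu T hT]
    · intro x hx
      have := hTs (Finset.mem_toList.1 hx)
      exact Icc_signed n this
end

set_option linter.unusedSectionVars false
set_option linter.unusedSimpArgs false
set_option linter.unusedVariables false

/-- orientation -/
def tri (p : ℕ) (x y : ℤ) : Prop :=
  y = -x ∨ (((0 < x ∧ y < 0) ∨ (x < 0 ∧ 0 < y)) ∧ y.natAbs < x.natAbs) ∨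
    (((0 < x ∧ 0 < y) ∨ (x < 0 ∧ y < 0)) ∧
      (((x.natAbs ≤ p ∧ y.natAbs ≤ p) ∧ x.natAbs < y.natAbs) ∨
       ((p < x.natAbs ∧ p < y.natAbs) ∧ x.natAbs < y.natAbs) ∨
       ((x.natAbs ≤ p ∧ p < y.natAbs) ∧ y.natAbs < x.natAbs) ∨
       ((p < x.natAbs ∧ y.natAbs ≤ p) ∧ y.natAbs < x.natAbs)))

lemma tri_RP (p : ℕ) : RP (tri p) where
  neg := by
    intro x y h; unfold tri at *
    rw [Int.natAbs_neg, Int.natAbs_neg]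
    omega
  asym := by intro x y h h1 h2; unfold tri at *; omega
  self := fun x => Or.inl rfl

lemma tri_total (p n : ℕ) : ∀ x y, x ∈ signedSet n → y ∈ signedSet n → x ≠ y → tri p x y ∨ tri p y x := by
  intro x y hx hy hxy
  have h1 : x ≠ 0 := hx.1
  have h2 : y ≠ 0 := hy.1
  by_cases h : y = -x
  · exact Or.inl (Or.inl h)
  rcases lt_or_gt_of_ne (show x.natAbs ≠ y.natAbs by omega) with h3 | h3 <;>
  rcases lt_or_gt_of_ne h1 with h4 | h4 <;> rcases lt_or_gt_of_ne h2 with h5 | h5 <;>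
  by_cases h6 : x.natAbs ≤ p <;> by_cases h7 : y.natAbs ≤ p <;>
  simp only [tri, h3, h4, h5, h6, h7, not_lt_of_gt h3, not_lt_of_gt h4, not_lt_of_gt h5, true_and, and_true, false_and, and_false, or_true, true_or, false_or, or_false] <;> omega

def Lst (s k : ℕ) : List ℤ := (List.range' s k).map (fun i : ℕ => (i : ℤ))

lemma Lst_succ (s k : ℕ) : Lst s (k + 1) = (s : ℤ) :: Lst (s + 1) k := by
  simp [Lst, List.range'_succ]

lemma Pth_Lst (σ : Equiv.Perm ℤ) (z : ℤ) : ∀ (k s : ℕ),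
    (∀ i, s ≤ i → i + 1 < s + k → σ (i : ℤ) = ((i + 1 : ℕ) : ℤ)) →
    (∀ i, i + 1 = s + k → s ≤ i → σ (i : ℤ) = z) → Pth σ (Lst s k) z := by
  intro k
  induction k with
  | zero => intro s _ _; trivial
  | succ k ih =>
    intro s h1 h2
    rw [Lst_succ]
    refine ⟨?_, ih (s + 1) (fun i hi hi' => h1 i (by omega) (by omega)) (fun i hi hi' => h2 i (by omega) (by omega))⟩
    cases k with
    | zero => exact h2 s (by omega) (by omega)
    | succ k =>
      rw [Lst_succ, List.headD_cons]
      exact h1 s (by omega) (by omega)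

lemma Lst_nab (s k : ℕ) : nab (Lst s k) = (List.range' s k : List ℕ) := by
  simp [nab, Lst, Function.comp_def]

lemma Lst_pw (p s k : ℕ) (hs : 1 ≤ s) (h : s + k ≤ p + 1 ∨ p < s) :
    (Lst s k).Pairwise (fun x y => tri p x y ∧ tri p y (-x)) := by
  unfold Lst
  rw [List.pairwise_map]
  have h1 : (List.range' s k).Pairwise (fun a b => a < b) := List.pairwise_lt_range'
  rw [List.Pairwise.iff_of_mem (S := fun a b : ℕ => tri p a b ∧ tri p b (-(a:ℤ)))] at h1
  · exact h1
  · intro a b ha hb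
    rw [List.mem_range'_1] at ha hb
    unfold tri
    omega

lemma gamma_Stt (p q : ℕ) (hp : 1 ≤ p) (hq : 1 ≤ q) :
    Stt (p + q) (tri p) (gammaPQ p q) (Lst 1 p) (Lst (p + 1) q) 0 := by
  refine ⟨gamma_inB p q, by simp, ⟨?_, Lst_pw p 1 p le_rfl (by omega)⟩,
    ⟨?_, Lst_pw p (p+1) q (by omega) (by omega)⟩, ?_, ?_⟩
  · apply Pth_Lst
    · intro i h1 h2
      rw [gamma_fst p q _ (by rw [abs_of_nonneg (by omega)]; omega)]
      have := cyc_pos p 0 (i - 1) (by omega)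
      convert this using 2 <;> push_cast <;> omega
    · intro i h1 h2
      rw [gamma_fst p q _ (by rw [abs_of_nonneg (by omega)]; omega)]
      have := cyc_pos_last p 0 (i - 1) (by omega)
      obtain ⟨p', rfl⟩ : ∃ p', p = p' + 1 := ⟨p - 1, by omega⟩
      rw [Lst_succ, List.headD_cons]
      convert this using 2 <;> push_cast <;> omega
  · apply Pth_Lst
    · intro i h1 h2
      rw [gamma_snd p q _ (by rw [abs_of_nonneg (by omega)]; omega)]
      have := cyc_pos q p (i - (p + 1)) (by omega)
      convert this using 2 <;> push_cast <;> omega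
    · intro i h1 h2
      rw [gamma_snd p q _ (by rw [abs_of_nonneg (by omega)]; omega)]
      have := cyc_pos_last q p (i - (p + 1)) (by omega)
      obtain ⟨q', rfl⟩ : ∃ q', q = q' + 1 := ⟨q - 1, by omega⟩
      rw [Lst_succ, List.headD_cons]
      convert this using 2 <;> push_cast <;> omega
  · intro a b ha hb
    rw [Lst_nab, Multiset.mem_coe, List.mem_range'_1] at ha hb
    unfold tri
    omega
  · rw [Lst_nab, Lst_nab, Multiset.zero_bind, add_zero, Multiset.coe_add]
    have : (Finset.Icc 1 (p + q)).val = ((List.range' 1 (p + q) : List ℕ) : Multiset ℕ) := by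
      rfl
    rw [this, add_comm p 1, List.range'_append_1]

/-! the final summation -/
lemma SumT_congr {n : ℕ} : ∀ (k : ℕ) (g g' : List ℤ → ℤ),
    (∀ s, (∀ x ∈ s, x ∈ Finset.Icc (1:ℤ) n) → g s = g' s) → SumT n k g = SumT n k g' := by
  intro k
  induction k with
  | zero => intro g g' h; exact h [] (by simp)
  | succ k ih =>
    intro g g' h
    simp only [SumT]
    refine Finset.sum_congr rfl (fun T hT => ih _ _ (fun s hs => h _ ?_))
    intro x hx
    rcases List.mem_append.1 hx with hx | hx
    · exact Finset.mem_powerset.1 hT (Finset.mem_toList.1 hx)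
    · exact hs x hx

def ca (p : ℕ) (s : List ℤ) : ℕ := s.countP (fun x => decide (x ≤ (p:ℤ)))
def cb (p : ℕ) (s : List ℤ) : ℕ := s.countP (fun x => decide ((p:ℤ) < x))

lemma ws_Lst (g : ℕ → ℤ) (s k : ℕ) : ws g (Lst s k) = ∑ i ∈ Finset.Ico s (s + k), g i := by
  rw [ws_nab, Lst_nab]
  have : (Finset.Ico s (s + k)).val = ((List.range' s k : List ℕ) : Multiset ℕ) := by
    show ((List.range' s (s + k - s) : List ℕ) : Multiset ℕ) = _
    rw [Nat.add_sub_cancel_left]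
  rw [← this]; rfl

lemma ws_gs (p q : ℕ) (s : List ℤ) (hs : ∀ x ∈ s, x ∈ Finset.Icc (1:ℤ) (p + q : ℕ)) :
    ws (gs s) (Lst 1 p) = (ca p s : ℤ) - p ∧ ws (gs s) (Lst (p + 1) q) = (cb p s : ℤ) - q := by
  rw [ws_Lst, ws_Lst]
  induction s with
  | nil => simp [gs, ca, cb]
  | cons x s ih =>
    obtain ⟨h1, h2⟩ := ih (fun y hy => hs y (by simp [hy]))
    have hx := hs x (by simp)
    rw [Finset.mem_Icc] at hx
    have e : ∀ k, gs (x :: s) k = gs s k + if x.natAbs = k then 1 else 0 := by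
      intro k
      simp only [gs, List.map_cons, List.count_cons, beq_iff_eq]
      split_ifs <;> push_cast <;> ring
    simp only [e, Finset.sum_add_distrib, Finset.sum_ite_eq, h1, h2]
    simp only [Finset.mem_Ico, ca, cb, List.countP_cons, decide_eq_true_eq]
    push_cast
    constructor <;> split_ifs <;> omega

noncomputable section
abbrev FF := ℕ → ℕ → ℤ
def S1 : Module.End ℤ FF := { toFun := fun φ a b => φ (a + 1) b, map_add' := fun _ _ => rfl, map_smul' := fun _ _ => rfl }
def S2 : Module.End ℤ FF := { toFun := fun φ a b => φ a (b + 1), map_add' := fun _ _ => rfl, map_smul' := fun _ _ => rfl }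

lemma S1_pow (i : ℕ) (φ : FF) (a b : ℕ) : (S1 ^ i) φ a b = φ (a + i) b := by
  induction i generalizing a with
  | zero => rfl
  | succ i ih =>
    rw [pow_succ', Module.End.mul_apply]
    show (S1 ^ i) φ (a + 1) b = _
    rw [ih]; congr 1; omega
lemma S2_pow (i : ℕ) (φ : FF) (a b : ℕ) : (S2 ^ i) φ a b = φ a (b + i) := by
  induction i generalizing b with
  | zero => rfl
  | succ i ih =>
    rw [pow_succ', Module.End.mul_apply]
    show (S2 ^ i) φ a (b + 1) = _
    rw [ih]; congr 1; omega

lemma S_comm : Commute (S1 + 1) (S2 + 1) := by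
  have : Commute S1 S2 := rfl
  exact (this.add_right (Commute.one_right _)).add_left ((Commute.one_left _))

lemma E_exp (S : Module.End ℤ FF) (N : ℕ) (φ : FF) (a b : ℕ) :
    ((S + 1) ^ N) φ a b = ∑ i ∈ Finset.range (N + 1), (N.choose i : ℤ) * (S ^ i) φ a b := by
  rw [(Commute.one_right S).add_pow, LinearMap.sum_apply, Finset.sum_apply, Finset.sum_apply]
  refine Finset.sum_congr rfl (fun i hi => ?_)
  rw [one_pow, mul_one, ← Nat.cast_comm, Module.End.mul_apply]
  simp [Module.End.natCast_apply]

lemma sum_pow (p : ℕ) (S : Finset ℤ) (φ : FF) (a b : ℕ) :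
    ∑ T ∈ S.powerset, φ (a + ca p T.toList) (b + cb p T.toList) =
      ((S1 + 1) ^ (S.filter (fun x => x ≤ (p:ℤ))).card * (S2 + 1) ^ (S.filter (fun x => (p:ℤ) < x)).card) φ a b := by
  classical
  induction S using Finset.induction_on generalizing φ with
  | empty => simp [ca, cb]
  | insert x S hx ih =>
    rw [Finset.sum_powerset_insert hx]
    have hc : ∀ T ∈ S.powerset, ∀ P : ℤ → Bool, (insert x T).toList.countP P =
        T.toList.countP P + if P x then 1 else 0 := by
      intro T hT P
      have hxT : x ∉ T := fun h => hx (Finset.mem_powerset.1 hT h)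
      rw [(Finset.toList_insert hxT).countP_eq, List.countP_cons]
    rw [Finset.filter_insert, Finset.filter_insert]
    by_cases h : x ≤ (p:ℤ)
    · rw [if_pos h, if_neg (by omega), Finset.card_insert_of_notMem (by simp [hx])]
      rw [← Finset.sum_add_distrib]
      have e := ih ((S1 + 1 : Module.End ℤ FF) φ)
      rw [← Module.End.mul_apply, mul_assoc, ← (S_comm.pow_right _).eq, ← mul_assoc, ← pow_succ] at e
      rw [← e]
      refine Finset.sum_congr rfl (fun T hT => ?_)
      have e1 : ca p (insert x T).toList = ca p T.toList + 1 := by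
        unfold ca; rw [hc T hT]; simp [h]
      have e2 : cb p (insert x T).toList = cb p T.toList := by
        unfold cb; rw [hc T hT]; simp [h]
      rw [e1, e2]
      exact add_comm _ _
    · rw [if_neg h, if_pos (by omega), Finset.card_insert_of_notMem (by simp [hx])]
      rw [← Finset.sum_add_distrib]
      have e := ih ((S2 + 1 : Module.End ℤ FF) φ)
      rw [← Module.End.mul_apply, mul_assoc, ← pow_succ] at e
      rw [← e]
      refine Finset.sum_congr rfl (fun T hT => ?_)
      have e1 : ca p (insert x T).toList = ca p T.toList := by
        unfold ca; rw [hc T hT]; simp [h]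
      have e2 : cb p (insert x T).toList = cb p T.toList + 1 := by
        unfold cb; rw [hc T hT]; simp; omega
      rw [e1, e2]
      exact add_comm _ _

lemma SumT_pow (p q k : ℕ) (φ : FF) (a b : ℕ) :
    SumT (p + q) k (fun s => φ (a + ca p s) (b + cb p s)) =
      ((S1 + 1) ^ (k * p) * (S2 + 1) ^ (k * q)) φ a b := by
  have c1 : ((Finset.Icc (1:ℤ) (p + q : ℕ)).filter (fun x => x ≤ (p:ℤ))).card = p := by
    have : (Finset.Icc (1:ℤ) (p + q : ℕ)).filter (fun x => x ≤ (p:ℤ)) = Finset.Icc 1 (p:ℤ) := by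
      ext x; simp only [Finset.mem_filter, Finset.mem_Icc]; omega
    rw [this, Int.card_Icc]; omega
  have c2 : ((Finset.Icc (1:ℤ) (p + q : ℕ)).filter (fun x => (p:ℤ) < x)).card = q := by
    have : (Finset.Icc (1:ℤ) (p + q : ℕ)).filter (fun x => (p:ℤ) < x) = Finset.Icc ((p:ℤ) + 1) (p + q : ℕ) := by
      ext x; simp only [Finset.mem_filter, Finset.mem_Icc]; omega
    rw [this, Int.card_Icc]; omega
  induction k generalizing a b with
  | zero => simp [SumT, ca, cb]
  | succ k ih =>
    simp only [SumT]
    have e : ∀ T : Finset ℤ, SumT (p + q) k (fun s => φ (a + ca p (T.toList ++ s)) (b + cb p (T.toList ++ s))) =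
        (((S1 + 1) ^ (k * p) * (S2 + 1) ^ (k * q)) φ) (a + ca p T.toList) (b + cb p T.toList) := by
      intro T
      rw [← ih]
      simp only [ca, cb, List.countP_append, add_assoc]
    rw [Finset.sum_congr rfl (fun T _ => e T), sum_pow, c1, c2, ← Module.End.mul_apply]
    congr 3
    rw [mul_assoc, ← mul_assoc _ _ ((S2 + 1) ^ (k * q)), ← (S_comm.pow_pow _ _).eq, mul_assoc, ← mul_assoc,
      ← pow_add, ← pow_add, Nat.succ_mul, Nat.succ_mul, add_comm p, add_comm q]

lemma SumT_val (p q m : ℕ) (φ : FF) :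
    SumT (p + q) m (fun s => φ (ca p s) (cb p s)) =
      ∑ i ∈ Finset.range (m * p + 1), ∑ j ∈ Finset.range (m * q + 1),
        ((m * p).choose i : ℤ) * (((m * q).choose j : ℤ) * φ i j) := by
  have := SumT_pow p q m φ 0 0
  simp only [Nat.zero_add] at this
  rw [this, Module.End.mul_apply, E_exp]
  refine Finset.sum_congr rfl (fun i _ => ?_)
  rw [S1_pow, E_exp, Finset.mul_sum]
  refine Finset.sum_congr rfl (fun j _ => ?_)
  rw [S2_pow, Nat.zero_add, Nat.zero_add]
end

lemma ann_row_sum (p q N : ℕ) (i : ℕ) :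
    ∑ j ∈ Finset.range (N + 1), ((N.choose j : ℤ) * ann ((i:ℤ) - p) ((j:ℤ) - q)) =
      if i ≤ p then (N.choose (q + (p - i)) : ℤ) * (if i = p then 1 else 2 * ((p - i : ℕ) : ℤ)) else 0 := by
  split_ifs with h1 h2
  · subst h2
    rw [Finset.sum_eq_single q]
    · simp [ann]
    · intro j _ hj
      rw [ann, if_pos (by omega), mul_zero]
    · intro h
      rw [Nat.choose_eq_zero_of_lt (by simpa using h)]; simp
  · rw [Finset.sum_eq_single (q + (p - i))]
    · rw [ann, if_neg (by omega), if_neg (by omega), if_pos (by omega)]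
      congr 2; omega
    · intro j _ hj
      rw [ann, if_pos (by omega), mul_zero]
    · intro h
      rw [Nat.choose_eq_zero_of_lt (by simpa using h)]; simp
  · refine Finset.sum_eq_zero (fun j _ => ?_)
    unfold ann
    split_ifs <;> first | omega | simp

lemma final_sum (p q m : ℕ) (hm : 2 ≤ m) :
    ∑ i ∈ Finset.range (m * p + 1), ∑ j ∈ Finset.range (m * q + 1),
        ((m * p).choose i : ℤ) * (((m * q).choose j : ℤ) * ann ((i:ℤ) - p) ((j:ℤ) - q)) =
      ((Nat.choose (m * p) p * Nat.choose (m * q) q +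
        ∑ c ∈ Finset.Icc 1 p,
          2 * c * Nat.choose (m * p) (p - c) * Nat.choose (m * q) (q + c) : ℕ) : ℤ) := by
  simp only [← Finset.mul_sum, ann_row_sum]
  have hle : p + 1 ≤ m * p + 1 := by nlinarith
  rw [← Finset.sum_subset (Finset.range_mono hle)
    (by intro i _ hi; rw [if_neg (by simpa using hi), mul_zero])]
  rw [← Finset.sum_range_reflect, Finset.sum_range_succ', add_comm]
  rw [Nat.cast_add, Nat.cast_mul, Nat.cast_sum]
  congr 1
  · simp
  · rw [Finset.range_eq_Ico, Finset.sum_Ico_add' (fun c => ((m * p).choose (p + 1 - 1 - c) : ℤ) *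
        if p + 1 - 1 - c ≤ p then (((m * q).choose (q + (p - (p + 1 - 1 - c))) : ℕ) : ℤ) *
          (if p + 1 - 1 - c = p then 1 else 2 * ((p - (p + 1 - 1 - c) : ℕ) : ℤ)) else 0) 0 p 1]
    refine Finset.sum_congr (by ext; simp only [Finset.mem_Ico, Finset.mem_Icc]; omega) (fun c hc => ?_)
    rw [Finset.mem_Icc] at hc
    rw [if_pos (by omega), if_neg (by omega)]
    have : p - (p + 1 - 1 - c) = c := by omega
    rw [this, Nat.add_sub_cancel]; push_cast; ring

/-- For `m ≥ 2`, the number of multichains `π_1 ≤ ⋯ ≤ π_{m-1}` in `NC^B(p,q)`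
equals `C(mp,p)·C(mq,q) + Σ_{c=1}^{p} 2c·C(mp,p-c)·C(mq,q+c)`
(the zeta polynomial of `NC^B(p,q)`). -/
theorem ncb_zeta (p q m : ℕ) (hp : 1 ≤ p) (hq : 1 ≤ q) (hm : 2 ≤ m) :
    {f : Fin (m - 1) → Set (Set ℤ) |
        (∀ i, f i ∈ NCB p q) ∧
        (∀ i j : Fin (m - 1), i ≤ j → refines (f i) (f j))}.ncard =
      Nat.choose (m * p) p * Nat.choose (m * q) q +
        ∑ c ∈ Finset.Icc 1 p,
          2 * c * Nat.choose (m * p) (p - c) * Nat.choose (m * q) (q + c) := by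
  have h1 := count_eq p q m hm (tri p) (fun σ => ∃ L1 L2 As, Stt (p + q) (tri p) σ L1 L2 As)
    (fun σ ⟨L1, L2, As, h⟩ => h.1)
    (fun σ x y ⟨L1, L2, As, h⟩ hx hy hxy hr hl => St_move (tri_RP p) h hx hy hxy hr hl)
    (tri_total p (p + q))
    (fun σ ⟨L1, L2, As, h⟩ => hsum_one (tri_RP p) h)
    ⟨_, _, _, gamma_Stt p q hp hq⟩
  rw [SumT_congr m _ (fun s => (fun i j : ℕ => ann ((i:ℤ) - p) ((j:ℤ) - q)) (ca p s) (cb p s)) ?_,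
    SumT_val p q m (fun i j : ℕ => ann ((i:ℤ) - p) ((j:ℤ) - q)), final_sum p q m hm] at h1
  · exact_mod_cast h1
  · intro s hs
    rw [Dl_val (tri_RP p) s (fun x hx => Icc_signed (p + q) (hs x hx)) (gamma_Stt p q hp hq)]
    simp only [valS, Multiset.map_zero, Multiset.prod_zero, mul_one, (ws_gs p q s hs).1, (ws_gs p q s hs).2]
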